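/- Let Ω be a pseudoconvex domain in ℂⁿ, let p be a strictly pseudoconvex boundary point of Ω of class C², and let V be a bounded neighborhood of p. Then there exist a neighborhood U ⊆ V of p and a constant C > 0 such that for every z ∈ Ω ∩ U and all nonzero X, Y ∈ ℂⁿ, 1 ≥ J²_Ω(z;X,Y)/J²_{Ω∩V}(z;X,Y) ≥ 1 + C·δ_Ω(z)·log δ_Ω(z). -/

import Mathlib

open Metric MeasureTheory Set
open scoped NNReal ENNReal

noncomputable section

/-- Complex Euclidean `n`-space. -/
abbrev Cn (n : ℕ) := EuclideanSpace ℂ (Fin n)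

variable {n : ℕ}

instance : MeasurableSpace (Cn n) := borel _
instance : BorelSpace (Cn n) := ⟨rfl⟩
instance : InnerProductSpace ℝ (Cn n) := InnerProductSpace.rclikeToReal ℂ _

/-- `δ_Ω(z)`: the Euclidean distance from `z` to the boundary of `Ω`. -/
def bdist (Ω : Set (Cn n)) (z : Cn n) : ℝ := Metric.infDist z (frontier Ω)

/-- The squeezing function `σ_Ω(z)` of a (bounded) domain `Ω`. -/
def squeezing (Ω : Set (Cn n)) (z : Cn n) : ℝ :=
  sSup {r : ℝ | 0 < r ∧ ∃ f : Cn n → Cn n,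
    DifferentiableOn ℂ f Ω ∧ Set.InjOn f Ω ∧ Set.MapsTo f Ω (Metric.ball 0 1) ∧
    f z = 0 ∧ Metric.ball (0 : Cn n) r ⊆ f '' Ω}

/-- The Kobayashi metric `κ_Ω(z;X)`. -/
def kobayashi (Ω : Set (Cn n)) (z X : Cn n) : ℝ :=
  sInf {r : ℝ | ∃ (α : ℂ) (φ : ℂ → Cn n),
    DifferentiableOn ℂ φ (Metric.ball 0 1) ∧ Set.MapsTo φ (Metric.ball 0 1) Ω ∧
    φ 0 = z ∧ α • deriv φ 0 = X ∧ r = ‖α‖}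

/-- The Carathéodory metric `γ_Ω(z;X)`. -/
def caratheodory (Ω : Set (Cn n)) (z X : Cn n) : ℝ :=
  sSup {r : ℝ | ∃ f : Cn n → ℂ,
    DifferentiableOn ℂ f Ω ∧ Set.MapsTo f Ω (Metric.ball 0 1) ∧
    r = ‖fderiv ℂ f z X‖}

/-- `⟨∂ρ(q),X⟩ = Σ_j (∂ρ/∂z_j)(q) X_j`, expressed via the real differential:
`⟨∂ρ(q),X⟩ = (Dρ(q)X - i·Dρ(q)(iX))/2`. -/
def cderiv (ρ : Cn n → ℝ) (q X : Cn n) : ℂ :=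
  (((fderiv ℝ ρ q X : ℝ) : ℂ) - Complex.I * ((fderiv ℝ ρ q (Complex.I • X) : ℝ) : ℂ)) / 2

/-- The Levi form `L_ρ(q;X) = Σ_{j,k} (∂²ρ/∂z_j∂z̄_k)(q) X_j X̄_k`, expressed via the real
second differential: `L_ρ(q;X) = (D²ρ(q)[X,X] + D²ρ(q)[iX,iX])/4`. -/
def leviForm (ρ : Cn n → ℝ) (q X : Cn n) : ℝ :=
  (fderiv ℝ (fun w => fderiv ℝ ρ w X) q X
    + fderiv ℝ (fun w => fderiv ℝ ρ w (Complex.I • X)) q (Complex.I • X)) / 4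

/-- `p` is a strictly pseudoconvex boundary point of `Ω` of class `C^{m,ε}`. -/
def IsStrictPscPtHolder (Ω : Set (Cn n)) (p : Cn n) (m : ℕ) (ε : ℝ) : Prop :=
  p ∈ frontier Ω ∧ ∃ W : Set (Cn n), IsOpen W ∧ p ∈ W ∧ ∃ ρ : Cn n → ℝ,
    ContDiffOn ℝ m ρ W ∧
    (∃ C : ℝ≥0, HolderOnWith C ε.toNNReal (iteratedFDeriv ℝ m ρ) W) ∧
    Ω ∩ W = {z ∈ W | ρ z < 0} ∧
    (∀ q ∈ frontier Ω ∩ W, fderiv ℝ ρ q ≠ 0) ∧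
    (∀ q ∈ frontier Ω ∩ W, ∀ X : Cn n, X ≠ 0 → cderiv ρ q X = 0 → 0 < leviForm ρ q X)

/-- `p` is a strictly pseudoconvex boundary point of `Ω` of class `C²`. -/
def IsStrictPscPtC2 (Ω : Set (Cn n)) (p : Cn n) : Prop :=
  p ∈ frontier Ω ∧ ∃ W : Set (Cn n), IsOpen W ∧ p ∈ W ∧ ∃ ρ : Cn n → ℝ,
    ContDiffOn ℝ 2 ρ W ∧
    Ω ∩ W = {z ∈ W | ρ z < 0} ∧
    (∀ q ∈ frontier Ω ∩ W, fderiv ℝ ρ q ≠ 0) ∧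
    (∀ q ∈ frontier Ω ∩ W, ∀ X : Cn n, X ≠ 0 → cderiv ρ q X = 0 → 0 < leviForm ρ q X)

/-- An open set `D ⊆ ℂⁿ` is pseudoconvex: `u = -log dist(·, Dᶜ)` is plurisubharmonic on `D`. -/
def IsPseudoconvex (D : Set (Cn n)) : Prop :=
  IsOpen D ∧
  UpperSemicontinuousOn (fun z => -Real.log (Metric.infDist z Dᶜ)) D ∧
  ∀ a ∈ D, ∀ w : Cn n, ∀ r : ℝ, 0 < r →
    (∀ l : ℂ, ‖l‖ ≤ r → a + l • w ∈ D) →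
    -Real.log (Metric.infDist a Dᶜ) ≤
      (1 / (2 * Real.pi)) * ∫ θ in (0:ℝ)..(2 * Real.pi),
        -Real.log (Metric.infDist (a + ((r : ℂ) * Complex.exp (θ * Complex.I)) • w) Dᶜ)

/-- `cl(Ω)` admits a Stein neighborhood basis. -/
def HasSteinBasis (Ω : Set (Cn n)) : Prop :=
  ∀ W : Set (Cn n), IsOpen W → closure Ω ⊆ W →
    ∃ U : Set (Cn n), IsPseudoconvex U ∧ closure Ω ⊆ U ∧ U ⊆ W

/-- The squared `L²`-norm of `f` on `D` (as an extended nonnegative real). -/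
def L2normSq (D : Set (Cn n)) (f : Cn n → ℂ) : ℝ≥0∞ := ∫⁻ w in D, (‖f w‖₊ : ℝ≥0∞) ^ 2

/-- `J⁰_D(z) = sup {|f(z)|² : f ∈ L²_h(D), ‖f‖_D ≤ 1}`; equals the Bergman kernel on the
diagonal. -/
def J0 (D : Set (Cn n)) (z : Cn n) : ℝ :=
  sSup {v : ℝ | ∃ f : Cn n → ℂ, DifferentiableOn ℂ f D ∧ L2normSq D f ≤ 1 ∧ v = ‖f z‖ ^ 2}

/-- `J¹_D(z;X) = sup {|f'(z)X|² : f ∈ L²_h(D), ‖f‖_D ≤ 1, f(z) = 0}`. -/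
def J1 (D : Set (Cn n)) (z X : Cn n) : ℝ :=
  sSup {v : ℝ | ∃ f : Cn n → ℂ, DifferentiableOn ℂ f D ∧ L2normSq D f ≤ 1 ∧ f z = 0 ∧
    v = ‖fderiv ℂ f z X‖ ^ 2}

/-- `J²_D(z;X,Y) = sup {|Σ_{j,k} f_{ζ_jζ_k}(z) X_j Y_k|² : f ∈ L²_h(D), ‖f‖_D ≤ 1,
f(z) = 0, f'(z) = 0}`. -/
def J2 (D : Set (Cn n)) (z X Y : Cn n) : ℝ :=
  sSup {v : ℝ | ∃ f : Cn n → ℂ, DifferentiableOn ℂ f D ∧ L2normSq D f ≤ 1 ∧ f z = 0 ∧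
    fderiv ℂ f z = 0 ∧ v = ‖fderiv ℂ (fun w => fderiv ℂ f w Y) z X‖ ^ 2}

/-- The Bergman metric `β_D(z;X) = (J¹_D(z;X)/J⁰_D(z))^{1/2}`. -/
def bergman (D : Set (Cn n)) (z X : Cn n) : ℝ := Real.sqrt (J1 D z X / J0 D z)

/-- The bisectional curvature of the Bergman metric. -/
def bisect (D : Set (Cn n)) (z X Y : Cn n) : ℝ :=
  2 - J0 D z * J2 D z X Y / (J1 D z X * J1 D z Y)

/-- The holomorphic sectional curvature `s_D(z;X)` of the Bergman metric. -/
def sectCurv (D : Set (Cn n)) (z X : Cn n) : ℝ := bisect D z X X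

/-- The Ricci curvature `r_D(z;X)` of the Bergman metric (w.r.t. the standard basis). -/
def ricciCurv (D : Set (Cn n)) (z X : Cn n) : ℝ :=
  ∑ j : Fin n, bisect D z (EuclideanSpace.single j 1) X

/-- The scalar curvature `t_D(z)` of the Bergman metric. -/
def scalarCurv (D : Set (Cn n)) (z : Cn n) : ℝ :=
  ∑ j : Fin n, ricciCurv D z (EuclideanSpace.single j 1)

/-- `M(z;X) = ( |⟨∂δ_Ω(z),X⟩|²/δ_Ω(z)² + L(z;X)/δ_Ω(z) )^{1/2}`, where `L` is the Levi form
of `-δ_Ω`. -/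
def Mfun (Ω : Set (Cn n)) (z X : Cn n) : ℝ :=
  Real.sqrt ((‖cderiv (bdist Ω) z X‖) ^ 2 / (bdist Ω z) ^ 2
    + leviForm (fun w => -(bdist Ω w)) z X / bdist Ω z)

/-- The sesquilinear form of the Bergman metric, recovered from `β²` by polarization. -/
def bergForm (D : Set (Cn n)) (z X Y : Cn n) : ℂ :=
  (((J1 D z (X + Y) / J0 D z : ℝ) : ℂ) - ((J1 D z (X - Y) / J0 D z : ℝ) : ℂ)
    + Complex.I * ((J1 D z (X + Complex.I • Y) / J0 D z : ℝ) : ℂ)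
    - Complex.I * ((J1 D z (X - Complex.I • Y) / J0 D z : ℝ) : ℂ)) / 4

/-- The Hermitian matrix `(B_{jk}(z))` of the Bergman metric in the standard coordinates. -/
def bergMat (D : Set (Cn n)) (z : Cn n) : Matrix (Fin n) (Fin n) ℂ :=
  fun j k => bergForm D z (EuclideanSpace.single j 1) (EuclideanSpace.single k 1)

/-- The canonical Bergman invariant `J_D(z) = Δ_D(z)/K_D(z)`. -/
def canonInvariant (D : Set (Cn n)) (z : Cn n) : ℂ :=
  (bergMat D z).det / ((J0 D z : ℝ) : ℂ)

section
open Filter Topology ComplexConjugate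
open Complex (I)
local notation "EC" => Cn n
local notation "FC" => Cn n → ℂ
local notation "FR" => Cn n → ℝ
local notation "SC" => Set (Cn n)
local notation "bp" => (by positivity)
local notation "bn" => (by norm_num)
instance : NormedSpace ℝ EC := inferInstance
instance : Module ℝ EC := inferInstance
instance : ContinuousSMul ℝ EC := inferInstance
instance : MeasureSpace EC := inferInstance
instance : NormedSpace ℂ EC := inferInstance
instance : Module ℂ EC := inferInstance
instance : ContinuousSMul ℂ EC := inferInstance


def db (X : EC) (f : FC) (x : EC) : ℂ :=
  (fderiv ℝ f x X + I * fderiv ℝ f x (I • X)) / 2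
def dz (X : EC) (f : FC) (x : EC) : ℂ :=
  (fderiv ℝ f x X - I * fderiv ℝ f x (I • X)) / 2
def ee (j : Fin n) : EC := EuclideanSpace.single j 1

lemma db_mul {f g : FC} {x X : EC} (hf : DifferentiableAt ℝ f x)
    (hg : DifferentiableAt ℝ g x) :
    db X (fun y => f y * g y) x = f x * db X g x + db X f x * g x := by
  simp only [db, fderiv_fun_mul hf hg, add_apply, smul_apply, smul_eq_mul]; ring

lemma dz_mul {f g : FC} {x X : EC} (hf : DifferentiableAt ℝ f x)
    (hg : DifferentiableAt ℝ g x) :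
    dz X (fun y => f y * g y) x = f x * dz X g x + dz X f x * g x := by
  simp only [dz, fderiv_fun_mul hf hg, add_apply, smul_apply, smul_eq_mul]; ring

lemma db_sub {f g : FC} {x X : EC} (hf : DifferentiableAt ℝ f x)
    (hg : DifferentiableAt ℝ g x) : db X (fun y => f y - g y) x = db X f x - db X g x := by
  simp only [db, fderiv_fun_sub hf hg, sub_apply]; ring

lemma fderiv_conj {f : FC} {x X : EC} (hf : DifferentiableAt ℝ f x) :
    fderiv ℝ (fun y => conj (f y)) x X = conj (fderiv ℝ f x X) := by
  have := (Complex.conjCLE.hasFDerivAt (x := f x)).comp x hf.hasFDerivAt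
  rw [show (fun y => conj (f y)) = (⇑Complex.conjCLE ∘ f) from rfl, this.fderiv]; rfl

lemma db_conj {f : FC} {x X : EC} (hf : DifferentiableAt ℝ f x) :
    db X (fun y => conj (f y)) x = conj (dz X f x) := by
  simp only [db, dz, fderiv_conj hf, map_div₀, map_sub, map_mul, Complex.conj_I, map_ofNat]; ring

lemma dz_conj {f : FC} {x X : EC} (hf : DifferentiableAt ℝ f x) :
    dz X (fun y => conj (f y)) x = conj (db X f x) := by
  simp only [db, dz, fderiv_conj hf, map_div₀, map_add, map_mul, Complex.conj_I, map_ofNat]; ring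

lemma cont_fd {f : FC} (hf : ContDiff ℝ 1 f) (X : EC) :
    Continuous fun x => fderiv ℝ f x X :=
  (hf.continuous_fderiv one_ne_zero).clm_apply continuous_const
lemma cont_db {f : FC} (hf : ContDiff ℝ 1 f) (X : EC) : Continuous (db X f) := by
  have := cont_fd hf; unfold db; fun_prop
lemma cont_dz {f : FC} (hf : ContDiff ℝ 1 f) (X : EC) : Continuous (dz X f) := by
  have := cont_fd hf; unfold dz; fun_prop
lemma c1_fd {f : FC} (hf : ContDiff ℝ 2 f) (X : EC) :
    ContDiff ℝ 1 fun x => fderiv ℝ f x X :=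
  (hf.fderiv_right (m := 1) bn).clm_apply contDiff_const
lemma c1_db {f : FC} (hf : ContDiff ℝ 2 f) (X : EC) : ContDiff ℝ 1 (db X f) := by
  have := c1_fd hf; unfold db; fun_prop
lemma c1_dz {f : FC} (hf : ContDiff ℝ 2 f) (X : EC) : ContDiff ℝ 1 (dz X f) := by
  have := c1_fd hf; unfold dz; fun_prop
lemma hcs_db {f : FC} (hf : HasCompactSupport f) (X : EC) : HasCompactSupport (db X f) := by
  refine (hf.fderiv ℝ).mono fun x hx => ?_
  contrapose! hx
  simp only [Function.mem_support, not_not] at hx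
  simp [db, hx]
lemma hcs_dz {f : FC} (hf : HasCompactSupport f) (X : EC) : HasCompactSupport (dz X f) := by
  refine (hf.fderiv ℝ).mono fun x hx => ?_
  contrapose! hx
  simp only [Function.mem_support, not_not] at hx
  simp [dz, hx]

lemma ibp_fd {f g : FC} (X : EC) (hf : ContDiff ℝ 1 f) (hg : ContDiff ℝ 1 g)
    (hc : HasCompactSupport g) : ∫ x, f x * fderiv ℝ g x X = - ∫ x, fderiv ℝ f x X * g x := by
  refine integral_mul_fderiv_eq_neg_fderiv_mul_of_integrable
     (((cont_fd hf X).mul hg.continuous).integrable_of_hasCompactSupport hc.mul_left)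
     ((hf.continuous.mul (cont_fd hg X)).integrable_of_hasCompactSupport
       (hc.fderiv_apply ℝ X).mul_left)
     ((hf.continuous.mul hg.continuous).integrable_of_hasCompactSupport hc.mul_left)
     (fun x _ => hf.differentiable one_ne_zero x) (fun x _ => hg.differentiable one_ne_zero x)

lemma ibp_db {f g : FC} (X : EC) (hf : ContDiff ℝ 1 f) (hg : ContDiff ℝ 1 g)
    (hc : HasCompactSupport g) : ∫ x, f x * db X g x = - ∫ x, db X f x * g x := by
  have i1 : ∀ Y, Integrable (fun x => f x * fderiv ℝ g x Y) := fun Y =>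
    (hf.continuous.mul (cont_fd hg Y)).integrable_of_hasCompactSupport
    (hc.fderiv_apply ℝ Y).mul_left
  have i2 : ∀ Y, Integrable (fun x => fderiv ℝ f x Y * g x) := fun Y =>
    ((cont_fd hf Y).mul hg.continuous).integrable_of_hasCompactSupport hc.mul_left
  have e1 : ∀ x, f x * db X g x = (f x * fderiv ℝ g x X) * (1/2) +
     (f x * fderiv ℝ g x (I • X)) * (I/2) := fun x => by simp only [db]; ring
  have e2 : ∀ x, db X f x * g x = (fderiv ℝ f x X * g x) * (1/2) +
     (fderiv ℝ f x (I • X) * g x) * (I/2) := fun x => by simp only [db]; ring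
  simp only [e1, e2]
  rw [integral_add ((i1 X).mul_const _) ((i1 (I • X)).mul_const _),
    integral_add ((i2 X).mul_const _) ((i2 (I • X)).mul_const _)]
  simp only [integral_mul_const, ibp_fd _ hf hg hc]; ring

lemma ibp_dz {f g : FC} (X : EC) (hf : ContDiff ℝ 1 f) (hg : ContDiff ℝ 1 g)
    (hc : HasCompactSupport g) : ∫ x, f x * dz X g x = - ∫ x, dz X f x * g x := by
  have i1 : ∀ Y, Integrable (fun x => f x * fderiv ℝ g x Y) := fun Y =>
    (hf.continuous.mul (cont_fd hg Y)).integrable_of_hasCompactSupport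
    (hc.fderiv_apply ℝ Y).mul_left
  have i2 : ∀ Y, Integrable (fun x => fderiv ℝ f x Y * g x) := fun Y =>
    ((cont_fd hf Y).mul hg.continuous).integrable_of_hasCompactSupport hc.mul_left
  have e1 : ∀ x, f x * dz X g x = (f x * fderiv ℝ g x X) * (1/2) -
     (f x * fderiv ℝ g x (I • X)) * (I/2) := fun x => by simp only [dz]; ring
  have e2 : ∀ x, dz X f x * g x = (fderiv ℝ f x X * g x) * (1/2) -
     (fderiv ℝ f x (I • X) * g x) * (I/2) := fun x => by simp only [dz]; ring
  simp only [e1, e2]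
  rw [integral_sub ((i1 X).mul_const _) ((i1 (I • X)).mul_const _),
    integral_sub ((i2 X).mul_const _) ((i2 (I • X)).mul_const _)]
  simp only [integral_mul_const, ibp_fd _ hf hg hc]; ring

lemma fd_fd {F : Type*} [NormedAddCommGroup F] [NormedSpace ℝ F] {f : EC → F} {x : EC}
    (hf : ContDiffAt ℝ 2 f x) (X Y : EC) :
    fderiv ℝ (fun y => fderiv ℝ f y X) x Y = fderiv ℝ (fderiv ℝ f) x Y X := by
  have h : DifferentiableAt ℝ (fderiv ℝ f) x :=
    (hf.fderiv_right (m := 1) bn).differentiableAt one_ne_zero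
  rw [fderiv_clm_apply h (differentiableAt_const X)]; simp

lemma fd_symm {F : Type*} [NormedAddCommGroup F] [NormedSpace ℝ F] {f : EC → F} {x : EC}
    (hf : ContDiffAt ℝ 2 f x) (X Y : EC) :
    fderiv ℝ (fderiv ℝ f) x X Y = fderiv ℝ (fderiv ℝ f) x Y X :=
  (hf.isSymmSndFDerivAt (by simp)).eq X Y

lemma fd_db {f : FC} {x : EC} (hf : ContDiffAt ℝ 2 f x) (X Y : EC) :
    fderiv ℝ (db X f) x Y = (fderiv ℝ (fderiv ℝ f) x Y X +
      I * fderiv ℝ (fderiv ℝ f) x Y (I • X)) / 2 := by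
  have h : ∀ Z, DifferentiableAt ℝ (fun y => fderiv ℝ f y Z) x := fun Z =>
    ((hf.fderiv_right (m := 1) bn).differentiableAt one_ne_zero).clm_apply
      (differentiableAt_const _)
  have e : db X f = fun y => (2:ℂ)⁻¹ * (fderiv ℝ f y X + I * fderiv ℝ f y (I • X)) := by
    ext y; simp only [db]; ring
  rw [e, fderiv_const_mul ((h X).fun_add ((h _).const_mul _)),
    fderiv_fun_add (h X) ((h _).const_mul _), fderiv_const_mul (h _)]
  simp only [smul_apply, add_apply, fd_fd hf, smul_eq_mul]; ring

lemma fd_dz {f : FC} {x : EC} (hf : ContDiffAt ℝ 2 f x) (X Y : EC) :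
    fderiv ℝ (dz X f) x Y = (fderiv ℝ (fderiv ℝ f) x Y X -
      I * fderiv ℝ (fderiv ℝ f) x Y (I • X)) / 2 := by
  have h : ∀ Z, DifferentiableAt ℝ (fun y => fderiv ℝ f y Z) x := fun Z =>
    ((hf.fderiv_right (m := 1) bn).differentiableAt one_ne_zero).clm_apply
      (differentiableAt_const _)
  have e : dz X f = fun y => (2:ℂ)⁻¹ * (fderiv ℝ f y X - I * fderiv ℝ f y (I • X)) := by
    ext y; simp only [dz]; ring
  rw [e, fderiv_const_mul ((h X).fun_sub ((h _).const_mul _)),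
    fderiv_fun_sub (h X) ((h _).const_mul _), fderiv_const_mul (h _)]
  simp only [smul_apply, sub_apply, fd_fd hf, smul_eq_mul]; ring

lemma db_dz_comm {f : FC} {x : EC} (hf : ContDiffAt ℝ 2 f x) (X Y : EC) :
    db Y (dz X f) x = dz X (db Y f) x := by
  simp only [db.eq_def Y (dz X f), dz.eq_def X (db Y f), fd_db hf, fd_dz hf, fd_symm hf X,
    fd_symm hf (I • X)]; ring

lemma db_db_comm {f : FC} {x : EC} (hf : ContDiffAt ℝ 2 f x) (X Y : EC) :
    db Y (db X f) x = db X (db Y f) x := by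
  simp only [db.eq_def Y (db X f), db.eq_def X (db Y f), fd_db hf, fd_symm hf X,
    fd_symm hf (I • X)]; ring

def cx (φ : FR) : FC := fun x => (φ x : ℂ)

lemma fd_cx {φ : FR} {x : EC} (h : DifferentiableAt ℝ φ x) (X : EC) :
    fderiv ℝ (cx φ) x X = (fderiv ℝ φ x X : ℝ) := by
  have := (Complex.ofRealCLM.hasFDerivAt (x := φ x)).comp x h.hasFDerivAt
  rw [show cx φ = (⇑Complex.ofRealCLM ∘ φ) from rfl, this.fderiv]; rfl

lemma diff_cx {φ : FR} {x : EC} (h : DifferentiableAt ℝ φ x) :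
    DifferentiableAt ℝ (cx φ) x := Complex.ofRealCLM.differentiableAt.comp x h

lemma cd_cx {φ : FR} {k} (h : ContDiff ℝ k φ) : ContDiff ℝ k (cx φ) :=
  Complex.ofRealCLM.contDiff.comp h

lemma fd2_cx {φ : FR} (h : ContDiff ℝ 2 φ) (x X Y : EC) :
    fderiv ℝ (fderiv ℝ (cx φ)) x Y X = (fderiv ℝ (fderiv ℝ φ) x Y X : ℝ) := by
  rw [← fd_fd (cd_cx h).contDiffAt, ← fd_fd h.contDiffAt]
  have e : (fun y => fderiv ℝ (cx φ) y X) = cx (fun y => fderiv ℝ φ y X) := by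
    ext y; exact fd_cx (h.differentiable two_ne_zero y) X
  rw [e, fd_cx]
  exact ((h.fderiv_right (m := 1) bn).clm_apply contDiff_const).differentiable
    one_ne_zero x

lemma levi_eq {φ : FR} {x : EC} (h : ContDiffAt ℝ 2 φ x) (X : EC) :
    leviForm φ x X = (fderiv ℝ (fderiv ℝ φ) x X X +
      fderiv ℝ (fderiv ℝ φ) x (I • X) (I • X)) / 4 := by
  rw [leviForm, fd_fd h, fd_fd h]

def Hs (φ : FR) (x X Y : EC) : ℂ := db Y (dz X (cx φ)) x

lemma Hs_eq {φ : FR} (h : ContDiff ℝ 2 φ) (x X Y : EC) :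
    Hs φ x X Y = ((fderiv ℝ (fderiv ℝ φ) x Y X : ℝ) + (fderiv ℝ (fderiv ℝ φ) x (I • Y) (I • X) : ℝ)
      - I * (fderiv ℝ (fderiv ℝ φ) x Y (I • X) : ℝ)
      + I * (fderiv ℝ (fderiv ℝ φ) x (I • Y) X : ℝ)) / 4 := by
  rw [Hs, db, fd_dz (cd_cx h).contDiffAt, fd_dz (cd_cx h).contDiffAt]
  simp only [fd2_cx h]
  linear_combination (-(((fderiv ℝ (fderiv ℝ φ) x (I • Y) (I • X) : ℝ):ℂ))/4) * Complex.I_sq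

lemma Hs_self {φ : FR} (h : ContDiff ℝ 2 φ) (x X : EC) :
    Hs φ x X X = (leviForm φ x X : ℝ) := by
  rw [Hs_eq h, levi_eq h.contDiffAt, fd_symm h.contDiffAt X (I • X)]; push_cast; ring

lemma Hs_conj {φ : FR} (h : ContDiff ℝ 2 φ) (x X Y : EC) :
    conj (Hs φ x X Y) = Hs φ x Y X := by
  rw [Hs_eq h, Hs_eq h, fd_symm h.contDiffAt X Y, fd_symm h.contDiffAt (I • X) (I • Y),
    fd_symm h.contDiffAt X (I • Y), fd_symm h.contDiffAt (I • X) Y]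
  simp only [map_div₀, map_add, map_sub, map_mul, Complex.conj_I, Complex.conj_ofReal, map_ofNat]
  ring

lemma Hs_smul {φ : FR} (h : ContDiff ℝ 2 φ) (x X Y : EC) (c : ℂ) :
    Hs φ x (c • X) Y = c * Hs φ x X Y := by
  have e : c • X = c.re • X + c.im • (I • X) := by
    rw [← Complex.coe_smul c.re, ← Complex.coe_smul c.im, smul_smul, ← add_smul, Complex.re_add_im]
  have e2 : I • c • X = c.re • (I • X) + (-c.im) • X := by
    rw [e, smul_add, smul_comm I, smul_comm I c.im, smul_smul I I, Complex.I_mul_I]; simp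
  rw [Hs_eq h, Hs_eq h, e2, e]
  simp only [map_add, map_smul, smul_eq_mul, Complex.ofReal_add, Complex.ofReal_mul,
    Complex.ofReal_neg]
  conv_rhs => rw [← Complex.re_add_im c]
  linear_combination ((c.im:ℂ) / 4 * (((fderiv ℝ (fderiv ℝ φ) x Y (I • X) : ℝ):ℂ) -
      (fderiv ℝ (fderiv ℝ φ) x (I • Y) X : ℝ))) * Complex.I_sq

lemma Hs_add {φ : FR} (h : ContDiff ℝ 2 φ) (x X X' Y : EC) :
    Hs φ x (X + X') Y = Hs φ x X Y + Hs φ x X' Y := by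
  simp only [Hs_eq h, smul_add, map_add, Complex.ofReal_add]; ring

lemma sum_ee (w : EC) : w = ∑ j, w j • ee j := by
  ext i; simp [ee, Pi.single_apply]

lemma Hs_expand1 {φ : FR} (h : ContDiff ℝ 2 φ) (x w Y : EC) :
    Hs φ x w Y = ∑ j, w j * Hs φ x (ee j) Y := by
  let T : EC →ₗ[ℂ] ℂ := ⟨⟨fun X => Hs φ x X Y, fun a b => Hs_add h x a b Y⟩,
    fun c a => Hs_smul h x a Y c⟩
  have : T w = ∑ j, w j * T (ee j) := by
    conv_lhs => rw [sum_ee w]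
    simp
  exact this

lemma levi_expand {φ : FR} (h : ContDiff ℝ 2 φ) (x w : EC) :
    (leviForm φ x w : ℂ) = ∑ j, ∑ k, Hs φ x (ee j) (ee k) * w j * conj (w k) := by
  rw [← Hs_self h, Hs_expand1 h]
  refine Finset.sum_congr rfl fun j _ => ?_
  rw [← Hs_conj h, Hs_expand1 h, map_sum, Finset.mul_sum]
  refine Finset.sum_congr rfl fun k _ => ?_
  rw [map_mul, Hs_conj h]; ring

def dl (φ : FR) (X : EC) (a : FC) (x : EC) : ℂ :=
  dz X a x - dz X (cx φ) x * a x
def wt (φ : FR) : FC := cx (fun x => Real.exp (-φ x))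

lemma cd_wt {φ : FR} {k} (h : ContDiff ℝ k φ) : ContDiff ℝ k (wt φ) :=
  cd_cx (Real.contDiff_exp.comp h.neg)

lemma fd_wt {φ : FR} {x : EC} (h : DifferentiableAt ℝ φ x) (X : EC) :
    fderiv ℝ (wt φ) x X = - fderiv ℝ (cx φ) x X * wt φ x := by
  rw [wt, fd_cx h.fun_neg.exp, fd_cx h]
  have := (h.hasFDerivAt.fun_neg.exp).fderiv
  rw [this]; simp [cx]; ring

lemma dz_wt {φ : FR} {x : EC} (h : DifferentiableAt ℝ φ x) (X : EC) :
    dz X (wt φ) x = - dz X (cx φ) x * wt φ x := by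
  simp only [dz, fd_wt h]; ring
lemma db_wt {φ : FR} {x : EC} (h : DifferentiableAt ℝ φ x) (X : EC) :
    db X (wt φ) x = - db X (cx φ) x * wt φ x := by
  simp only [db, fd_wt h]; ring
lemma db_cx {φ : FR} {x : EC} (h : DifferentiableAt ℝ φ x) (X : EC) :
    db X (cx φ) x = conj (dz X (cx φ) x) := by
  rw [← db_conj (diff_cx h)]; congr 1; ext y; simp [cx]

lemma db_cE {φ : FR} {b : FC} {x : EC} (h : DifferentiableAt ℝ φ x)
    (hb : DifferentiableAt ℝ b x) (Y : EC) :
    db Y (fun y => conj (b y) * wt φ y) x = conj (dl φ Y b x) * wt φ x := by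
  have hc : DifferentiableAt ℝ (fun y => conj (b y)) x :=
    Complex.conjCLE.differentiableAt.comp x hb
  have hw : DifferentiableAt ℝ (wt φ) x := diff_cx h.fun_neg.exp
  rw [db_mul hc hw, db_conj hb, db_wt h, db_cx h, dl]; simp only [map_sub, map_mul]; ring

lemma dz_cE {φ : FR} {c : FC} {x : EC} (h : DifferentiableAt ℝ φ x)
    (hc : DifferentiableAt ℝ c x) (X : EC) :
    dz X (fun y => c y * wt φ y) x = dl φ X c x * wt φ x := by
  have hw : DifferentiableAt ℝ (wt φ) x := diff_cx h.fun_neg.exp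
  rw [dz_mul hc hw, dz_wt h, dl]; ring

lemma c1_dl {φ : FR} {a : FC} (h : ContDiff ℝ 2 φ) (ha : ContDiff ℝ 2 a) (X : EC) :
    ContDiff ℝ 1 (dl φ X a) := by
  have h1 := c1_dz ha X; have h2 := c1_dz (cd_cx h) X; have h3 := ha.of_le one_le_two
  unfold dl; fun_prop

lemma db_dl {φ : FR} {a : FC} (h : ContDiff ℝ 2 φ) (ha : ContDiff ℝ 2 a)
    (X Y x : EC) : db Y (dl φ X a) x = dl φ X (db Y a) x - Hs φ x X Y * a x := by
  have d1 := (c1_dz ha X).differentiable one_ne_zero x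
  have d2 := (c1_dz (cd_cx h) X).differentiable one_ne_zero x
  have d3 := ha.differentiable two_ne_zero x
  have : dl φ X a = fun y => dz X a y - (fun y => dz X (cx φ) y * a y) y := rfl
  rw [this, db_sub d1 (d2.fun_mul d3), db_mul d2 d3, db_dz_comm ha.contDiffAt, dl, Hs]; ring

lemma cont_Hs {φ : FR} (h : ContDiff ℝ 2 φ) (X Y : EC) : Continuous fun x => Hs φ x X Y :=
  cont_db (c1_dz (cd_cx h) X) Y

lemma cont_conj {f : FC} (h : Continuous f) : Continuous fun x => conj (f x) :=
  Complex.continuous_conj.comp h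

lemma hcs_conj {f : FC} (h : HasCompactSupport f) : HasCompactSupport fun x => conj (f x) :=
  h.comp_left (map_zero _)

lemma pair_id {φ : FR} {a b : FC} (h : ContDiff ℝ 2 φ) (ha : ContDiff ℝ 2 a)
    (hb : ContDiff ℝ 2 b) (hbc : HasCompactSupport b) (X Y : EC) :
    ∫ x, dl φ X a x * conj (dl φ Y b x) * wt φ x =
      (∫ x, db Y a x * conj (db X b x) * wt φ x) +
      ∫ x, Hs φ x X Y * a x * conj (b x) * wt φ x := by
  have dφ := h.differentiable two_ne_zero
  have db' := hb.differentiable two_ne_zero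
  have hb1 : ContDiff ℝ 1 b := hb.of_le one_le_two
  have hw1 : ContDiff ℝ 1 (wt φ) := cd_wt (h.of_le one_le_two)
  have hcb : ContDiff ℝ 1 (fun y => conj (b y)) := Complex.conjCLE.contDiff.comp hb1
  have hY := c1_db ha Y
  have s1 : ∫ x, dl φ X a x * conj (dl φ Y b x) * wt φ x =
      - ∫ x, db Y (dl φ X a) x * (conj (b x) * wt φ x) := by
    rw [← ibp_db Y (c1_dl h ha X) (hcb.mul hw1) ((hcs_conj hbc).mul_right)]
    refine integral_congr_ae (.of_forall fun x => ?_)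
    simp only []; rw [db_cE (dφ x) (db' x)]; ring
  have s2 : ∫ x, db Y a x * conj (db X b x) * wt φ x =
      - ∫ x, dl φ X (db Y a) x * (conj (b x) * wt φ x) := by
    have := ibp_dz X (hY.mul hw1) hcb (hcs_conj hbc)
    rw [neg_eq_iff_eq_neg.symm, neg_eq_iff_eq_neg] at this
    have e1 : ∀ x, db Y a x * conj (db X b x) * wt φ x =
       db Y a x * wt φ x * dz X (fun y => conj (b y)) x := fun x => by
      rw [dz_conj (db' x)]; ring
    have e2 : ∀ x, dl φ X (db Y a) x * (conj (b x) * wt φ x) =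
       dz X (fun y => db Y a y * wt φ y) x * conj (b x) := fun x => by
      rw [dz_cE (dφ x) (hY.differentiable one_ne_zero x)]; ring
    simp only [e1, e2]; exact this
  rw [s1, s2]
  have c1 : Continuous (dl φ X (db Y a)) := by
    have := cont_dz hY X; have := cont_dz (cd_cx (h.of_le one_le_two)) X
    have := hY.continuous
    unfold dl; fun_prop
  have cc := hcb.continuous
  have cw := hw1.continuous
  have cH := cont_Hs h X Y
  have ca := ha.continuous
  have hk : HasCompactSupport fun x => conj (b x) * wt φ x := (hcs_conj hbc).mul_right
  have i1 : Integrable fun x => dl φ X (db Y a) x * (conj (b x) * wt φ x) :=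
    (c1.mul (cc.mul cw)).integrable_of_hasCompactSupport hk.mul_left
  have i2 : Integrable fun x => Hs φ x X Y * a x * conj (b x) * wt φ x := by
    have : Integrable fun x => (Hs φ x X Y * a x) * (conj (b x) * wt φ x) :=
      ((cH.mul ca).mul (cc.mul cw)).integrable_of_hasCompactSupport hk.mul_left
    simpa only [mul_assoc] using this
  have : ∀ x, db Y (dl φ X a) x * (conj (b x) * wt φ x) = dl φ X (db Y a) x * (conj (b x) * wt φ x)
     - Hs φ x X Y * a x * conj (b x) * wt φ x := fun x => by rw [db_dl h ha]; ring
  simp only [this]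
  rw [integral_sub i1 i2]; ring

lemma hcs_dl {φ : FR} {a : FC} (ha : HasCompactSupport a) (X : EC) :
    HasCompactSupport (dl φ X a) := by
  have h2 : HasCompactSupport (fun x => dz X (cx φ) x * a x) := ha.mul_left
  exact (hcs_dz ha X).sub h2

def vec (w : Fin n → FC) (x : EC) : EC := WithLp.toLp 2 fun j => w j x

lemma vec_sq (w : Fin n → FC) (x : EC) : ‖vec w x‖ ^ 2 = ∑ j, ‖w j x‖ ^ 2 := by
  rw [EuclideanSpace.norm_sq_eq]; rfl

lemma re_mul_conj_ge (A B : ℂ) : -(1/2) * ‖A - B‖ ^ 2 ≤ (A * conj B).re := by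
  rw [← Complex.normSq_eq_norm_sq, Complex.normSq_apply]
  simp only [Complex.mul_re, Complex.conj_re, Complex.conj_im, Complex.sub_re, Complex.sub_im]
  nlinarith [sq_nonneg A.re, sq_nonneg A.im, sq_nonneg B.re, sq_nonneg B.im]

lemma basic_ineq {φ κ : FR} {w : Fin n → FC} {K : SC} (h : ContDiff ℝ 2 φ)
    (hw : ∀ j, ContDiff ℝ 2 (w j)) (hwc : ∀ j, HasCompactSupport (w j))
    (hK : ∀ j, ∀ x, x ∉ K → w j x = 0)
    (hκ : Continuous κ) (hl : ∀ x ∈ K, ∀ X, κ x * ‖X‖ ^ 2 ≤ leviForm φ x X) :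
    ∫ x, κ x * (∑ j, ‖w j x‖ ^ 2) * Real.exp (-φ x) ≤
      (∫ x, ‖∑ j, dl φ (ee j) (w j) x‖ ^ 2 * Real.exp (-φ x)) +
      ∫ x, (∑ j, ∑ k, (1/2) * ‖db (ee k) (w j) x - db (ee j) (w k) x‖ ^ 2) * Real.exp (-φ x) := by
  have cw : Continuous (wt φ) := (cd_wt (h.of_le one_le_two)).continuous
  have cd : ∀ j, Continuous (dl φ (ee j) (w j)) := fun j => (c1_dl h (hw j) _).continuous
  have hd : ∀ j, HasCompactSupport (dl φ (ee j) (w j)) := fun j => hcs_dl (hwc j) _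
  have cb : ∀ j k, Continuous (db (ee k) (w j)) := fun j k => (c1_db (hw j) _).continuous
  have hb : ∀ j k, HasCompactSupport (db (ee k) (w j)) := fun j k => hcs_db (hwc j) _
  have ce : Continuous fun x => Real.exp (-φ x) := Real.continuous_exp.comp h.continuous.neg
  have cW : ∀ j, Continuous (w j) := fun j => (hw j).continuous
  have iD : ∀ j k, Integrable fun x => dl φ (ee j) (w j) x * conj (dl φ (ee k) (w k) x) * wt φ x :=
    fun j k => (((cd j).mul (cont_conj (cd k))).mul cw).integrable_of_hasCompactSupport
      (hd j).mul_right.mul_right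
  have iP : ∀ j k, Integrable fun x => db (ee k) (w j) x * conj (db (ee j) (w k) x) * wt φ x :=
    fun j k => (((cb j k).mul (cont_conj (cb k j))).mul cw).integrable_of_hasCompactSupport
      (hb j k).mul_right.mul_right
  have iQ : ∀ j k, Integrable fun x => Hs φ x (ee j) (ee k) * w j x * conj (w k x) * wt φ x :=
    fun j k => ((((cont_Hs h _ _).mul (cW j)).mul (cont_conj (cW k))).mul
      cw).integrable_of_hasCompactSupport (hwc j).mul_left.mul_right.mul_right
  have main : ∫ x, ∑ j, ∑ k, dl φ (ee j) (w j) x * conj (dl φ (ee k) (w k) x) * wt φ x =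
      (∫ x, ∑ j, ∑ k, db (ee k) (w j) x * conj (db (ee j) (w k) x) * wt φ x) +
      ∫ x, ∑ j, ∑ k, Hs φ x (ee j) (ee k) * w j x * conj (w k x) * wt φ x := by
    rw [integral_finsetSum _ fun j _ => integrable_finsetSum _ fun k _ => iD j k,
      integral_finsetSum _ fun j _ => integrable_finsetSum _ fun k _ => iP j k,
      integral_finsetSum _ fun j _ => integrable_finsetSum _ fun k _ => iQ j k,
      ← Finset.sum_add_distrib]
    refine Finset.sum_congr rfl fun j _ => ?_
    rw [integral_finsetSum _ fun k _ => iD j k, integral_finsetSum _ fun k _ => iP j k,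
      integral_finsetSum _ fun k _ => iQ j k, ← Finset.sum_add_distrib]
    exact Finset.sum_congr rfl fun k _ => pair_id h (hw j) (hw k) (hwc k) _ _
  have e1 : ∀ x, ∑ j, ∑ k, dl φ (ee j) (w j) x * conj (dl φ (ee k) (w k) x) * wt φ x =
      ((‖∑ j, dl φ (ee j) (w j) x‖ ^ 2 * Real.exp (-φ x) : ℝ) : ℂ) := fun x => by
    rw [Complex.ofReal_mul, Complex.ofReal_pow, ← Complex.mul_conj', map_sum,
      Finset.sum_mul_sum, Finset.sum_mul]
    refine Finset.sum_congr rfl fun j _ => ?_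
    rw [Finset.sum_mul]; rfl
  have e2 : ∀ x, ∑ j, ∑ k, Hs φ x (ee j) (ee k) * w j x * conj (w k x) * wt φ x =
      ((leviForm φ x (vec w x) * Real.exp (-φ x) : ℝ) : ℂ) := fun x => by
    rw [Complex.ofReal_mul, levi_expand h, Finset.sum_mul]
    refine Finset.sum_congr rfl fun j _ => ?_
    rw [Finset.sum_mul]; rfl
  have i1 : Integrable fun x => ∑ j, ∑ k, db (ee k) (w j) x * conj (db (ee j) (w k) x) * wt φ x :=
    integrable_finsetSum _ fun j _ => integrable_finsetSum _ fun k _ => iP j k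
  have i2 : Integrable fun x => leviForm φ x (vec w x) * Real.exp (-φ x) := by
    have : Integrable fun x =>
        ∑ j, ∑ k, Hs φ x (ee j) (ee k) * w j x * conj (w k x) * wt φ x :=
      integrable_finsetSum _ fun j _ => integrable_finsetSum _ fun k _ => iQ j k
    simp only [e2] at this
    exact this.re
  simp only [e1, e2] at main
  rw [integral_complex_ofReal, integral_complex_ofReal] at main
  have main2 := congrArg Complex.re main
  rw [Complex.add_re, Complex.ofReal_re, Complex.ofReal_re,
    ← RCLike.re_eq_complex_re, ← integral_re i1] at main2
  have i3 : Integrable fun x => κ x * (∑ j, ‖w j x‖ ^ 2) * Real.exp (-φ x) := by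
    simp only [Finset.mul_sum, Finset.sum_mul]
    refine integrable_finsetSum _ fun j _ => ?_
    refine Continuous.integrable_of_hasCompactSupport (by fun_prop) ?_
    exact ((hwc j).comp_left (g := fun z => ‖z‖ ^ 2) (by simp)).mul_left.mul_right
  have i4 : Integrable fun x => (∑ j, ∑ k, (1/2) * ‖db (ee k) (w j) x - db (ee j) (w k) x‖ ^ 2) *
      Real.exp (-φ x) := by
    simp only [Finset.sum_mul]
    refine integrable_finsetSum _ fun j _ => integrable_finsetSum _ fun k _ => ?_
    have := cb j k; have := cb k j
    refine Continuous.integrable_of_hasCompactSupport (by fun_prop) ?_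
    exact (((hb j k).sub (hb k j)).comp_left (g := fun z => (1/2) * ‖z‖ ^ 2) (by simp)).mul_right
  have l1 : ∫ x, κ x * (∑ j, ‖w j x‖ ^ 2) * Real.exp (-φ x) ≤
      ∫ x, leviForm φ x (vec w x) * Real.exp (-φ x) := by
    refine integral_mono i3 i2 fun x => ?_
    simp only []
    refine mul_le_mul_of_nonneg_right ?_ (Real.exp_pos _).le
    rw [← vec_sq]
    by_cases hx : x ∈ K
    · exact hl x hx _
    · have : vec w x = 0 := by ext j; exact hK j x hx
      rw [this, levi_eq h.contDiffAt]; simp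
  have l2 : -∫ x, (∑ j, ∑ k, (1/2) * ‖db (ee k) (w j) x - db (ee j) (w k) x‖ ^ 2) * Real.exp (-φ x) ≤
      ∫ x, RCLike.re (∑ j, ∑ k, db (ee k) (w j) x * conj (db (ee j) (w k) x) * wt φ x) := by
    rw [← integral_neg]
    refine integral_mono i4.neg i1.re fun x => ?_
    simp only [Finset.sum_mul, RCLike.re_eq_complex_re, Complex.re_sum, ← Finset.sum_neg_distrib]
    refine Finset.sum_le_sum fun j _ => Finset.sum_le_sum fun k _ => ?_
    rw [wt, cx, Complex.re_mul_ofReal, ← neg_mul]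
    refine mul_le_mul_of_nonneg_right ?_ (Real.exp_pos _).le
    have := re_mul_conj_ge (db (ee k) (w j) x) (db (ee j) (w k) x)
    linarith
  linarith

def mo0 (ε : ℝ) (x : EC) : ℝ := Real.smoothTransition (ε ^ 2 - ‖x‖ ^ 2)
def mo (ε : ℝ) (x : EC) : ℝ := (∫ y : EC, mo0 ε y)⁻¹ * mo0 ε x

lemma mo0_cd (ε : ℝ) : ContDiff ℝ 2 (mo0 ε : FR) := by
  have h : ContDiff ℝ 2 Real.smoothTransition := Real.smoothTransition.contDiff (n := 2)
  exact h.comp (contDiff_const.sub (contDiff_norm_sq ℝ))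

lemma mo0_zero {ε : ℝ} {x : EC} (h0 : 0 ≤ ε) (h : ε ≤ ‖x‖) : mo0 ε x = 0 :=
  Real.smoothTransition.zero_of_nonpos (by nlinarith)

lemma mo0_hcs {ε : ℝ} (h0 : 0 ≤ ε) : HasCompactSupport (mo0 ε : FR) := by
  refine HasCompactSupport.intro (isCompact_closedBall 0 ε) fun x hx => mo0_zero h0 ?_
  simp at hx; exact hx.le

lemma mo0_int {ε : ℝ} (h0 : 0 < ε) : 0 < ∫ y : EC, mo0 ε y := by
  refine Continuous.integral_pos_of_hasCompactSupport_nonneg_nonzero (x := 0)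
    (mo0_cd ε).continuous (mo0_hcs h0.le) (fun x => Real.smoothTransition.nonneg _) ?_
  exact (Real.smoothTransition.pos_of_pos (by simp; positivity)).ne'

lemma mo_cd (ε : ℝ) : ContDiff ℝ 2 (mo ε : FR) := contDiff_const.mul (mo0_cd ε)
lemma mo_zero {ε : ℝ} {x : EC} (h0 : 0 ≤ ε) (h : ε ≤ ‖x‖) : mo ε x = 0 := by
  rw [mo, mo0_zero h0 h, mul_zero]
lemma mo_hcs {ε : ℝ} (h0 : 0 ≤ ε) : HasCompactSupport (mo ε : FR) := (mo0_hcs h0).mul_left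
lemma mo_nonneg (ε : ℝ) (x : EC) : 0 ≤ mo ε x :=
  mul_nonneg (inv_nonneg.2 (integral_nonneg fun _ => Real.smoothTransition.nonneg _))
    (Real.smoothTransition.nonneg _)
lemma mo_int {ε : ℝ} (h0 : 0 < ε) : ∫ y : EC, mo ε y = 1 := by
  simp only [mo]; rw [integral_const_mul, inv_mul_cancel₀ (mo0_int h0).ne']
lemma mo_radial {ε : ℝ} {x y : EC} (h : ‖x‖ = ‖y‖) : mo ε x = mo ε y := by
  simp only [mo, mo0, h]
lemma mo_integrable {ε : ℝ} (h0 : 0 ≤ ε) : Integrable (mo ε : FR) :=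
  (mo_cd ε).continuous.integrable_of_hasCompactSupport (mo_hcs h0)

section mol
variable {F : Type*} [NormedAddCommGroup F] [NormedSpace ℝ F]

def mol (ε : ℝ) (h : EC → F) (x : EC) : F := ∫ t, mo ε (x - t) • h t

lemma mol_eq_conv (ε : ℝ) (h : EC → F) :
    mol ε h = convolution (mo ε) h (ContinuousLinearMap.lsmul ℝ ℝ) volume := by
  ext x; rw [convolution_lsmul_swap]; rfl

lemma mol_eq (ε : ℝ) (h : EC → F) (x : EC) : mol ε h x = ∫ t, mo ε t • h (x - t) := by
  rw [mol_eq_conv, convolution_lsmul]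

lemma mol_cd [CompleteSpace F] {ε : ℝ} (h0 : 0 ≤ ε) {h : EC → F} (hh : LocallyIntegrable h) :
    ContDiff ℝ 2 (mol ε h) := by
  rw [mol_eq_conv]
  exact (mo_hcs h0).contDiff_convolution_left _ (mo_cd ε) hh

lemma mol_fd [CompleteSpace F] {ε : ℝ} (h0 : 0 ≤ ε) {h : EC → F} (hh : LocallyIntegrable h)
    (x X : EC) : fderiv ℝ (mol ε h) x X = ∫ t, (fderiv ℝ (mo ε) (x - t) X) • h t := by
  rw [mol_eq_conv, ((mo_hcs h0).hasFDerivAt_convolution_left _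
    ((mo_cd ε).of_le one_le_two) hh x).fderiv, convolution_eq_swap]
  have hi : Integrable fun t => ((ContinuousLinearMap.lsmul ℝ ℝ :
      ℝ →L[ℝ] F →L[ℝ] F).precompL EC) (fderiv ℝ (mo ε) (x - t)) (h t) := by
    have := ((mo_hcs (n := n) h0).fderiv ℝ).convolutionExists_left
      ((ContinuousLinearMap.lsmul ℝ ℝ : ℝ →L[ℝ] F →L[ℝ] F).precompL EC) 
      ((mo_cd ε).continuous_fderiv two_ne_zero) hh x
    exact this.integrable_swap
  rw [ContinuousLinearMap.integral_apply hi]; rfl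

lemma mol_supp {ε : ℝ} (h0 : 0 ≤ ε) {h : EC → F} {K : SC} (hK : ∀ x, x ∉ K → h x = 0)
    {x : EC} (hx : x ∉ cthickening ε K) : mol ε h x = 0 := by
  refine integral_eq_zero_of_ae (.of_forall fun t => ?_)
  by_cases ht : t ∈ K
  · have : ε ≤ ‖x - t‖ := by
      by_contra! hlt
      exact hx (mem_cthickening_of_dist_le x t ε K ht (by rw [dist_eq_norm]; exact hlt.le))
    simp [mo_zero h0 this]
  · simp [hK t ht]
end mol

def moT (ε : ℝ) (x : EC) : FC := cx fun s => mo ε (x - s)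
lemma moT_cd (ε : ℝ) (x : EC) : ContDiff ℝ 2 (moT ε x) :=
  cd_cx ((mo_cd ε).comp (contDiff_const.sub contDiff_id))
lemma moT_zero {ε : ℝ} (h0 : 0 ≤ ε) {x s : EC} (h : s ∉ closedBall x ε) : moT ε x s = 0 := by
  rw [mem_closedBall, dist_comm, dist_eq_norm] at h
  simp [moT, cx, mo_zero h0 (not_le.1 h).le]
lemma moT_hcs {ε : ℝ} (h0 : 0 ≤ ε) (x : EC) : HasCompactSupport (moT ε x) :=
  HasCompactSupport.intro (isCompact_closedBall x ε) fun _ hs => moT_zero h0 hs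
lemma moT_tsupp {ε : ℝ} (h0 : 0 ≤ ε) (x : EC) : tsupport (moT ε x) ⊆ closedBall x ε :=
  closure_minimal (fun s hs => by
    by_contra h; exact hs (moT_zero h0 h)) isClosed_closedBall

lemma fd_moT (ε : ℝ) (x t X : EC) :
    fderiv ℝ (moT ε x) t X = -((fderiv ℝ (mo ε) (x - t) X : ℝ) : ℂ) := by
  have h1 := ((mo_cd (n := n) ε).differentiable two_ne_zero (x - t)).hasFDerivAt
  have h2 : HasFDerivAt (fun s : EC => x - s) (-ContinuousLinearMap.id ℝ EC) t :=
    (hasFDerivAt_id t).const_sub x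
  have h3 := h1.comp t h2
  have : DifferentiableAt ℝ (fun s => mo ε (x - s)) t := h3.differentiableAt
  rw [moT, fd_cx this, show (fun s => mo ε (x - s)) = mo ε ∘ (fun s => x - s) from rfl, h3.fderiv]
  simp

lemma locint_of_memLp {h : FC} (hh : MemLp h 2) : LocallyIntegrable h :=
  hh.locallyIntegrable one_le_two

lemma li_mul {h : FC} (hh : LocallyIntegrable h) {g : FC} (hg : Continuous g)
    (hc : HasCompactSupport g) : Integrable fun t => h t * g t := by
  simpa [mul_comm] using hh.integrable_smul_left_of_hasCompactSupport hg hc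

lemma mol_fdC {ε : ℝ} (h0 : 0 ≤ ε) {h : FC} (hh : LocallyIntegrable h) (x X : EC) :
    fderiv ℝ (mol ε h) x X = - ∫ t, h t * fderiv ℝ (moT ε x) t X := by
  rw [mol_fd h0 hh, ← integral_neg]
  refine integral_congr_ae (.of_forall fun t => ?_)
  simp only [fd_moT, Complex.real_smul]; ring

lemma mol_C (ε : ℝ) (h : FC) (x : EC) : mol ε h x = ∫ t, h t * moT ε x t := by
  refine integral_congr_ae (.of_forall fun t => ?_)
  simp only [moT, cx, Complex.real_smul]; ring

lemma mol_db {ε : ℝ} (h0 : 0 ≤ ε) {h : FC} (hh : LocallyIntegrable h) (x X : EC) :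
    db X (mol ε h) x = - ∫ t, h t * db X (moT ε x) t := by
  have i : ∀ Y, Integrable fun t => h t * fderiv ℝ (moT ε x) t Y := fun Y =>
    li_mul hh (cont_fd ((moT_cd ε x).of_le one_le_two) Y) ((moT_hcs h0 x).fderiv_apply ℝ Y)
  have e : ∀ t, h t * db X (moT ε x) t = h t * fderiv ℝ (moT ε x) t X * (1/2) +
    h t * fderiv ℝ (moT ε x) t (I • X) * (I/2) := fun t => by simp only [db]; ring
  simp only [e]
  rw [integral_add ((i _).mul_const _) ((i _).mul_const _), integral_mul_const, integral_mul_const,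
    db, mol_fdC h0 hh, mol_fdC h0 hh]; ring

lemma mol_dz {ε : ℝ} (h0 : 0 ≤ ε) {h : FC} (hh : LocallyIntegrable h) (x X : EC) :
    dz X (mol ε h) x = - ∫ t, h t * dz X (moT ε x) t := by
  have i : ∀ Y, Integrable fun t => h t * fderiv ℝ (moT ε x) t Y := fun Y =>
    li_mul hh (cont_fd ((moT_cd ε x).of_le one_le_two) Y) ((moT_hcs h0 x).fderiv_apply ℝ Y)
  have e : ∀ t, h t * dz X (moT ε x) t = h t * fderiv ℝ (moT ε x) t X * (1/2) -
    h t * fderiv ℝ (moT ε x) t (I • X) * (I/2) := fun t => by simp only [dz]; ring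
  simp only [e]
  rw [integral_sub ((i _).mul_const _) ((i _).mul_const _), integral_mul_const, integral_mul_const,
    dz, mol_fdC h0 hh, mol_fdC h0 hh]; ring

lemma trans_cont {h : FC} (hh : MemLp h 2) :
    Tendsto (fun t : EC => eLpNorm (fun x => h (-t + x) - h x) 2 volume) (𝓝 0) (𝓝 0) := by
  have : Fact ((2:ℝ≥0∞) ≠ ∞) := ⟨by norm_num⟩
  have h1 : Continuous fun t : EC => (DomAddAct.mk (-t) +ᵥ hh.toLp h : Lp ℂ 2 volume) := by
    have c1 : Continuous fun t : EC => DomAddAct.mk (-t) := by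
      exact (DomAddAct.continuous_mk).comp continuous_neg
    exact c1.vadd continuous_const
  have h2 : Tendsto (fun t : EC => edist (DomAddAct.mk (-t) +ᵥ hh.toLp h : Lp ℂ 2 volume)
      (hh.toLp h)) (𝓝 0) (𝓝 0) := by
    have := (h1.edist (continuous_const (y := hh.toLp h))).tendsto 0
    simpa using this
  refine h2.congr fun t => ?_
  rw [DomAddAct.mk_vadd_toLp, Lp.edist_toLp_toLp]
  rfl

def pm (n : ℕ) (ε : ℝ) : Measure (Cn n) := volume.withDensity fun t => ENNReal.ofReal (mo ε t)

lemma pm_meas (ε : ℝ) : Measurable fun t : EC => ENNReal.ofReal (mo ε t) :=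
  ENNReal.measurable_ofReal.comp (mo_cd ε).continuous.measurable

lemma pm_prob {ε : ℝ} (h0 : 0 < ε) : IsProbabilityMeasure (pm n ε) := by
  refine ⟨?_⟩
  rw [pm, withDensity_apply _ MeasurableSet.univ, Measure.restrict_univ,
    ← ofReal_integral_eq_lintegral_ofReal (mo_integrable h0.le) (.of_forall (mo_nonneg ε)),
    mo_int h0, ENNReal.ofReal_one]

lemma pm_integral (ε : ℝ) {F : Type*} [NormedAddCommGroup F] [NormedSpace ℝ F] (g : EC → F) :
    ∫ t, g t ∂(pm n ε) = ∫ t, mo ε t • g t := by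
  have : pm n ε = volume.withDensity fun t => ((mo ε t).toNNReal : ℝ≥0∞) := rfl
  rw [this, integral_withDensity_eq_integral_smul (f := fun t => (mo ε t).toNNReal)
    (measurable_real_toNNReal.comp (mo_cd ε).continuous.measurable)]
  refine integral_congr_ae (.of_forall fun t => ?_)
  simp only [NNReal.smul_def, Real.coe_toNNReal _ (mo_nonneg ε t)]

lemma pm_lintegral_le {ε : ℝ} (h0 : 0 < ε) {g : EC → ℝ≥0∞} {c : ℝ≥0∞}
    (h : ∀ t, ‖t‖ < ε → g t ≤ c) : ∫⁻ t, g t ∂(pm n ε) ≤ c := by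
  have := pm_prob (n := n) h0
  have h1 : ∀ᵐ t ∂(pm n ε), g t ≤ c := by
    rw [pm, ae_withDensity_iff (pm_meas ε)]
    refine .of_forall fun t ht => h t ?_
    by_contra! hc
    exact ht (by rw [mo_zero h0.le hc, ENNReal.ofReal_zero])
  calc _ ≤ ∫⁻ t, c ∂(pm n ε) := lintegral_mono_ae h1
    _ = c := by simp

lemma sq_lint_le {α : Type*} [MeasurableSpace α] {μ : Measure α} [IsProbabilityMeasure μ]
    {f : α → ℝ≥0∞} (hf : AEMeasurable f μ) : (∫⁻ t, f t ∂μ) ^ 2 ≤ ∫⁻ t, f t ^ 2 ∂μ := by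
  have := ENNReal.lintegral_mul_le_Lp_mul_Lq μ Real.HolderConjugate.two_two hf
    (aemeasurable_const (b := (1:ℝ≥0∞)))
  simp only [Pi.mul_apply, mul_one, ENNReal.one_rpow, lintegral_one, measure_univ] at this
  calc _ ≤ ((∫⁻ t, f t ^ (2:ℝ) ∂μ) ^ (1/2:ℝ)) ^ 2 := by gcongr
    _ = _ := by
      rw [← ENNReal.rpow_natCast, ← ENNReal.rpow_mul]; norm_num

lemma mol_L2 {h : FC} (hh : MemLp h 2) :
    Tendsto (fun ε => ∫⁻ x, ‖mol ε h x - h x‖ₑ ^ 2) (𝓝[>] 0) (𝓝 0) := by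
  obtain ⟨g, hg, hgh⟩ := hh.1
  have hgL : MemLp g 2 := (memLp_congr_ae hgh).1 hh
  have hm : ∀ ε, mol ε h = mol ε g := fun ε => by
    ext x; refine integral_congr_ae (hgh.mono fun t ht => ?_); simp only [ht]
  have e1 : ∀ ε, ∫⁻ x, ‖mol ε h x - h x‖ₑ ^ 2 = ∫⁻ x, ‖mol ε g x - g x‖ₑ ^ 2 := fun ε => by
    rw [hm]; exact lintegral_congr_ae (hgh.mono fun t ht => by simp only [ht])
  simp only [e1]
  have gm : Measurable g := hg.measurable
  have tc := trans_cont hgL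
  have e2 : ∀ t : EC, ∫⁻ x, ‖g (-t + x) - g x‖ₑ ^ 2 =
      eLpNorm (fun x => g (-t + x) - g x) 2 volume ^ 2 := fun t => by
    rw [eLpNorm_eq_lintegral_rpow_enorm_toReal bn bn,
      ← ENNReal.rpow_natCast, ← ENNReal.rpow_mul]; norm_num
  have tc2 : Tendsto (fun t : EC => ∫⁻ x, ‖g (-t + x) - g x‖ₑ ^ 2) (𝓝 0) (𝓝 0) := by
    simp only [e2]
    simpa using ENNReal.Tendsto.pow (n := 2) tc
  rw [ENNReal.tendsto_nhds_zero] at tc2 ⊢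
  intro c hc
  obtain ⟨d, hd, hdc⟩ := Metric.eventually_nhds_iff.1 (tc2 c hc)
  filter_upwards [Ioo_mem_nhdsGT hd] with ε hε
  have := pm_prob (n := n) hε.1
  have m2 : Measurable fun q : EC × EC => ‖g (-q.2 + q.1) - g q.1‖ₑ ^ 2 := by fun_prop
  calc ∫⁻ x, ‖mol ε g x - g x‖ₑ ^ 2 ≤ ∫⁻ x, ∫⁻ t, ‖g (-t + x) - g x‖ₑ ^ 2 ∂(pm n ε) := by
        refine lintegral_mono fun x => ?_
        have e3 : mol ε g x - g x = ∫ t, (g (-t + x) - g x) ∂(pm n ε) := by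
          have ig : Integrable (fun t => g (-t + x)) (pm n ε) := by
            have : pm n ε = volume.withDensity fun t => ((mo ε t).toNNReal : ℝ≥0∞) := rfl
            rw [this, integrable_withDensity_iff_integrable_smul
              (f := fun t => (mo ε t).toNNReal) (measurable_real_toNNReal.comp (mo_cd ε).continuous.measurable)]
            have l1 : LocallyIntegrable fun t => g (-t + x) := by
              have : MemLp (fun t => g (-t + x)) 2 := by
                have := hgL.comp_measurePreserving (Measure.measurePreserving_sub_left volume x)
                refine this.congr_norm (Measurable.aestronglyMeasurable (by fun_prop)) (.of_forall fun t => ?_)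
                simp [neg_add_eq_sub]
              exact locint_of_memLp this
            have := l1.integrable_smul_left_of_hasCompactSupport (mo_cd ε).continuous
              (mo_hcs hε.1.le)
            refine this.congr (.of_forall fun t => ?_)
            simp only [NNReal.smul_def, Real.coe_toNNReal _ (mo_nonneg ε t)]
          rw [integral_sub ig (integrable_const _), integral_const, pm_integral, mol_eq]
          simp [neg_add_eq_sub]
        rw [e3]
        calc _ ≤ (∫⁻ t, ‖g (-t + x) - g x‖ₑ ∂(pm n ε)) ^ 2 := by
              gcongr; exact enorm_integral_le_lintegral_enorm _
          _ ≤ _ := sq_lint_le (by fun_prop)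
    _ = ∫⁻ t, ∫⁻ x, ‖g (-t + x) - g x‖ₑ ^ 2 ∂volume ∂(pm n ε) :=
        lintegral_lintegral_swap m2.aemeasurable
    _ ≤ c := by
        refine pm_lintegral_le hε.1 fun t ht => hdc ?_
        rw [dist_zero_right]; exact ht.trans hε.2

structure L2T (K : SC) (F : ℝ → FC) (f : FC) : Prop where
  memF : ∀ᶠ i in 𝓝[>] (0:ℝ), MemLp (F i) 2
  mem : MemLp f 2
  zF : ∀ᶠ i in 𝓝[>] (0:ℝ), ∀ x, x ∉ K → F i x = 0
  z : ∀ x, x ∉ K → f x = 0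
  lim : Tendsto (fun i => eLpNorm (fun x => F i x - f x) 2 volume) (𝓝[>] (0:ℝ)) (𝓝 0)

lemma eLp_sq (f : FC) : ∫⁻ x, ‖f x‖ₑ ^ 2 = eLpNorm f 2 volume ^ 2 := by
  rw [eLpNorm_eq_lintegral_rpow_enorm_toReal bn bn,
      ← ENNReal.rpow_natCast, ← ENNReal.rpow_mul]; norm_num

lemma L2T.sub {K : SC} {F G : ℝ → FC} {f g : FC} (hf : L2T K F f)
    (hg : L2T K G g) : L2T K (fun i x => F i x - G i x) (fun x => f x - g x) where
  memF := by filter_upwards [hf.memF, hg.memF] with i h1 h2 using h1.sub h2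
  mem := hf.mem.sub hg.mem
  zF := by filter_upwards [hf.zF, hg.zF] with i h1 h2 x hx; simp [h1 x hx, h2 x hx]
  z := fun x hx => by simp [hf.z x hx, hg.z x hx]
  lim := by
    have := hf.lim.add hg.lim
    rw [add_zero] at this
    refine tendsto_of_tendsto_of_tendsto_of_le_of_le' tendsto_const_nhds this
      (.of_forall fun _ => zero_le) ?_
    filter_upwards [hf.memF, hg.memF] with i h1 h2
    have e : (fun x => F i x - G i x - (f x - g x)) = (fun x => F i x - f x) -
      (fun x => G i x - g x) := by ext x; simp; ring
    rw [e]
    exact eLpNorm_sub_le (h1.sub hf.mem).1 (h2.sub hg.mem).1 one_le_two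

lemma mem_mulc {K : SC} (hK : IsCompact K) {a : FC} (ha : Continuous a) : ∃ M : ℝ, 0 ≤ M ∧ ∀ f : FC,
    MemLp f 2 → (∀ x, x ∉ K → f x = 0) → MemLp (fun x => a x * f x) 2 ∧
     eLpNorm (fun x => a x * f x) 2 volume ≤ ENNReal.ofReal M * eLpNorm f 2 volume := by
  obtain ⟨M, hM⟩ := hK.exists_bound_of_continuousOn ha.continuousOn
  refine ⟨max M 0, le_max_right _ _, fun f hf hz => ?_⟩
  have hb : ∀ x, ‖a x * f x‖ ≤ max M 0 * ‖f x‖ := fun x => by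
    by_cases hx : x ∈ K
    · rw [norm_mul]; gcongr; exact (hM x hx).trans (le_max_left _ _)
    · simp [hz x hx]
  have hs := ha.aestronglyMeasurable.mul hf.1 (μ := volume)
  exact ⟨hf.of_le_mul hs (.of_forall hb), eLpNorm_le_mul_eLpNorm_of_ae_le_mul (.of_forall hb) 2⟩

lemma L2T.mulc {K : SC} (hK : IsCompact K) {F : ℝ → FC} {f : FC}
    (hf : L2T K F f) {a : FC} (ha : Continuous a) :
    L2T K (fun i x => a x * F i x) (fun x => a x * f x) := by
  obtain ⟨M, hM0, hM⟩ := mem_mulc hK ha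
  refine ⟨?_, (hM f hf.mem hf.z).1, ?_, fun x hx => by simp [hf.z x hx], ?_⟩
  · filter_upwards [hf.memF, hf.zF] with i h1 h2 using (hM _ h1 h2).1
  · filter_upwards [hf.zF] with i h2 x hx; simp [h2 x hx]
  · have := ENNReal.Tendsto.const_mul (a := ENNReal.ofReal M) hf.lim (Or.inr ENNReal.ofReal_ne_top)
    rw [mul_zero] at this
    refine tendsto_of_tendsto_of_tendsto_of_le_of_le' tendsto_const_nhds this
      (.of_forall fun _ => zero_le) ?_
    filter_upwards [hf.memF, hf.zF] with i h1 h2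
    have := (hM (fun x => F i x - f x) (h1.sub hf.mem)
      (fun x hx => by simp [h2 x hx, hf.z x hx])).2
    simpa only [mul_sub] using this

lemma L2T.sum {ι : Type*} {K : SC} {F : ι → ℝ → FC} {f : ι → FC}
    (s : Finset ι) (h : ∀ j ∈ s, L2T K (F j) (f j)) :
    L2T K (fun i x => ∑ j ∈ s, F j i x) (fun x => ∑ j ∈ s, f j x) := by
  classical
  induction s using Finset.induction_on with
  | empty =>
    simp only [Finset.sum_empty]
    exact ⟨.of_forall fun _ => MemLp.zero', MemLp.zero', .of_forall fun _ _ _ => rfl, fun _ _ => rfl,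
      by simp⟩
  | insert a s ha ih =>
    have h1 := h a (Finset.mem_insert_self _ _)
    have h2 := ih fun j hj => h j (Finset.mem_insert_of_mem hj)
    have h0 : L2T K (fun _ _ => (0:ℂ)) (fun _ => 0) :=
      ⟨.of_forall fun _ => MemLp.zero', MemLp.zero', .of_forall fun _ _ _ => rfl, fun _ _ => rfl,
      by simp⟩
    have h3 := h1.sub (h0.sub h2)
    simp only [zero_sub, sub_neg_eq_add] at h3
    simpa only [Finset.sum_insert ha] using h3

lemma int_sq_mul {K : SC} (hK : IsCompact K) {f : FC} (hf : MemLp f 2)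
    (hz : ∀ x, x ∉ K → f x = 0) {q : FR} (hq : Continuous q) :
    Integrable fun x => ‖f x‖ ^ 2 * q x := by
  obtain ⟨M, hM⟩ := hK.exists_bound_of_continuousOn hq.continuousOn
  refine Integrable.mono' (g := fun x => ‖f x‖ ^ 2 * M) ?_ ?_ (.of_forall fun x => ?_)
  · exact (hf.integrable_norm_pow two_ne_zero).mul_const _
  · exact (hf.1.norm.pow 2).mul hq.aestronglyMeasurable
  · by_cases hx : x ∈ K
    · rw [norm_mul, norm_pow, norm_norm]; gcongr; exact hM x hx
    · simp [hz x hx]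

lemma L2T.norm_sq {K : SC} (hK : IsCompact K) {F : ℝ → FC} {f : FC}
    (hf : L2T K F f) {q : FR} (hq : Continuous q) :
    Tendsto (fun i => ∫ x, ‖F i x‖ ^ 2 * q x) (𝓝[>] (0:ℝ)) (𝓝 (∫ x, ‖f x‖ ^ 2 * q x)) := by
  obtain ⟨M, hM⟩ := hK.exists_bound_of_continuousOn hq.continuousOn
  refine tendsto_integral_of_L1 _ (int_sq_mul hK hf.mem hf.z hq).aestronglyMeasurable ?_ ?_
  · filter_upwards [hf.memF, hf.zF] with i h1 h2 using int_sq_mul hK h1 h2 hq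
  have hfin : eLpNorm f 2 volume ≠ ∞ := hf.mem.2.ne
  have t1 : Tendsto (fun i => ENNReal.ofReal M * (eLpNorm (fun x => F i x - f x) 2 volume ^ 2 +
      2 * (eLpNorm (fun x => F i x - f x) 2 volume * eLpNorm f 2 volume)))
      (𝓝[>] (0:ℝ)) (𝓝 0) := by
    have a1 := ENNReal.Tendsto.pow (n := 2) hf.lim
    have a2 := ENNReal.Tendsto.const_mul (a := 2)
      (ENNReal.Tendsto.mul_const (b := eLpNorm f 2 volume) hf.lim (Or.inr hfin))
      (Or.inr bn)
    have a3 := ENNReal.Tendsto.const_mul (a := ENNReal.ofReal M) (a1.add a2)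
      (Or.inr ENNReal.ofReal_ne_top)
    simpa using a3
  refine tendsto_of_tendsto_of_tendsto_of_le_of_le' tendsto_const_nhds t1
      (.of_forall fun _ => zero_le) ?_
  filter_upwards [hf.memF, hf.zF] with i h1 h2
  have hg := (h1.sub hf.mem)
  set g : FC := fun x => F i x - f x with hgdef
  have hgm : AEMeasurable (fun x => ‖g x‖ₑ) (volume : Measure EC) := hg.1.enorm
  have hfm : AEMeasurable (fun x => ‖f x‖ₑ) (volume : Measure EC) := hf.mem.1.enorm
  calc ∫⁻ x, ‖‖F i x‖ ^ 2 * q x - ‖f x‖ ^ 2 * q x‖ₑ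
      ≤ ∫⁻ x, ENNReal.ofReal M * (‖g x‖ₑ ^ 2 + 2 * (‖g x‖ₑ * ‖f x‖ₑ)) := by
        refine lintegral_mono fun x => ?_
        by_cases hx : x ∈ K
        · have hM0 : 0 ≤ M := (norm_nonneg _).trans (hM x hx)
          rw [← sub_mul, enorm_mul, mul_comm]
          refine mul_le_mul' ?_ ?_
          · rw [← ofReal_norm]; exact ENNReal.ofReal_le_ofReal (hM x hx)
          · simp only [← ofReal_norm]
            rw [← ENNReal.ofReal_pow (norm_nonneg _), ← ENNReal.ofReal_mul (norm_nonneg _),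
              show (2:ℝ≥0∞) = ENNReal.ofReal 2 by simp, ← ENNReal.ofReal_mul bn,
              ← ENNReal.ofReal_add bp bp]
            refine ENNReal.ofReal_le_ofReal ?_
            have e1 : ‖F i x‖ ≤ ‖g x‖ + ‖f x‖ := by
              have : F i x = g x + f x := by simp [hgdef]
              rw [this]; exact norm_add_le _ _
            have e2 : ‖f x‖ ≤ ‖g x‖ + ‖F i x‖ := by
              have : f x = F i x - g x := by simp [hgdef]
              rw [this, add_comm]; exact norm_sub_le _ _
            rw [Real.norm_eq_abs, abs_le]
            constructor <;> nlinarith [norm_nonneg (g x), norm_nonneg (f x), norm_nonneg (F i x)]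
        · simp [h2 x hx, hf.z x hx]
    _ = ENNReal.ofReal M * ((∫⁻ x, ‖g x‖ₑ ^ 2) + 2 * ∫⁻ x, ‖g x‖ₑ * ‖f x‖ₑ) := by
        rw [lintegral_const_mul' _ _ ENNReal.ofReal_ne_top,
          lintegral_add_left' (hgm.pow_const 2), lintegral_const_mul' _ _ bn]
    _ ≤ _ := by
        rw [eLp_sq]
        gcongr
        have := ENNReal.lintegral_mul_le_Lp_mul_Lq volume Real.HolderConjugate.two_two hgm hfm
        rw [eLpNorm_eq_lintegral_rpow_enorm_toReal bn bn,
          eLpNorm_eq_lintegral_rpow_enorm_toReal bn bn]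
        simpa using this

lemma mol_hcs {ε : ℝ} (h0 : 0 ≤ ε) {h : FC} {K : SC} (hK : IsCompact K)
    (hz : ∀ x, x ∉ K → h x = 0) : HasCompactSupport (mol ε h) :=
  HasCompactSupport.intro (hK.cthickening (r := ε)) fun _ hx => mol_supp h0 hz hx

lemma L2T_mol {h : FC} (hh : MemLp h 2) {K : SC} (hK : IsCompact K) {d : ℝ}
    (hd : 0 < d) (hz : ∀ x, x ∉ K → h x = 0) :
    L2T (cthickening d K) (fun ε => mol ε h) h where
  memF := by
    filter_upwards [self_mem_nhdsWithin] with ε hε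
    have h0 : (0:ℝ) ≤ ε := le_of_lt hε
    exact (mol_cd h0 (locint_of_memLp hh)).continuous.memLp_of_hasCompactSupport (mol_hcs h0 hK hz)
  mem := hh
  zF := by
    filter_upwards [Ioo_mem_nhdsGT hd] with ε hε x hx
    exact mol_supp hε.1.le hz fun hx' => hx (cthickening_mono hε.2.le K hx')
  z := fun x hx => hz x fun hx' => hx (self_subset_cthickening K hx')
  lim := by
    have := mol_L2 hh
    simp only [eLp_sq] at this
    have t := (ENNReal.continuous_rpow_const (y := 1/2)).tendsto 0 |>.comp this
    refine (t.congr fun ε => ?_).trans (by simp)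
    simp only [Function.comp]
    rw [← ENNReal.rpow_natCast, ← ENNReal.rpow_mul]; norm_num

lemma weak_basic {φ κ : FR} {w : Fin n → FC} {A : FC}
    {B : Fin n → Fin n → FC} {K U : SC} (hK : IsCompact K) (hU : IsOpen U)
    (hKU : K ⊆ U) (h : ContDiff ℝ 2 φ)
    (hw : ∀ j, MemLp (w j) 2) (hwz : ∀ j, ∀ x, x ∉ K → w j x = 0)
    (hA : MemLp A 2) (hAz : ∀ x, x ∉ K → A x = 0)
    (hB : ∀ j k, MemLp (B j k) 2) (hBz : ∀ j k, ∀ x, x ∉ K → B j k x = 0)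
    (eA : ∀ g : FC, ContDiff ℝ 2 g → HasCompactSupport g →
      ∑ j, ∫ x, w j x * dz (ee j) g x = - ∫ x, A x * g x)
    (eB : ∀ j k, ∀ g : FC, ContDiff ℝ 2 g → HasCompactSupport g →
      (∫ x, w j x * db (ee k) g x) - ∫ x, w k x * db (ee j) g x = - ∫ x, B j k x * g x)
    (hκ : Continuous κ) (hl : ∀ x ∈ U, ∀ X, κ x * ‖X‖ ^ 2 ≤ leviForm φ x X) :
    ∑ j, ∫ x, ‖w j x‖ ^ 2 * (κ x * Real.exp (-φ x)) ≤
      (∫ x, ‖A x - ∑ j, dz (ee j) (cx φ) x * w j x‖ ^ 2 * Real.exp (-φ x)) +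
      ∑ j, ∑ k, ∫ x, ‖B j k x‖ ^ 2 * ((1/2) * Real.exp (-φ x)) := by
  obtain ⟨d, hd, hdU⟩ := hK.exists_cthickening_subset_open hU hKU
  have hK1 : IsCompact (cthickening d K) := hK.cthickening
  have ce : Continuous fun x => Real.exp (-φ x) := Real.continuous_exp.comp h.continuous.neg
  have cz : ∀ j, Continuous (dz (ee j) (cx φ)) := fun j => cont_dz (cd_cx (h.of_le one_le_two)) _
  have tw := fun j => L2T_mol (hw j) hK hd (hwz j)
  have tA := L2T_mol hA hK hd hAz
  have tB := fun j k => L2T_mol (hB j k) hK hd (hBz j k)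
  have l1 := tendsto_finsetSum Finset.univ fun j _ =>
    (tw j).norm_sq hK1 (q := fun x => κ x * Real.exp (-φ x)) (hκ.mul ce)
  have l2 := (tA.sub (L2T.sum Finset.univ fun j _ => (tw j).mulc hK1 (cz j))).norm_sq hK1 ce
  have l3 := tendsto_finsetSum Finset.univ fun j _ => tendsto_finsetSum Finset.univ fun k _ =>
    (tB j k).norm_sq hK1 (q := fun x => (1/2) * Real.exp (-φ x)) (continuous_const.mul ce)
  refine le_of_tendsto_of_tendsto l1 (l2.add l3) ?_
  filter_upwards [Ioo_mem_nhdsGT hd] with ε hε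
  have h0 : (0:ℝ) ≤ ε := hε.1.le
  have li := fun j => locint_of_memLp (hw j)
  have cdw := fun j => mol_cd h0 (li j)
  have hcw := fun j => mol_hcs h0 hK (hwz j)
  have hzw : ∀ j x, x ∉ cthickening d K → mol ε (w j) x = 0 := fun j x hx =>
    mol_supp h0 (hwz j) fun hx' => hx (cthickening_mono hε.2.le K hx')
  have hzB : ∀ j k x, x ∉ cthickening d K → mol ε (B j k) x = 0 := fun j k x hx =>
    mol_supp h0 (hBz j k) fun hx' => hx (cthickening_mono hε.2.le K hx')
  have key := basic_ineq h cdw hcw hzw hκ fun x hx => hl x (hdU hx)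
  have E1 : ∀ x, ∑ j, dl φ (ee j) (mol ε (w j)) x =
      mol ε A x - ∑ j, dz (ee j) (cx φ) x * mol ε (w j) x := fun x => by
    simp only [dl, Finset.sum_sub_distrib, mol_dz h0 (li _), Finset.sum_neg_distrib]
    rw [eA _ (moT_cd ε x) (moT_hcs h0 x), neg_neg, mol_C ε A]
  have E2 : ∀ j k x, db (ee k) (mol ε (w j)) x - db (ee j) (mol ε (w k)) x = mol ε (B j k) x :=
    fun j k x => by
    rw [mol_db h0 (li _), mol_db h0 (li _), mol_C]
    have := eB j k _ (moT_cd ε x) (moT_hcs h0 x)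
    linear_combination -this
  simp only [E1, E2] at key
  have mw : ∀ j, MemLp (mol ε (w j)) 2 := fun j =>
    (cdw j).continuous.memLp_of_hasCompactSupport (hcw j)
  have mB : ∀ j k, MemLp (mol ε (B j k)) 2 := fun j k =>
    (mol_cd h0 (locint_of_memLp (hB j k))).continuous.memLp_of_hasCompactSupport
      (mol_hcs h0 hK (hBz j k))
  rw [← integral_finsetSum _ fun j _ => int_sq_mul hK1 (mw j) (hzw j)
    (q := fun x => κ x * Real.exp (-φ x)) (hκ.mul ce)]
  have E3 : ∑ j, ∑ k, ∫ x, ‖mol ε (B j k) x‖ ^ 2 * ((1/2) * Real.exp (-φ x)) =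
      ∫ x, (∑ j, ∑ k, (1/2) * ‖mol ε (B j k) x‖ ^ 2) * Real.exp (-φ x) := by
    have hi := fun j k => int_sq_mul hK1 (mB j k) (hzB j k)
      (q := fun x => (1/2) * Real.exp (-φ x)) (continuous_const.mul ce)
    simp only [← integral_finsetSum _ fun k _ => hi _ k]
    rw [← integral_finsetSum _ fun j _ => integrable_finsetSum _ fun k _ => hi j k]
    refine integral_congr_ae (.of_forall fun x => ?_)
    simp only [Finset.sum_mul]
    refine Finset.sum_congr rfl fun j _ => Finset.sum_congr rfl fun k _ => by ring
  rw [E3]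
  refine le_trans (le_of_eq ?_) key
  refine integral_congr_ae (.of_forall fun x => ?_)
  simp only [Finset.mul_sum, Finset.sum_mul]
  refine Finset.sum_congr rfl fun j _ => by ring

lemma ev_cd {F : Type*} [NormedAddCommGroup F] [NormedSpace ℝ F] {f : EC → F} {x : EC}
    (hf : ContDiffAt ℝ 2 f x) : ∀ᶠ y in 𝓝 x, DifferentiableAt ℝ f y := by
  filter_upwards [hf.eventually (by simp)] with y hy using hy.differentiableAt two_ne_zero
lemma df2 {F : Type*} [NormedAddCommGroup F] [NormedSpace ℝ F] {f : EC → F} {x : EC}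
    (hf : ContDiffAt ℝ 2 f x) : DifferentiableAt ℝ (fderiv ℝ f) x :=
  (hf.fderiv_right (m := 1) bn).differentiableAt one_ne_zero

lemma levi_congr {f g : FR} {x : EC} (h : f =ᶠ[𝓝 x] g) (X : EC) :
    leviForm f x X = leviForm g x X := by
  have := h.fderiv (𝕜 := ℝ)
  have h1 : ∀ X : EC, (fun w => fderiv ℝ f w X) =ᶠ[𝓝 x] fun w => fderiv ℝ g w X :=
    fun X => this.mono fun y hy => by simp only [hy]
  rw [leviForm, leviForm, (h1 X).fderiv_eq, (h1 (Complex.I • X)).fderiv_eq]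

lemma levi_add {f g : FR} {x : EC} (hf : ContDiffAt ℝ 2 f x) (hg : ContDiffAt ℝ 2 g x)
    (X : EC) : leviForm (fun y => f y + g y) x X = leviForm f x X + leviForm g x X := by
  have e : fderiv ℝ (fun y => f y + g y) =ᶠ[𝓝 x] fun y => fderiv ℝ f y + fderiv ℝ g y := by
    filter_upwards [ev_cd hf, ev_cd hg] with y h1 h2 using fderiv_fun_add h1 h2
  rw [levi_eq (hf.add hg), levi_eq hf, levi_eq hg, e.fderiv_eq, fderiv_fun_add (df2 hf) (df2 hg)]
  simp only [add_apply]; ring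

lemma fd2_comp {f : FR} {c : ℝ → ℝ} {x : EC} (hf : ContDiffAt ℝ 2 f x)
    (hc : ContDiffAt ℝ 2 c (f x)) (X Y : EC) :
    fderiv ℝ (fderiv ℝ (fun y => c (f y))) x X Y = deriv c (f x) * fderiv ℝ (fderiv ℝ f) x X Y +
      deriv (deriv c) (f x) * fderiv ℝ f x X * fderiv ℝ f x Y := by
  have ec : ∀ᶠ t in 𝓝 (f x), DifferentiableAt ℝ c t := by
    filter_upwards [hc.eventually (by simp)] with y hy using hy.differentiableAt two_ne_zero
  have e : fderiv ℝ (fun y => c (f y)) =ᶠ[𝓝 x] fun y => deriv c (f y) • fderiv ℝ f y := by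
    filter_upwards [ev_cd hf, hf.continuousAt.eventually ec] with y h1 h2
    exact (h2.hasDerivAt.comp_hasFDerivAt y h1.hasFDerivAt).fderiv
  have d1 : DifferentiableAt ℝ f x := hf.differentiableAt two_ne_zero
  have d2 : DifferentiableAt ℝ (deriv c) (f x) := by
    have : ContDiffAt ℝ 1 (deriv c) (f x) := by
      have h := (hc.fderiv_right (m := 1) bn).clm_apply (contDiffAt_const (c := (1:ℝ)))
      exact h
    exact this.differentiableAt one_ne_zero
  have d3 : HasFDerivAt (fun y => deriv c (f y)) (deriv (deriv c) (f x) • fderiv ℝ f x) x :=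
    d2.hasDerivAt.comp_hasFDerivAt x d1.hasFDerivAt
  rw [e.fderiv_eq, fderiv_fun_smul d3.differentiableAt (df2 hf), d3.fderiv]
  simp [ContinuousLinearMap.smulRight_apply]

lemma levi_comp {f : FR} {c : ℝ → ℝ} {x : EC} (hf : ContDiffAt ℝ 2 f x)
    (hc : ContDiffAt ℝ 2 c (f x)) (X : EC) :
    leviForm (fun y => c (f y)) x X = deriv c (f x) * leviForm f x X +
      deriv (deriv c) (f x) * ((fderiv ℝ f x X) ^ 2 + (fderiv ℝ f x (I • X)) ^ 2) / 4 := by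
  have hcf : ContDiffAt ℝ 2 (fun y => c (f y)) x := hc.comp x hf
  rw [levi_eq hcf, levi_eq hf, fd2_comp hf hc, fd2_comp hf hc]; ring

lemma fd_nsq (a x X : EC) : fderiv ℝ (fun y => ‖y - a‖ ^ 2) x X = 2 * inner ℝ (x - a) X := by
  have h : HasFDerivAt (fun y : EC => y - a) (ContinuousLinearMap.id ℝ EC) x :=
    (hasFDerivAt_id x).sub_const a
  rw [h.norm_sq.fderiv]; simp [inner_sub_left]

lemma fd2_nsq (a x X Y : EC) :
    fderiv ℝ (fderiv ℝ (fun y => ‖y - a‖ ^ 2)) x X Y = 2 * inner ℝ X Y := by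
  have hc : ContDiff ℝ 2 (fun y : EC => ‖y - a‖ ^ 2) := (contDiff_id.sub contDiff_const).norm_sq ℝ
  rw [← fd_fd hc.contDiffAt]
  simp only [fd_nsq]
  have h : HasFDerivAt (fun y : EC => 2 * inner ℝ (y - a) Y)
     ((2:ℝ) • (innerSL ℝ Y)) x := by
    have h1 : HasFDerivAt (fun y : EC => y - a) (ContinuousLinearMap.id ℝ EC) x :=
      (hasFDerivAt_id x).sub_const a
    have h2 := ((innerSL ℝ Y).hasFDerivAt (x := x - a)).comp x h1
    have h3 := h2.const_mul 2
    refine (h3.congr_of_eventuallyEq (.of_forall fun y => ?_)).congr_fderiv (by ext; simp)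
    simp [real_inner_comm]
  rw [h.fderiv]; simp [real_inner_comm]

lemma cd_nsq (a : EC) : ContDiff ℝ 2 (fun y : EC => ‖y - a‖ ^ 2) :=
  (contDiff_id.sub contDiff_const).norm_sq ℝ

lemma levi_nsq (a x X : EC) : leviForm (fun y => ‖y - a‖ ^ 2) x X = ‖X‖ ^ 2 := by
  rw [levi_eq (cd_nsq a).contDiffAt, fd2_nsq, fd2_nsq, real_inner_self_eq_norm_sq,
    real_inner_self_eq_norm_sq, norm_smul]; simp; ring

lemma taylor2 {f : FR} {x : EC} (hf : ContDiffAt ℝ 2 f x) {c : ℝ} (hc : 0 < c) :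
    ∃ d > 0, ∀ h : EC, ‖h‖ < d →
      |f (x + h) - f x - fderiv ℝ f x h - (1/2) * fderiv ℝ (fderiv ℝ f) x h h| ≤ c * ‖h‖ ^ 2 := by
  have h1 := (df2 hf).hasFDerivAt.isLittleO
  have h2 := (Asymptotics.isLittleO_iff.1 h1) hc
  obtain ⟨d, hd, hdd⟩ := Metric.eventually_nhds_iff.1 (h2.and (ev_cd hf))
  refine ⟨d, hd, fun h hh => ?_⟩
  set S := fderiv ℝ (fderiv ℝ f) x
  let G : FR := fun y => f (x + y) - fderiv ℝ f x y - (1/2) * S y y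
  have hG : ∀ y, ‖y‖ < d → HasFDerivAt G (fderiv ℝ f (x + y) - fderiv ℝ f x - S y) y := by
    intro y hy
    have d0 : DifferentiableAt ℝ f (x + y) := (@hdd (x + y) (by simpa using hy)).2
    have a1 : HasFDerivAt (fun y => f (x + y)) (fderiv ℝ f (x + y)) y :=
      (d0.hasFDerivAt.comp y ((hasFDerivAt_id y).const_add x)).congr_fderiv (by ext; simp)
    have a2 : HasFDerivAt (fun y => S y y) (S y + S.flip y) y := by
      have := (S.hasFDerivAt (x := y)).clm_apply (hasFDerivAt_id y)
      refine this.congr_fderiv ?_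
      ext z; simp
    refine ((a1.sub (fderiv ℝ f x).hasFDerivAt).sub (a2.const_mul (1/2))).congr_fderiv ?_
    ext z
    simp only [sub_apply, smul_apply, add_apply, ContinuousLinearMap.flip_apply, smul_eq_mul]
    rw [show S z y = S y z from fd_symm hf z y]; ring
  have key := Convex.norm_image_sub_le_of_norm_hasFDerivWithin_le (𝕜 := ℝ) (f := G)
    (s := closedBall 0 ‖h‖) (C := c * ‖h‖) (x := 0) (y := h)
    (f' := fun y => fderiv ℝ f (x + y) - fderiv ℝ f x - S y)
    (fun y hy => (hG y (lt_of_le_of_lt (by simpa using hy) hh)).hasFDerivWithinAt)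
    (fun y hy => by
      have hy' : ‖y‖ ≤ ‖h‖ := by simpa using hy
      have := (@hdd (x + y) (by simpa using lt_of_le_of_lt hy' hh)).1
      simp only [add_sub_cancel_left] at this
      exact this.trans (by gcongr)) (convex_closedBall _ _) (by simp) (by simp)
  simp only [G, sub_zero, add_zero, map_zero, mul_zero] at key
  rw [Real.norm_eq_abs] at key
  have e : f (x + h) - f x - fderiv ℝ f x h - 1 / 2 * S h h =
    f (x + h) - fderiv ℝ f x h - 1 / 2 * S h h - f x := by ring
  rw [e, pow_two, ← mul_assoc]
  convert key using 2

lemma levi_nonneg {f : FR} {x : EC} (hf : ContDiff ℝ 2 f) (X : EC) {s0 : ℝ} (h0 : 0 < s0)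
    (hs : ∀ s : ℝ, 0 < s → s < s0 → (2 * Real.pi) * f x ≤ ∫ θ in (0:ℝ)..(2 * Real.pi),
        f (x + ((s : ℂ) * Complex.exp (θ * Complex.I)) • X)) : 0 ≤ leviForm f x X := by
  by_contra! hneg
  obtain ⟨c, hc, hcl⟩ : ∃ c > 0, c * ‖X‖ ^ 2 < - leviForm f x X :=
    ⟨-leviForm f x X / (2 * (‖X‖ ^ 2 + 1)), div_pos (by linarith) bp, by
      rw [div_mul_eq_mul_div, div_lt_iff₀ bp]; nlinarith [sq_nonneg ‖X‖]⟩
  obtain ⟨d, hd, ht⟩ := taylor2 (hf.contDiffAt (x := x)) hc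
  obtain ⟨s, hs1, hs2, hs3⟩ : ∃ s : ℝ, 0 < s ∧ s < s0 ∧ s * ‖X‖ < d := by
    refine ⟨min (s0 / 2) (d / (2 * (‖X‖ + 1))), by positivity, ?_, ?_⟩
    · exact (min_le_left _ _).trans_lt (by linarith)
    · calc _ ≤ d / (2 * (‖X‖ + 1)) * ‖X‖ := by gcongr; exact min_le_right _ _
        _ < d := by rw [div_mul_eq_mul_div, div_lt_iff₀ bp]; nlinarith [norm_nonneg X]
  have hh := hs s hs1 hs2
  set S := fderiv ℝ (fderiv ℝ f) x with hS
  have pt : ∀ θ : ℝ, f (x + ((s : ℂ) * Complex.exp (θ * Complex.I)) • X) ≤ f x +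
      (s * fderiv ℝ f x X) * Real.cos θ + (s * fderiv ℝ f x (I • X)) * Real.sin θ +
      (s ^ 2 / 2 * S X X) * Real.cos θ ^ 2 + (s ^ 2 / 2 * S (I • X) (I • X)) * Real.sin θ ^ 2 +
      (s ^ 2 * S X (I • X)) * (Real.sin θ * Real.cos θ) + c * (s ^ 2 * ‖X‖ ^ 2) := by
    intro θ
    set h := ((s : ℂ) * Complex.exp (θ * Complex.I)) • X with hdef
    have e1 : h = (s * Real.cos θ) • X + (s * Real.sin θ) • (I • X) := by
      rw [hdef, Complex.exp_mul_I, ← Complex.coe_smul, ← Complex.coe_smul, smul_smul, ← add_smul]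
      push_cast; congr 1; ring
    have e2 : ‖h‖ = s * ‖X‖ := by
      rw [hdef, norm_smul, norm_mul, Complex.norm_exp_ofReal_mul_I]
      simp [abs_of_pos hs1]
    have h3 := ht h (by rw [e2]; exact hs3)
    have h4 := (abs_le.1 h3).2
    rw [e2] at h4
    have e3 : fderiv ℝ f x h = (s * fderiv ℝ f x X) * Real.cos θ +
      (s * fderiv ℝ f x (I • X)) * Real.sin θ := by
      rw [e1]; simp only [map_add, map_smul, smul_eq_mul]; ring
    have e4 : S h h = (s ^ 2 * S X X) * Real.cos θ ^ 2 + (s ^ 2 * S (I • X) (I • X)) * Real.sin θ ^ 2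
       + 2 * (s ^ 2 * S X (I • X)) * (Real.sin θ * Real.cos θ) := by
      rw [e1]; simp only [map_add, map_smul, smul_eq_mul, add_apply, smul_apply]
      rw [show S (I • X) X = S X (I • X) from fd_symm hf.contDiffAt _ _]; ring
    rw [e3, e4] at h4
    linarith
  have cf : Continuous fun θ : ℝ => f (x + ((s : ℂ) * Complex.exp (θ * Complex.I)) • X) := by
    have := hf.continuous; fun_prop
  have bd := intervalIntegral.integral_mono_on (μ := volume) (a := 0) (b := 2 * Real.pi) bp
    (cf.intervalIntegrable _ _) (Continuous.intervalIntegrable (by fun_prop) _ _)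
    fun θ _ => pt θ
  have ev : ∫ θ in (0:ℝ)..(2 * Real.pi), (f x +
      (s * fderiv ℝ f x X) * Real.cos θ + (s * fderiv ℝ f x (I • X)) * Real.sin θ +
      (s ^ 2 / 2 * S X X) * Real.cos θ ^ 2 + (s ^ 2 / 2 * S (I • X) (I • X)) * Real.sin θ ^ 2 +
      (s ^ 2 * S X (I • X)) * (Real.sin θ * Real.cos θ) + c * (s ^ 2 * ‖X‖ ^ 2)) =
      2 * Real.pi * f x + Real.pi * (s ^ 2 / 2 * S X X) + Real.pi * (s ^ 2 / 2 * S (I • X) (I • X))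
      + 2 * Real.pi * (c * (s ^ 2 * ‖X‖ ^ 2)) := by
    rw [intervalIntegral.integral_add (Continuous.intervalIntegrable (by fun_prop) _ _)
        (Continuous.intervalIntegrable (by fun_prop) _ _),
      intervalIntegral.integral_add (Continuous.intervalIntegrable (by fun_prop) _ _)
        (Continuous.intervalIntegrable (by fun_prop) _ _),
      intervalIntegral.integral_add (Continuous.intervalIntegrable (by fun_prop) _ _)
        (Continuous.intervalIntegrable (by fun_prop) _ _),
      intervalIntegral.integral_add (Continuous.intervalIntegrable (by fun_prop) _ _)
        (Continuous.intervalIntegrable (by fun_prop) _ _),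
      intervalIntegral.integral_add (Continuous.intervalIntegrable (by fun_prop) _ _)
        (Continuous.intervalIntegrable (by fun_prop) _ _),
      intervalIntegral.integral_add (Continuous.intervalIntegrable (by fun_prop) _ _)
        (Continuous.intervalIntegrable (by fun_prop) _ _)]
    simp only [intervalIntegral.integral_const_mul, intervalIntegral.integral_const, integral_cos,
      integral_sin, integral_cos_sq, integral_sin_sq, integral_sin_mul_cos₁]
    simp; ring
  rw [ev] at bd
  have l1 := hh.trans bd
  have l2 : leviForm f x X = (S X X + S (I • X) (I • X)) / 4 := levi_eq hf.contDiffAt X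
  have l3 : 0 ≤ (2 * Real.pi * s ^ 2) * (leviForm f x X + c * ‖X‖ ^ 2) := by
    rw [l2]; nlinarith
  have l4 : (2 * Real.pi * s ^ 2) * (leviForm f x X + c * ‖X‖ ^ 2) < 0 :=
    mul_neg_of_pos_of_neg bp (by linarith)
  linarith

lemma mol_submean {u : FR} (hu : Continuous u) {ε s : ℝ} (h0 : 0 ≤ ε) {x X : EC}
    (h : ∀ t : EC, ‖t‖ ≤ ε → (2 * Real.pi) * u (x - t) ≤ ∫ θ in (0:ℝ)..(2 * Real.pi),
      u (x - t + ((s : ℂ) * Complex.exp (θ * Complex.I)) • X)) :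
    (2 * Real.pi) * mol ε u x ≤ ∫ θ in (0:ℝ)..(2 * Real.pi),
      mol ε u (x + ((s : ℂ) * Complex.exp (θ * Complex.I)) • X) := by
  have hp : (0:ℝ) ≤ 2 * Real.pi := by positivity
  simp only [mol_eq, smul_eq_mul]
  have mc := (mo_cd (n := n) ε).continuous
  have z : ∀ (g : FR), ∫ t, mo ε t * g t = ∫ t in closedBall (0:EC) ε, mo ε t * g t := by
    intro g
    rw [setIntegral_eq_integral_of_forall_compl_eq_zero]
    intro t ht
    rw [mo_zero h0 (by simpa using (not_le.1 (fun h => ht (by simpa using h))).le), zero_mul]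
  let G : EC → ℝ → ℝ := fun t θ => mo ε t * u (x - t + ((s : ℂ) * Complex.exp (θ * Complex.I)) • X)
  have cG : Continuous (Function.uncurry G) := by
    simp only [G, Function.uncurry_def]; fun_prop
  have iG : Integrable (Function.uncurry G) ((volume.restrict (closedBall (0:EC) ε)).prod
      (volume.restrict (Ioc 0 (2 * Real.pi)))) := by
    rw [Measure.prod_restrict]
    exact (cG.continuousOn.integrableOn_compact ((isCompact_closedBall (0:EC) ε).prod
      (isCompact_Icc (a := (0:ℝ)) (b := 2 * Real.pi)))).mono_set (Set.prod_mono le_rfl Ioc_subset_Icc_self)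
  have sw := integral_integral_swap iG
  calc 2 * Real.pi * ∫ t, mo ε t * u (x - t)
      = ∫ t in closedBall (0:EC) ε, mo ε t * (2 * Real.pi * u (x - t)) := by
        rw [z, ← integral_const_mul]; congr 1; ext t; ring
    _ ≤ ∫ t in closedBall (0:EC) ε, ∫ θ in Ioc 0 (2 * Real.pi), G t θ := by
        refine setIntegral_mono_on ?_ ?_ measurableSet_closedBall fun t ht => ?_
        · exact (Continuous.continuousOn (by fun_prop)).integrableOn_compact (isCompact_closedBall _ _)
        · exact iG.integral_prod_left
        · simp only [G]
          rw [integral_const_mul, ← intervalIntegral.integral_of_le hp]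
          exact mul_le_mul_of_nonneg_left (h t (by simpa using ht)) (mo_nonneg _ _)
    _ = ∫ θ in Ioc 0 (2 * Real.pi), ∫ t in closedBall (0:EC) ε, G t θ := sw
    _ = _ := by
        rw [intervalIntegral.integral_of_le hp]
        congr 1; ext θ
        rw [z]; congr 1; ext t; simp only [G]; congr 2; abel

lemma mol_close {u : FR} (hu : Continuous u) {ε c : ℝ} (h0 : 0 < ε) {x : EC}
    (h : ∀ t : EC, ‖t‖ ≤ ε → |u (x - t) - u x| ≤ c) : |mol ε u x - u x| ≤ c := by
  have mc := (mo_cd (n := n) ε).continuous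
  have i1 : Integrable fun t => mo ε t * u (x - t) :=
    (Continuous.integrable_of_hasCompactSupport (by fun_prop) (mo_hcs h0.le).mul_right)
  have e : mol ε u x - u x = ∫ t, mo ε t * (u (x - t) - u x) := by
    rw [mol_eq]
    simp only [smul_eq_mul, mul_sub]
    rw [integral_sub i1 ((mo_integrable h0.le).mul_const _), integral_mul_const, mo_int h0, one_mul]
  rw [e, ← Real.norm_eq_abs]
  calc _ ≤ ∫ t, mo (n := n) ε t * c := by
        refine norm_integral_le_of_norm_le ((mo_integrable h0.le).mul_const _) (.of_forall fun t => ?_)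
        rw [norm_mul, Real.norm_of_nonneg (mo_nonneg _ _)]
        by_cases ht : ‖t‖ ≤ ε
        · exact mul_le_mul_of_nonneg_left (h t ht) (mo_nonneg _ _)
        · rw [mo_zero h0.le (not_le.1 ht).le]; simp
    _ = c := by rw [integral_mul_const, mo_int h0, one_mul]

lemma log_max_lip {κ a b : ℝ} (hκ : 0 < κ) :
    |-Real.log (max a κ) - -Real.log (max b κ)| ≤ |a - b| / κ := by
  have key : ∀ a b : ℝ, Real.log (max a κ) - Real.log (max b κ) ≤ |a - b| / κ := by
    intro a b
    have ha : 0 < max a κ := lt_max_of_lt_right hκ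
    have hb : 0 < max b κ := lt_max_of_lt_right hκ
    rw [← Real.log_div ha.ne' hb.ne']
    refine (Real.log_le_sub_one_of_pos bp).trans ?_
    rw [div_sub_one hb.ne']
    have h1 : max a κ - max b κ ≤ |a - b| := (le_abs_self _).trans (abs_max_sub_max_le_abs a b κ)
    calc _ ≤ |a - b| / max b κ := by gcongr
      _ ≤ _ := by gcongr; exact le_max_right _ _
  rw [abs_le]
  constructor
  · have := key a b; linarith
  · have := key b a; rw [abs_sub_comm] at this; linarith

lemma exhaustion {Ω K : SC} (hΩ : IsPseudoconvex Ω) (hK : IsCompact K) (hKΩ : K ⊆ Ω) :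
    ∃ r : FR, ContDiff ℝ 2 r ∧ IsCompact {x | r x ≤ 0} ∧ {x | r x ≤ 0} ⊆ Ω ∧
      (∀ x, r x ≤ 0 → ∀ X, ‖X‖ ^ 2 ≤ leviForm r x X) ∧ ∀ x ∈ K, r x < -3 := by
  obtain ⟨R, hR⟩ := hK.isBounded.subset_closedBall 0
  have hR' : ∀ x ∈ K, ‖x‖ ^ 2 ≤ R ^ 2 := fun x hx => by
    have := hR hx; rw [mem_closedBall_zero_iff] at this; gcongr
  have cn : ContDiff ℝ 2 (fun y : EC => ‖y‖ ^ 2) := contDiff_id.norm_sq ℝ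
  have ln : ∀ x X : EC, leviForm (fun y => ‖y‖ ^ 2) x X = ‖X‖ ^ 2 := fun x X => by
    have := levi_nsq 0 x X; simpa using this
  have lc : ∀ (c : ℝ) (x X : EC), leviForm (fun _ => c) x X = 0 := fun c x X => by simp [leviForm]
  rcases (em (Ω = univ)).imp_right (fun h => nonempty_compl.2 h) with h | ⟨q, hq⟩
  · refine ⟨fun x => ‖x‖ ^ 2 + -(R ^ 2 + 4), cn.add contDiff_const, ?_, by simp [h], ?_, ?_⟩
    · refine (isCompact_closedBall (0 : EC) (R ^ 2 + 4)).of_isClosed_subset ?_ ?_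
      · exact isClosed_le (by fun_prop) continuous_const
      · intro x hx
        simp only [mem_ofPred_eq] at hx
        rw [mem_closedBall_zero_iff]; nlinarith [norm_nonneg x, sq_nonneg (‖x‖ - 1), sq_nonneg R]
    · intro x _ X
      rw [levi_add cn.contDiffAt contDiffAt_const, ln, lc, add_zero]
    · intro x hx; have := hR' x hx; simp only; linarith
  · have ne : (Ωᶜ).Nonempty := ⟨q, hq⟩
    have hcl : IsClosed Ωᶜ := hΩ.1.isClosed_compl
    set d : FR := fun x => infDist x Ωᶜ with hd
    have dc : Continuous d := continuous_infDist_pt _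
    have dpos : ∀ x, 0 < d x → x ∈ Ω := fun x hx => by
      by_contra h; rw [hd] at hx; simp only [infDist_zero_of_mem (show x ∈ Ωᶜ from h)] at hx
      exact lt_irrefl _ hx
    obtain ⟨d0, hd0, hd0K⟩ := hK.exists_forall_le' (f := d) (a := 0) dc.continuousOn
      (fun x hx => (hcl.notMem_iff_infDist_pos ne).1 (fun h => h (hKΩ hx)))
    set c := |Real.log d0| + R ^ 2 + 5 with hc
    have hc0 : 4 ≤ c := by have := abs_nonneg (Real.log d0); nlinarith [sq_nonneg R]
    set κ := Real.exp (-c - 1) / 4 with hκ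
    have κ0 : 0 < κ := by positivity
    have κ1 : κ ≤ 1 := by
      have : Real.exp (-c - 1) ≤ 1 := Real.exp_le_one_iff.2 (by linarith)
      linarith
    set u : FR := fun x => -Real.log (max (d x) κ) with hu
    have mpos : ∀ x, 0 < max (d x) κ := fun x => lt_max_of_lt_right κ0
    have uc : Continuous u := ((dc.max continuous_const).log fun x => (mpos x).ne').neg
    have dl : ∀ x y, |d x - d y| ≤ ‖x - y‖ := fun x y => by
      rw [abs_le]
      have h1 := infDist_le_infDist_add_dist (s := Ωᶜ) (x := x) (y := y)
      have h2 := infDist_le_infDist_add_dist (s := Ωᶜ) (x := y) (y := x)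
      rw [dist_comm] at h2
      rw [dist_eq_norm] at h1 h2
      constructor <;> simp only [hd] <;> linarith
    have cl : ∀ x, |mol (κ / 2) u x - u x| ≤ 1 := fun x => by
      refine mol_close uc bp fun t ht => ?_
      refine (log_max_lip κ0).trans ?_
      rw [div_le_one κ0]
      refine (dl _ _).trans ?_
      simp only [sub_sub_cancel_left, norm_neg]; linarith
    have cm : ContDiff ℝ 2 (mol (κ / 2) u) := mol_cd bp uc.locallyIntegrable
    have big : ∀ x, mol (κ / 2) u x + ‖x‖ ^ 2 + -c ≤ 0 → 4 * κ ≤ d x := fun x hx => by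
      have h1 := (abs_le.1 (cl x)).1
      have h2 : -c - 1 ≤ Real.log (max (d x) κ) := by
        have : u x = -Real.log (max (d x) κ) := rfl
        nlinarith [sq_nonneg ‖x‖]
      rw [Real.le_log_iff_exp_le (mpos x)] at h2
      rcases le_max_iff.1 h2 with h | h
      · linarith
      · linarith
    refine ⟨fun x => mol (κ / 2) u x + ‖x‖ ^ 2 + -c, (cm.add cn).add contDiff_const, ?_, ?_, ?_, ?_⟩
    · refine (isCompact_closedBall (0 : EC) (c + 2 + ‖q‖)).of_isClosed_subset ?_ ?_
      · exact isClosed_le ((cm.continuous.add cn.continuous).add continuous_const) continuous_const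
      · intro x hx
        simp only [mem_ofPred_eq] at hx
        rw [mem_closedBall_zero_iff]
        have h1 := (abs_le.1 (cl x)).1
        have h2 : d x ≤ ‖x‖ + ‖q‖ := by
          have := infDist_le_dist_of_mem (x := x) hq
          rw [dist_eq_norm] at this
          exact this.trans (norm_sub_le _ _)
        have h3 : Real.log (max (d x) κ) ≤ d x := by
          refine (Real.log_le_sub_one_of_pos (mpos x)).trans ?_
          have : max (d x) κ ≤ d x + 1 := max_le (by linarith)
            (by have : 0 ≤ d x := infDist_nonneg
                linarith)
          linarith
        have h4 : u x = -Real.log (max (d x) κ) := rfl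
        by_contra! hlt
        nlinarith [norm_nonneg x, norm_nonneg q]
    · intro x hx
      exact dpos x (by have := big x hx; linarith)
    · intro x hx X
      rw [levi_add (cm.add cn).contDiffAt contDiffAt_const, levi_add cm.contDiffAt cn.contDiffAt, ln, lc,
        add_zero]
      have := big x hx
      have : 0 ≤ leviForm (mol (κ / 2) u) x X := by
        refine levi_nonneg cm X (s0 := κ / (‖X‖ + 1)) bp fun s s1 s2 => ?_
        refine mol_submean uc bp fun t ht => ?_
        have sX : s * ‖X‖ ≤ κ := by
          rw [lt_div_iff₀ bp] at s2; nlinarith [norm_nonneg X]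
        have ld : ∀ l : ℂ, ‖l‖ ≤ s → 2 * κ ≤ d (x - t + l • X) := fun l hl => by
          have h1 := (abs_le.1 (dl (x - t + l • X) x)).1
          have h2 : ‖x - t + l • X - x‖ ≤ κ / 2 + κ := by
            rw [show x - t + l • X - x = l • X - t by abel]
            refine (norm_sub_le _ _).trans ?_
            rw [norm_smul]
            have : ‖l‖ * ‖X‖ ≤ s * ‖X‖ := by gcongr
            linarith
          linarith
        have ueq : ∀ l : ℂ, ‖l‖ ≤ s → u (x - t + l • X) = -Real.log (d (x - t + l • X)) := fun l hl => by
          simp only [hu]; rw [max_eq_left (by linarith [ld l hl])]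
        have hmem : ∀ l : ℂ, ‖l‖ ≤ s → x - t + l • X ∈ Ω := fun l hl => dpos _ (by linarith [ld l hl])
        have sm := hΩ.2.2 (x - t) (by simpa using hmem 0 (by simpa using s1.le)) X s s1 hmem
        have e0 := ueq 0 (by simpa using s1.le)
        simp only [zero_smul, add_zero] at e0
        rw [e0]
        have nl : ∀ θ : ℝ, ‖(s : ℂ) * Complex.exp (θ * Complex.I)‖ ≤ s := fun θ => by
          rw [norm_mul, Complex.norm_exp_ofReal_mul_I]; simp [abs_of_pos s1]
        simp only [fun θ : ℝ => ueq _ (nl θ)]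
        rw [one_div, ← div_eq_inv_mul, le_div_iff₀ bp] at sm
        linarith
      linarith
    · intro x hx
      have h1 := (abs_le.1 (cl x)).2
      have h2 : Real.log d0 ≤ Real.log (max (d x) κ) :=
        Real.log_le_log hd0 ((hd0K x hx).trans (le_max_left _ _))
      have h4 : u x = -Real.log (max (d x) κ) := rfl
      have := hR' x hx
      have := neg_abs_le (Real.log d0)
      simp only; linarith

lemma cut {K D : SC} (hK : IsCompact K) (hD : IsOpen D) (h : K ⊆ D) :
    ∃ χ : FR, ContDiff ℝ 2 χ ∧ HasCompactSupport χ ∧ tsupport χ ⊆ D ∧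
      (∃ U, IsOpen U ∧ K ⊆ U ∧ U ⊆ D ∧ ∀ x ∈ U, χ x = 1) ∧ ∀ x, 0 ≤ χ x ∧ χ x ≤ 1 := by
  obtain ⟨L, hL, h1, h2⟩ := exists_compact_between hK hD h
  obtain ⟨f, f1, f2, f3⟩ := exists_contMDiffMap_one_nhds_of_subset_interior
    (modelWithCornersSelf ℝ EC) (n := 2) hK.isClosed h1
  have ts : tsupport f ⊆ L := closure_minimal (fun x hx => by
    by_contra h; exact hx (f2 x h)) hL.isClosed
  obtain ⟨U, hU, hKU, hU1⟩ := eventually_nhdsSet_iff_exists.1 f1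
  exact ⟨f, f.contMDiff.contDiff, hL.of_isClosed_subset (isClosed_tsupport _) ts, ts.trans h2,
    ⟨U ∩ D, hU.inter hD, subset_inter hKU h, inter_subset_right, fun x hx => hU1 x hx.1⟩,
    fun x => ⟨(f3 x).1, (f3 x).2⟩⟩

lemma cd_tsupp {F : Type*} [NormedAddCommGroup F] [NormedSpace ℝ F] {f : EC → F} {D : SC}
    (hD : IsOpen D) (hf : ContDiffOn ℝ 2 f D) (ht : tsupport f ⊆ D) : ContDiff ℝ 2 f := by
  rw [contDiff_iff_contDiffAt]
  intro x
  by_cases hx : x ∈ D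
  · exact hf.contDiffAt (hD.mem_nhds hx)
  · have : f =ᶠ[𝓝 x] fun _ => 0 := notMem_tsupport_iff_eventuallyEq.1 fun h => hx (ht h)
    exact contDiffAt_const.congr_of_eventuallyEq this

lemma glob {F : Type*} [NormedAddCommGroup F] [NormedSpace ℝ F] {f : EC → F} {K D : SC}
    (hK : IsCompact K) (hD : IsOpen D) (h : K ⊆ D) (hf : ContDiffOn ℝ 2 f D) :
    ∃ g U, ContDiff ℝ 2 g ∧ IsOpen U ∧ K ⊆ U ∧ U ⊆ D ∧ ∀ x ∈ U, g x = f x := by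
  obtain ⟨χ, h1, h2, h3, ⟨U, hU, hKU, hUD, hU1⟩, h5⟩ := cut hK hD h
  refine ⟨fun x => χ x • f x, U, cd_tsupp hD (h1.contDiffOn.smul hf) ?_, hU, hKU, hUD,
    fun x hx => by simp [hU1 x hx]⟩
  exact (tsupport_smul_subset_left χ f).trans h3

def Good (E : FR) (a : EC → EC) : Prop :=
  Measurable a ∧ Integrable fun x => E x * ‖a x‖ ^ 2

lemma decompW {E : FR} (hE : Measurable E) (hE0 : ∀ x, 0 ≤ E x)
    (T : Set (EC → EC)) (hT : ∀ t ∈ T, Good E t) {v : EC → EC} (hv : Good E v) :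
    ∃ v1, Good E v1 ∧ (∀ t ∈ T, ∫ x, E x • inner ℂ (t x) (v1 x) = 0) ∧
      ∀ a, Good E a → (∀ t ∈ T, ∫ x, E x • inner ℂ (t x) (a x) = 0) →
        ∫ x, E x • inner ℂ (a x) (v1 x) = ∫ x, E x • inner ℂ (a x) (v x) := by
  set μ : Measure EC := volume.withDensity fun x => ((E x).toNNReal : ℝ≥0∞) with hμ
  have mE : Measurable fun x => (E x).toNNReal := measurable_real_toNNReal.comp hE
  have ig : ∀ g : FC, ∫ x, g x ∂μ = ∫ x, E x • g x := fun g => by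
    rw [hμ, integral_withDensity_eq_integral_smul mE]
    refine integral_congr_ae (.of_forall fun t => ?_)
    simp only [NNReal.smul_def, Real.coe_toNNReal _ (hE0 t)]
  have gm : ∀ a, Measurable a → (Good E a ↔ MemLp a 2 μ) := fun a ha => by
    rw [memLp_two_iff_integrable_sq_norm ha.aestronglyMeasurable, hμ,
      integrable_withDensity_iff_integrable_smul mE, Good]
    simp only [ha, true_and, NNReal.smul_def, Real.coe_toNNReal _ (hE0 _), smul_eq_mul]
  let S : Submodule ℂ (Lp EC 2 μ) :=
    Submodule.span ℂ {f | ∃ t, ∃ ht : t ∈ T, f = ((gm t (hT t ht).1).1 (hT t ht)).toLp t}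
  let V : Lp EC 2 μ := ((gm v hv.1).1 hv).toLp v
  let W := (Sᗮ).starProjection V
  have inn : ∀ a (ha : MemLp a 2 μ) (f : Lp EC 2 μ),
      inner ℂ (ha.toLp a) f = ∫ x, E x • inner ℂ (a x) (f x) := fun a ha f => by
    rw [L2.inner_def, ← ig]
    refine integral_congr_ae ?_
    filter_upwards [ha.coeFn_toLp] with x hx
    rw [hx]
  have inn2 : ∀ a (ha : MemLp a 2 μ) b (hb : MemLp b 2 μ),
      inner ℂ (ha.toLp a) (hb.toLp b) = ∫ x, E x • inner ℂ (a x) (b x) := fun a ha b hb => by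
    rw [inn, ← ig, ← ig]
    refine integral_congr_ae ?_
    filter_upwards [hb.coeFn_toLp] with x hx
    rw [hx]
  have mW : Measurable (W : EC → EC) := (Lp.stronglyMeasurable W).measurable
  refine ⟨W, (gm _ mW).2 (Lp.memLp W), fun t ht => ?_, fun a ha hat => ?_⟩
  · rw [← inn t ((gm t (hT t ht).1).1 (hT t ht))]
    exact (Submodule.starProjection_apply_mem Sᗮ V) _ (Submodule.subset_span ⟨t, ht, rfl⟩)
  · have ha' := (gm a ha.1).1 ha
    rw [← inn a ha', ← inn2 a ha' v ((gm v hv.1).1 hv)]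
    have hmem : ha'.toLp a ∈ Sᗮ := by
      rw [Submodule.mem_orthogonal]
      intro u hu
      induction hu using Submodule.span_induction with
      | mem x h => obtain ⟨t, ht, rfl⟩ := h; rw [inn2]; exact hat t ht
      | zero => simp
      | add x y _ _ h1 h2 => rw [inner_add_left, h1, h2, add_zero]
      | smul c x _ h => rw [inner_smul_left, h, mul_zero]
    have := Submodule.starProjection_inner_eq_zero (K := Sᗮ) V _ hmem
    rw [inner_sub_left, sub_eq_zero] at this
    rw [← inner_conj_symm, ← this, inner_conj_symm]

lemma hilb_rep {H V : Type*} [NormedAddCommGroup H] [InnerProductSpace ℂ H] [CompleteSpace H]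
    [AddCommGroup V] [Module ℂ V] (A : V →ₗ[ℂ] H) (l : V →ₗ[ℂ] ℂ) {C : ℝ} (hC : 0 ≤ C)
    (h : ∀ v, ‖l v‖ ≤ C * ‖A v‖) : ∃ u : H, ‖u‖ ≤ C ∧ ∀ v, l v = inner ℂ u (A v) := by
  have hk : LinearMap.ker A ≤ LinearMap.ker l := fun v hv => by
    have := h v; rw [LinearMap.mem_ker.1 hv] at this; simpa using this
  let l0 : LinearMap.range A →ₗ[ℂ] ℂ :=
    ((LinearMap.ker A).liftQ l hk).comp A.quotKerEquivRange.symm.toLinearMap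
  have e0 : ∀ v, l0 ⟨A v, LinearMap.mem_range_self A v⟩ = l v := fun v => by
    have : A.quotKerEquivRange.symm ⟨A v, LinearMap.mem_range_self A v⟩ =
        (LinearMap.ker A).mkQ v := by
      rw [LinearEquiv.symm_apply_eq]; rfl
    simp only [l0, LinearMap.comp_apply, LinearEquiv.coe_coe, this]
    simp
  let l1 : LinearMap.range A →L[ℂ] ℂ := l0.mkContinuous C (by
    rintro ⟨_, v, rfl⟩
    rw [e0]; exact h v)
  obtain ⟨g, hg, hgn⟩ := exists_extension_norm_eq (LinearMap.range A) l1
  refine ⟨(InnerProductSpace.toDual ℂ H).symm g, ?_, fun v => ?_⟩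
  · rw [LinearIsometryEquiv.norm_map, hgn]; exact LinearMap.mkContinuous_norm_le _ hC _
  · rw [InnerProductSpace.toDual_symm_apply, ← e0 v]
    exact (hg ⟨A v, LinearMap.mem_range_self A v⟩).symm

def mx (k : ℕ) (x : ℝ) : ℝ := (max 0 x) ^ k

lemma mx_hd (k : ℕ) (x : ℝ) : HasDerivAt (mx (k + 2)) ((k + 2) * mx (k + 1) x) x := by
  rcases lt_trichotomy x 0 with h | h | h
  · have : mx (k + 2) =ᶠ[𝓝 x] fun _ => 0 := by
      filter_upwards [gt_mem_nhds h] with y hy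
      simp [mx, max_eq_left hy.le]
    rw [show mx (k + 1) x = 0 by simp [mx, max_eq_left h.le], mul_zero]
    exact (hasDerivAt_const x 0).congr_of_eventuallyEq this
  · subst h
    rw [show mx (k + 1) 0 = 0 by simp [mx], mul_zero, hasDerivAt_iff_isLittleO]
    simp only [sub_zero, smul_zero, mx, max_self, ne_eq, Nat.add_eq_zero_iff, OfNat.ofNat_ne_zero,
      and_false, not_false_eq_true, zero_pow]
    have h1 : (fun x : ℝ => (max 0 x) ^ (k + 2)) =O[𝓝 0] fun x => x ^ (k + 2) := by
      refine Asymptotics.isBigO_of_le _ fun x => ?_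
      rw [norm_pow, norm_pow]; gcongr
      rw [Real.norm_of_nonneg (le_max_left _ _)]; exact max_le (norm_nonneg _) (le_abs_self x)
    refine h1.trans_isLittleO ?_
    exact Asymptotics.isLittleO_pow_id (by omega)
  · have : mx (k + 2) =ᶠ[𝓝 x] fun y => y ^ (k + 2) := by
      filter_upwards [lt_mem_nhds h] with y hy
      simp [mx, max_eq_right hy.le]
    rw [show mx (k + 1) x = x ^ (k + 1) by simp [mx, max_eq_right h.le]]
    have h1 := (hasDerivAt_pow (k + 2) x).congr_of_eventuallyEq this
    exact h1.congr_deriv (by push_cast; rfl)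

lemma mx_cd : ContDiff ℝ 2 (mx 3) := by
  have d3 : deriv (mx 3) = fun x => 3 * mx 2 x := funext fun x => by
    rw [(mx_hd 1 x).deriv]; push_cast; norm_num
  have d2 : deriv (mx 2) = fun x => 2 * mx 1 x := funext fun x => by
    rw [(mx_hd 0 x).deriv]; push_cast; norm_num
  have c2 : ContDiff ℝ 1 (mx 2) := by
    rw [contDiff_one_iff_deriv, d2]
    refine ⟨fun x => (mx_hd 0 x).differentiableAt, ?_⟩
    unfold mx; fun_prop
  rw [show (2 : WithTop ℕ∞) = 1 + 1 by norm_num, contDiff_succ_iff_deriv, d3]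
  exact ⟨fun x => (mx_hd 1 x).differentiableAt, by simp, contDiff_const.mul c2⟩

lemma mx_nonneg (k : ℕ) (x : ℝ) : 0 ≤ mx k x := pow_nonneg (le_max_left _ _) _

def hh (t : ℝ) : ℝ := mx 3 (1 - mx 3 (1 - t))
lemma hh_cd : ContDiff ℝ 2 hh :=
  mx_cd.comp (contDiff_const.sub (mx_cd.comp (contDiff_const.sub contDiff_id)))
lemma hh_zero {t : ℝ} (h : t ≤ 0) : hh t = 0 := by
  have : 1 ≤ mx 3 (1 - t) := by
    unfold mx; rw [max_eq_right (by linarith)]; exact one_le_pow₀ (by linarith)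
  rw [hh, mx, max_eq_left (by linarith)]; norm_num
lemma hh_one {t : ℝ} (h : 1 ≤ t) : hh t = 1 := by
  simp [hh, mx, max_eq_left (show 1 - t ≤ 0 by linarith)]
lemma hh_le (t : ℝ) : hh t ≤ 1 := by
  have := mx_nonneg 3 (1 - t)
  exact pow_le_one₀ (le_max_left _ _) (max_le zero_le_one (by linarith))
lemma hh_nonneg (t : ℝ) : 0 ≤ hh t := mx_nonneg _ _
lemma hh_ge {t : ℝ} (h0 : 0 ≤ t) (h1 : t ≤ 1) : t ^ 3 ≤ hh t := by
  rw [hh]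
  have : t ≤ 1 - mx 3 (1 - t) := by
    unfold mx; rw [max_eq_right (by linarith)]; nlinarith [mul_nonneg h0 (sub_nonneg.2 h1)]
  exact pow_le_pow_left₀ h0 (this.trans (le_max_right _ _)) 3
lemma hh_deriv (t : ℝ) : |deriv hh t| ≤ 9 := by
  have h1 : HasDerivAt (fun t : ℝ => 1 - mx 3 (1 - t)) (3 * mx 2 (1 - t)) t := by
    have := ((mx_hd 1 (1 - t)).comp t ((hasDerivAt_id t).const_sub 1)).const_sub 1
    exact this.congr_deriv (by push_cast; norm_num)
  have h2 := (mx_hd 1 (1 - mx 3 (1 - t))).comp t h1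
  rw [show deriv hh t = _ from h2.deriv]
  norm_num
  have a0 := mx_nonneg 2 (1 - mx 3 (1 - t))
  have b0 := mx_nonneg 2 (1 - t)
  rw [abs_of_nonneg a0, abs_of_nonneg b0]
  have a1 : mx 2 (1 - mx 3 (1 - t)) ≤ 1 := by
    have := mx_nonneg 3 (1 - t)
    exact pow_le_one₀ (le_max_left _ _) (max_le zero_le_one (by linarith))
  by_cases ht : 0 ≤ t
  · have b1 : mx 2 (1 - t) ≤ 1 :=
      pow_le_one₀ (le_max_left _ _) (max_le zero_le_one (by linarith))
    nlinarith
  · have : 1 ≤ mx 3 (1 - t) := by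
      unfold mx; rw [max_eq_right (by linarith)]; exact one_le_pow₀ (by linarith)
    have : mx 2 (1 - mx 3 (1 - t)) = 0 := by
      rw [mx, max_eq_left (by linarith)]; norm_num
    rw [this]; norm_num

def ch (K : ℝ) (t : ℝ) : ℝ := K * mx 3 (t + 3) * ((-t)⁻¹) ^ 6
lemma ch_zero {K t : ℝ} (h : t ≤ -3) : ch K t = 0 := by
  simp [ch, mx, max_eq_left (show t + 3 ≤ 0 by linarith)]
lemma ch_cd {K t : ℝ} (h : t < 0) : ContDiffAt ℝ 2 (ch K) t := by
  refine ((contDiff_const.mul (mx_cd.comp (contDiff_id.add contDiff_const))).contDiffAt).mul ?_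
  exact ((contDiff_id.neg.contDiffAt).inv (by simpa using h.ne)).pow 6
lemma mxs_hd (k : ℕ) (t : ℝ) :
    HasDerivAt (fun t => mx (k + 2) (t + 3)) ((k + 2) * mx (k + 1) (t + 3)) t := by
  have := (mx_hd k (t + 3)).comp t ((hasDerivAt_id t).add_const 3)
  rwa [mul_one] at this
lemma s_hd {t : ℝ} (h : t < 0) (k : ℕ) :
    HasDerivAt (fun t : ℝ => ((-t)⁻¹) ^ (k + 1)) ((k + 1) * ((-t)⁻¹) ^ (k + 2)) t := by
  have := ((hasDerivAt_neg t).inv (by simpa using h.ne)).pow (k + 1)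
  refine this.congr_deriv ?_
  push_cast
  rw [neg_neg, one_div, ← inv_pow]
  simp only [Pi.inv_apply]; ring
lemma ch_d1 {K t : ℝ} (h : t < 0) : HasDerivAt (ch K)
    (K * (3 * mx 2 (t + 3) * ((-t)⁻¹) ^ 6 + 6 * (mx 3 (t + 3) * ((-t)⁻¹) ^ 7))) t := by
  have := ((mxs_hd 1 t).const_mul K).mul (s_hd h 5)
  exact this.congr_deriv (by push_cast; ring)
lemma ch_deriv {K t : ℝ} (hK : 0 ≤ K) (h : t < 0) :
    K * (mx 2 (t + 3) * ((-t)⁻¹) ^ 6) ≤ deriv (ch K) t ∧ 0 ≤ deriv (deriv (ch K)) t := by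
  have s0 : 0 < (-t)⁻¹ := inv_pos.2 (by linarith)
  have y2 := mx_nonneg 2 (t + 3)
  have y3 := mx_nonneg 3 (t + 3)
  have y1 := mx_nonneg 1 (t + 3)
  constructor
  · rw [(ch_d1 h).deriv]
    have : 0 ≤ mx 3 (t + 3) * (-t)⁻¹ ^ 7 := by positivity
    have : 0 ≤ mx 2 (t + 3) * (-t)⁻¹ ^ 6 := by positivity
    exact mul_le_mul_of_nonneg_left (by linarith) hK
  · have e : deriv (ch K) =ᶠ[𝓝 t] fun t =>
        K * (3 * mx 2 (t + 3) * ((-t)⁻¹) ^ 6 + 6 * (mx 3 (t + 3) * ((-t)⁻¹) ^ 7)) := by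
      filter_upwards [gt_mem_nhds h] with y hy using (ch_d1 hy).deriv
    have d2 := ((((mxs_hd 0 t).const_mul 3).mul (s_hd h 5)).add
      (((mxs_hd 1 t).mul (s_hd h 6)).const_mul 6)).const_mul K
    have d3 : deriv (fun t => K * (3 * mx 2 (t + 3) * ((-t)⁻¹) ^ 6 +
      6 * (mx 3 (t + 3) * ((-t)⁻¹) ^ 7))) t = _ := d2.deriv
    rw [e.deriv_eq, d3]
    simp only [zero_add, one_add_one_eq_two, Nat.reduceAdd]
    positivity

lemma db_zero {K : SC} (hK : IsClosed K) {f : FC} (h : ∀ x, x ∉ K → f x = 0)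
    {x : EC} (hx : x ∉ K) (X : EC) : fderiv ℝ f x X = 0 ∧ db X f x = 0 ∧ dz X f x = 0 := by
  have : f =ᶠ[𝓝 x] fun _ => 0 := by
    filter_upwards [hK.isOpen_compl.mem_nhds hx] with y hy using h y hy
  have e := this.fderiv_eq (𝕜 := ℝ)
  simp [db, dz, e]

lemma hcs_of {F : Type*} [Zero F] {K : SC} (hK : IsCompact K) {f : EC → F}
    (h : ∀ x, x ∉ K → f x = 0) : HasCompactSupport f := HasCompactSupport.intro hK h

lemma cut_basic {φ κ η : FR} {q : Fin n → FC} {Δ : FC} {K U : SC}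
    (hK : IsCompact K) (hU : IsOpen U) (hKU : K ⊆ U) (h : ContDiff ℝ 2 φ) (hη : ContDiff ℝ 2 η)
    (hηz : ∀ x, x ∉ K → η x = 0) (hq : ∀ j, MemLp (q j) 2) (hqz : ∀ j, ∀ x, x ∉ K → q j x = 0)
    (hΔ : Continuous Δ) (hΔz : ∀ x, x ∉ K → Δ x = 0)
    (eD : ∀ G : FC, ContDiff ℝ 2 G → (∀ x, x ∉ K → G x = 0) →
      ∑ j, ∫ x, q j x * (dz (ee j) G x * wt φ x) = - ∫ x, Δ x * (G x * wt φ x))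
    (eZ : ∀ j k, ∀ G : FC, ContDiff ℝ 2 G → (∀ x, x ∉ K → G x = 0) →
      (∫ x, q j x * db (ee k) G x) - ∫ x, q k x * db (ee j) G x = 0)
    (hκ : Continuous κ) (hl : ∀ x ∈ U, ∀ X, κ x * ‖X‖ ^ 2 ≤ leviForm φ x X) :
    ∑ j, ∫ x, ‖cx η x * q j x‖ ^ 2 * (κ x * Real.exp (-φ x)) ≤
      (∫ x, ‖cx η x * Δ x + ∑ j, dz (ee j) (cx η) x * q j x‖ ^ 2 * Real.exp (-φ x)) +
      ∑ j, ∑ k, ∫ x, ‖db (ee k) (cx η) x * q j x - db (ee j) (cx η) x * q k x‖ ^ 2 *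
        ((1/2) * Real.exp (-φ x)) := by
  have cη := cd_cx hη
  have cφ := cd_cx h
  have c1 := fun j => cont_dz (cη.of_le one_le_two) (ee j)
  have c2 := fun j => cont_db (cη.of_le one_le_two) (ee j)
  have c3 := fun j => cont_dz (cφ.of_le one_le_two) (ee j)
  have mm : ∀ {a f : FC}, Continuous a → MemLp f 2 → (∀ x, x ∉ K → f x = 0) →
    MemLp (fun x => a x * f x) 2 := fun ha hf hz => by
      obtain ⟨M, _, hM⟩ := mem_mulc hK ha; exact (hM _ hf hz).1
  have mΔ : MemLp Δ 2 := hΔ.memLp_of_hasCompactSupport (hcs_of hK hΔz)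
  have il : ∀ {a f : FC}, Continuous a → HasCompactSupport a → MemLp f 2 →
    Integrable fun x => f x * a x := fun ha hc hf => li_mul (locint_of_memLp hf) ha hc
  have ew : ∀ x, wt (fun x => -φ x) x * wt φ x = 1 := fun x => by
    simp only [wt, cx, ← Complex.ofReal_mul, ← Real.exp_add]; simp
  have dwm : ∀ j x, dz (ee j) (wt fun x => -φ x) x = dz (ee j) (cx φ) x * wt (fun x => -φ x) x := by
    intro j x
    rw [dz_wt (h.neg.differentiable two_ne_zero x)]
    congr 1
    have : cx (fun x => -φ x) = fun x => - cx φ x := by ext; simp [cx]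
    rw [this, dz, dz, fderiv_fun_neg]; simp only [neg_apply]; ring
  have key := weak_basic (φ := φ) (κ := κ) (w := fun j x => cx η x * q j x)
    (A := fun x => (cx η x * Δ x + ∑ j, dz (ee j) (cx η) x * q j x) +
      ∑ j, dz (ee j) (cx φ) x * (cx η x * q j x))
    (B := fun j k x => db (ee k) (cx η) x * q j x - db (ee j) (cx η) x * q k x)
    hK hU hKU h (fun j => mm cη.continuous (hq j) (hqz j))
    (fun j x hx => by simp [hqz j x hx])
    (((mm cη.continuous mΔ hΔz).add (memLp_finsetSum _ fun j _ => mm (c1 j) (hq j) (hqz j))).add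
      (memLp_finsetSum _ fun j _ => mm (c3 j) (mm cη.continuous (hq j) (hqz j))
        (fun x hx => by simp [hqz j x hx])))
    (fun x hx => by simp [hqz _ x hx, hΔz x hx])
    (fun j k => (mm (c2 k) (hq j) (hqz j)).sub (mm (c2 j) (hq k) (hqz k)))
    (fun j k x hx => by simp [hqz _ x hx]) ?_ ?_ hκ hl
  · simpa only [add_sub_cancel_right] using key
  · intro g hg hgc
    have hG := eD (fun x => (cx η x * g x) * wt (fun x => -φ x) x)
      ((cη.mul hg).mul (cd_wt h.neg)) (fun x hx => by simp [cx, hηz x hx])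
    have e1 : ∀ j x, dz (ee j) (fun x => (cx η x * g x) * wt (fun x => -φ x) x) x * wt φ x =
        cx η x * dz (ee j) g x + (dz (ee j) (cx η) x + dz (ee j) (cx φ) x * cx η x) * g x := by
      intro j x
      rw [dz_mul ((cη.mul hg).differentiable two_ne_zero x)
        ((cd_wt h.neg).differentiable two_ne_zero x), dz_mul (cη.differentiable two_ne_zero x)
        (hg.differentiable two_ne_zero x), dwm]
      linear_combination (cx η x * g x * dz (ee j) (cx φ) x +
        cx η x * dz (ee j) g x + dz (ee j) (cx η) x * g x) * ew x
    have e2 : ∀ x, Δ x * ((cx η x * g x) * wt (fun x => -φ x) x * wt φ x) = Δ x * (cx η x * g x) :=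
      fun x => by linear_combination (Δ x * cx η x * g x) * ew x
    simp only [e1, e2] at hG
    have i1 : ∀ j, Integrable fun x => q j x * (cx η x * dz (ee j) g x) := fun j =>
      il (cη.continuous.mul (cont_dz (hg.of_le one_le_two) _)) (hcs_dz hgc _).mul_left (hq j)
    have i2 : ∀ j, Integrable fun x => q j x *
      ((dz (ee j) (cx η) x + dz (ee j) (cx φ) x * cx η x) * g x) := fun j =>
      il (((c1 j).add ((c3 j).mul cη.continuous)).mul hg.continuous) hgc.mul_left (hq j)
    have i3 : Integrable fun x => Δ x * (cx η x * g x) :=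
      il (cη.continuous.mul hg.continuous) hgc.mul_left mΔ
    simp only [mul_add (q _ _)] at hG
    rw [Finset.sum_congr rfl fun j _ => integral_add (i1 j) (i2 j), Finset.sum_add_distrib] at hG
    have e3 : ∫ x, ((cx η x * Δ x + ∑ j, dz (ee j) (cx η) x * q j x) +
      ∑ j, dz (ee j) (cx φ) x * (cx η x * q j x)) * g x = (∫ x, Δ x * (cx η x * g x)) +
      ∑ j, ∫ x, q j x * ((dz (ee j) (cx η) x + dz (ee j) (cx φ) x * cx η x) * g x) := by
      rw [← integral_finsetSum _ (fun j _ => i2 j), ← integral_add i3 (integrable_finsetSum _ fun j _ => i2 j)]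
      congr 1; ext x
      rw [add_mul, add_mul, Finset.sum_mul, Finset.sum_mul, add_assoc, ← Finset.sum_add_distrib]
      congr 1
      · ring
      · exact Finset.sum_congr rfl fun j _ => by ring
    rw [e3, neg_add, ← hG, add_neg_cancel_right]
    exact Finset.sum_congr rfl fun j _ => integral_congr_ae (.of_forall fun x => by simp only; ring)
  · intro j k g hg hgc
    have hG := eZ j k (fun x => cx η x * g x) (cη.mul hg) (fun x hx => by simp [cx, hηz x hx])
    have e1 : ∀ j x, db (ee j) (fun x => cx η x * g x) x =
      cx η x * db (ee j) g x + db (ee j) (cx η) x * g x := fun j x =>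
      db_mul (cη.differentiable two_ne_zero x) (hg.differentiable two_ne_zero x)
    simp only [e1, mul_add] at hG
    have i1 : ∀ j k, Integrable fun x => q j x * (cx η x * db (ee k) g x) := fun j k =>
      il (cη.continuous.mul (cont_db (hg.of_le one_le_two) _)) (hcs_db hgc _).mul_left (hq j)
    have i2 : ∀ j k, Integrable fun x => q j x * (db (ee k) (cx η) x * g x) := fun j k =>
      il ((c2 k).mul hg.continuous) hgc.mul_left (hq j)
    rw [integral_add (i1 j k) (i2 j k), integral_add (i1 k j) (i2 k j)] at hG
    have e3 : ∫ x, (db (ee k) (cx η) x * q j x - db (ee j) (cx η) x * q k x) * g x =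
      (∫ x, q j x * (db (ee k) (cx η) x * g x)) - ∫ x, q k x * (db (ee j) (cx η) x * g x) := by
      rw [← integral_sub (i2 j k) (i2 k j)]; congr 1; ext x; ring
    have e4 : ∀ j k, ∫ x, cx η x * q j x * db (ee k) g x = ∫ x, q j x * (cx η x * db (ee k) g x) :=
      fun j k => integral_congr_ae (.of_forall fun x => by simp only; ring)
    rw [e3, e4, e4]
    linear_combination hG

lemma pw1 (a v : Fin n → ℂ) : ‖∑ j, a j * v j‖ ^ 2 ≤ (∑ j, ‖a j‖ ^ 2) * ∑ j, ‖v j‖ ^ 2 := by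
  calc _ ≤ (∑ j, ‖a j‖ * ‖v j‖) ^ 2 := by
        gcongr; exact (norm_sum_le _ _).trans_eq (by simp)
    _ ≤ _ := Finset.sum_mul_sq_le_sq_mul_sq _ _ _

lemma pw2 (b v : Fin n → ℂ) : ∑ j, ∑ k, ‖b k * v j - b j * v k‖ ^ 2 * (1/2) ≤
    2 * ((∑ j, ‖b j‖ ^ 2) * ∑ j, ‖v j‖ ^ 2) := by
  calc _ ≤ ∑ j, ∑ k, (‖b k‖ ^ 2 * ‖v j‖ ^ 2 + ‖b j‖ ^ 2 * ‖v k‖ ^ 2) := by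
        gcongr with j _ k _
        have := norm_sub_le (b k * v j) (b j * v k)
        rw [norm_mul, norm_mul] at this
        nlinarith [norm_nonneg (b k * v j - b j * v k), sq_nonneg (‖b k‖ * ‖v j‖ - ‖b j‖ * ‖v k‖)]
    _ = _ := by
        simp only [Finset.sum_add_distrib, ← Finset.sum_mul, ← Finset.mul_sum]; ring

lemma hh_deriv0 {t : ℝ} (h : 1 ≤ t) : deriv hh t = 0 := by
  have h1 : HasDerivAt (fun t : ℝ => 1 - mx 3 (1 - t)) 0 t := by
    have := ((mx_hd 1 (1 - t)).comp t ((hasDerivAt_id t).const_sub 1)).const_sub 1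
    exact this.congr_deriv (by simp [mx, max_eq_left (show 1 - t ≤ 0 by linarith)])
  have h2 := (mx_hd 1 (1 - mx 3 (1 - t))).comp t h1
  rw [show deriv hh t = _ from h2.deriv, mul_zero]

def EE (r ψ : FR) (K0 : ℝ) : FR :=
  indicator {x | r x < 0} fun x => Real.exp (-(ψ x + ch K0 (r x)))

structure Setup (r ψ κ0 : FR) (Cr M0 K0 : ℝ) : Prop where
  hr : ContDiff ℝ 2 r
  hc : IsCompact {x | r x ≤ 0}
  hlr : ∀ x, r x ≤ 0 → ∀ X, ‖X‖ ^ 2 ≤ leviForm r x X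
  hψ : ContDiff ℝ 2 ψ
  hκ : Continuous κ0
  hκ0 : ∀ x, 0 ≤ κ0 x
  hκ1 : ∀ x, κ0 x ≤ M0
  hlψ : ∀ x, r x < 0 → ∀ X, κ0 x * ‖X‖ ^ 2 ≤ leviForm ψ x X
  hCr : ∀ x, r x ≤ 0 → ∑ j, ‖dz (ee j) (cx r) x‖ ^ 2 ≤ Cr
  hCr0 : 0 ≤ Cr
  hM0 : 0 ≤ M0
  hK0 : 64 * (243 * Cr + M0) ≤ K0

lemma Setup.K0n {r ψ κ0 : FR} {Cr M0 K0 : ℝ} (S : Setup r ψ κ0 Cr M0 K0) : 0 ≤ K0 := by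
  have := S.hK0; have := S.hCr0; have := S.hM0; linarith
lemma Setup.cdφ {r ψ κ0 : FR} {Cr M0 K0 : ℝ} (S : Setup r ψ κ0 Cr M0 K0) :
    ContDiffOn ℝ 2 (fun x => ψ x + ch K0 (r x)) {x | r x < 0} := fun x hx =>
  (S.hψ.contDiffAt.add (ContDiffAt.comp x (ch_cd hx) S.hr.contDiffAt)).contDiffWithinAt
lemma Setup.op {r ψ κ0 : FR} {Cr M0 K0 : ℝ} (S : Setup r ψ κ0 Cr M0 K0) :
    IsOpen {x | r x < 0} := isOpen_lt S.hr.continuous continuous_const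
lemma Setup.Emeas {r ψ κ0 : FR} {Cr M0 K0 : ℝ} (S : Setup r ψ κ0 Cr M0 K0) :
    Measurable (EE r ψ K0) := by
  refine Measurable.indicator ?_ S.op.measurableSet
  have h1 := S.hr.continuous.measurable
  have h2 := S.hψ.continuous.measurable
  unfold ch mx
  fun_prop
lemma EE_nonneg (r ψ : FR) (K0 : ℝ) (x : EC) : 0 ≤ EE r ψ K0 x :=
  indicator_nonneg (fun x _ => (Real.exp_pos _).le) x
lemma Setup.levi {r ψ κ0 : FR} {Cr M0 K0 : ℝ} (S : Setup r ψ κ0 Cr M0 K0) {x : EC}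
    (hx : r x < 0) (X : EC) : (κ0 x + K0 * (mx 2 (r x + 3) * ((-r x)⁻¹) ^ 6)) * ‖X‖ ^ 2 ≤
      leviForm (fun x => ψ x + ch K0 (r x)) x X := by
  have hch : ContDiffAt ℝ 2 (fun x => ch K0 (r x)) x := ContDiffAt.comp x (ch_cd hx) S.hr.contDiffAt
  rw [levi_add S.hψ.contDiffAt hch, levi_comp S.hr.contDiffAt (ch_cd hx), add_mul]
  obtain ⟨h1, h2⟩ := ch_deriv S.K0n hx
  have h3 := S.hlr x hx.le X
  have h4 := S.hlψ x hx X
  have s0 : 0 < (-r x)⁻¹ := inv_pos.2 (by linarith)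
  have h5 : 0 ≤ K0 * (mx 2 (r x + 3) * ((-r x)⁻¹) ^ 6) :=
    mul_nonneg S.K0n (mul_nonneg (mx_nonneg _ _) bp)
  have h6 : K0 * (mx 2 (r x + 3) * ((-r x)⁻¹) ^ 6) * ‖X‖ ^ 2 ≤ deriv (ch K0) (r x) * leviForm r x X :=
    mul_le_mul h1 h3 bp (h5.trans h1)
  have h7 : 0 ≤ deriv (deriv (ch K0)) (r x) * ((fderiv ℝ r x X) ^ 2 + (fderiv ℝ r x (I • X)) ^ 2) / 4 := by
    positivity
  linarith

lemma memLp_ind {E : FR} {v : EC → EC} (hv : Good E v) {K : SC}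
    (hK : MeasurableSet K) {c : ℝ} (hc : 0 < c) (hE : ∀ x ∈ K, c ≤ E x) (hE0 : ∀ x, 0 ≤ E x) (j : Fin n) :
    MemLp (K.indicator fun x => v x j) 2 := by
  have m1 : Measurable fun x => v x j := by
    have : Measurable fun y : EC => y j := (EuclideanSpace.proj (𝕜 := ℂ) j).continuous.measurable
    exact this.comp hv.1
  have m2 := (m1.indicator hK).aestronglyMeasurable (μ := volume)
  rw [memLp_two_iff_integrable_sq_norm m2]
  refine (hv.2.const_mul c⁻¹).mono' (m2.norm.pow 2) (.of_forall fun x => ?_)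
  rw [Real.norm_of_nonneg bp]
  have h0 : 0 ≤ E x * ‖v x‖ ^ 2 := mul_nonneg (hE0 x) bp
  by_cases hx : x ∈ K
  · rw [indicator_of_mem hx, ← div_eq_inv_mul, le_div_iff₀ hc]
    have : ‖v x j‖ ^ 2 ≤ ‖v x‖ ^ 2 := by gcongr; exact PiLp.norm_apply_le (v x) j
    nlinarith [hE x hx, sq_nonneg ‖v x j‖, sq_nonneg ‖v x‖]
  · rw [indicator_of_notMem hx, norm_zero, zero_pow two_ne_zero]; exact mul_nonneg (inv_pos.2 hc).le h0

def kap (r κ0 : FR) (K0 ε : ℝ) (x : EC) : ℝ :=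
  κ0 x + K0 * (mx 2 (r x + 3) * ((max (-r x) ε)⁻¹) ^ 6)

lemma absorb1 {r ψ κ0 : FR} {Cr M0 K0 : ℝ} (S : Setup r ψ κ0 Cr M0 K0) {v : EC → EC}
    (hv : Good (EE r ψ K0) v) {Δ : FC} (hΔ : Continuous Δ) (hΔz : ∀ x, Δ x ≠ 0 → r x < -3)
    (eD : ∀ G : FC, ContDiff ℝ 2 G → HasCompactSupport G → tsupport G ⊆ {x | r x < 0} →
      ∑ j, ∫ x, v x j * (dz (ee j) G x * EE r ψ K0 x) = - ∫ x, Δ x * (G x * EE r ψ K0 x))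
    (eZ : ∀ j k, ∀ G : FC, ContDiff ℝ 2 G → HasCompactSupport G → tsupport G ⊆ {x | r x < 0} →
      (∫ x, v x j * db (ee k) G x) - ∫ x, v x k * db (ee j) G x = 0) {ε : ℝ} (h0 : 0 < ε) (h1 : ε ≤ 1) :
    ∫ x, hh (-r x - ε) ^ 2 * kap r κ0 K0 ε x * (EE r ψ K0 x * ‖v x‖ ^ 2) ≤
      (∫ x, ‖Δ x‖ ^ 2 * Real.exp (-ψ x)) + 243 * Cr *
        ∫ x, indicator {x | -2 < r x} (fun x => EE r ψ K0 x * ‖v x‖ ^ 2) x := by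
  have rc := S.hr.continuous
  set K : SC := {x | r x ≤ -ε} with hK
  have Kc : IsClosed K := isClosed_le rc continuous_const
  have Kk : IsCompact K := S.hc.of_isClosed_subset Kc fun x (hx : r x ≤ -ε) => show r x ≤ 0 by linarith
  have KD : K ⊆ {x | r x < 0} := fun x (hx : r x ≤ -ε) => show r x < 0 by linarith
  obtain ⟨φ, U, cφ, oU, KU, UD, eφ⟩ := glob Kk S.op KD S.cdφ
  have Eφ : ∀ x ∈ K, EE r ψ K0 x = Real.exp (-φ x) := fun x hx => by
    rw [EE, indicator_of_mem (KD hx), eφ x (KU hx)]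
  have Eφ' : ∀ x ∈ K, (EE r ψ K0 x : ℂ) = wt φ x := fun x hx => by rw [Eφ x hx]; rfl
  set η : FR := fun x => hh (-r x - ε) with hη
  have cη : ContDiff ℝ 2 η := hh_cd.comp (S.hr.neg.sub contDiff_const)
  have ηz : ∀ x, x ∉ K → η x = 0 := fun x hx =>
    hh_zero (by have : -ε < r x := not_le.1 hx
                linarith)
  obtain ⟨c, c0, hcE⟩ := Kk.exists_forall_le' (f := fun x => Real.exp (-φ x)) (a := 0)
    cφ.continuous.neg.rexp.continuousOn (fun x _ => Real.exp_pos _)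
  set q : Fin n → FC := fun j => K.indicator fun x => v x j with hq
  have mq : ∀ j, MemLp (q j) 2 := fun j => memLp_ind hv Kc.measurableSet c0
    (fun x hx => by rw [Eφ x hx]; exact hcE x hx) (EE_nonneg _ _ _) j
  have qz : ∀ j, ∀ x, x ∉ K → q j x = 0 := fun j x hx => indicator_of_notMem hx _
  have qv : ∀ j, ∀ x ∈ K, q j x = v x j := fun j x hx => indicator_of_mem hx _
  have Δz : ∀ x, x ∉ K → Δ x = 0 := fun x hx => by
    by_contra h; exact hx (show r x ≤ -ε by have := hΔz x h; linarith)
  have ts : ∀ G : FC, (∀ x, x ∉ K → G x = 0) → tsupport G ⊆ {x | r x < 0} := fun G hG =>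
    (closure_minimal (fun x hx => by by_contra h; exact hx (hG x h)) Kc).trans KD
  have key := cut_basic (κ := kap r κ0 K0 ε) Kk oU KU cφ cη ηz mq qz hΔ Δz ?_ ?_ ?_ ?_
  rotate_left
  · intro G cG zG
    have := eD G cG (hcs_of Kk zG) (ts G zG)
    convert this using 1
    · refine Finset.sum_congr rfl fun j _ => integral_congr_ae (.of_forall fun x => ?_)
      by_cases hx : x ∈ K
      · simp only [qv j x hx, Eφ' x hx]
      · simp [(db_zero Kc zG hx (ee j)).2.2]
    · congr 1; refine integral_congr_ae (.of_forall fun x => ?_)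
      by_cases hx : x ∈ K
      · simp only [Eφ' x hx]
      · simp [zG x hx]
  · intro j k G cG zG
    have := eZ j k G cG (hcs_of Kk zG) (ts G zG)
    have e : ∀ j k, ∫ x, q j x * db (ee k) G x = ∫ x, v x j * db (ee k) G x := fun j k =>
      integral_congr_ae (.of_forall fun x => by
        by_cases hx : x ∈ K
        · simp only [qv j x hx]
        · simp [(db_zero Kc zG hx (ee k)).2.1])
    rw [e, e, this]
  · have := S.hκ
    unfold kap mx
    refine this.add (continuous_const.mul (Continuous.mul (by fun_prop) (Continuous.pow ?_ 6)))
    exact Continuous.inv₀ (by fun_prop) fun x => (lt_max_of_lt_right h0).ne'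
  · intro x hx X
    have hx0 : r x < 0 := UD hx
    rw [levi_congr (show φ =ᶠ[𝓝 x] fun x => ψ x + ch K0 (r x) from by
      filter_upwards [oU.mem_nhds hx] with y hy using eφ y hy)]
    refine le_trans ?_ (S.levi hx0 X)
    unfold kap
    have := mx_nonneg 2 (r x + 3)
    have := S.K0n
    have : 0 < -r x := by linarith
    gcongr
    exact le_max_left _ _
  have vsq : ∀ x, ‖v x‖ ^ 2 = ∑ j, ‖v x j‖ ^ 2 := fun x => EuclideanSpace.norm_sq_eq _
  have dη : ∀ j x, dz (ee j) (cx η) x = -((deriv hh (-r x - ε) : ℝ) : ℂ) * dz (ee j) (cx r) x := by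
    intro j x
    have hf : HasFDerivAt η (deriv hh (-r x - ε) • -(fderiv ℝ r x)) x := by
      have h1 : HasFDerivAt (fun x => -r x - ε) (-(fderiv ℝ r x)) x :=
        (S.hr.differentiable two_ne_zero x).hasFDerivAt.neg.sub_const ε
      exact (hh_cd.differentiable two_ne_zero _).hasDerivAt.comp_hasFDerivAt x h1
    rw [dz, dz, fd_cx hf.differentiableAt, fd_cx hf.differentiableAt, hf.fderiv,
      fd_cx (S.hr.differentiable two_ne_zero x), fd_cx (S.hr.differentiable two_ne_zero x)]
    simp only [smul_apply, neg_apply, smul_eq_mul]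
    push_cast; ring
  have dbη : ∀ j x, ‖db (ee j) (cx η) x‖ = ‖dz (ee j) (cx η) x‖ := fun j x => by
    rw [db_cx (cη.differentiable two_ne_zero x), Complex.norm_conj]
  have Sη : ∀ x ∈ K, ∑ j, ‖dz (ee j) (cx η) x‖ ^ 2 ≤ indicator {x | -2 < r x} (fun _ => 81 * Cr) x := by
    intro x hx
    have hx' : r x ≤ -ε := hx
    have : ∑ j, ‖dz (ee j) (cx η) x‖ ^ 2 = deriv hh (-r x - ε) ^ 2 * ∑ j, ‖dz (ee j) (cx r) x‖ ^ 2 := by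
      rw [Finset.mul_sum]
      refine Finset.sum_congr rfl fun j _ => ?_
      rw [dη, norm_mul, norm_neg, Complex.norm_real, mul_pow, Real.norm_eq_abs, sq_abs]
    rw [this]
    by_cases h2 : -2 < r x
    · rw [indicator_of_mem (show x ∈ {x | -2 < r x} from h2)]
      have a1 : deriv hh (-r x - ε) ^ 2 ≤ 81 := by
        rw [← sq_abs]; nlinarith [hh_deriv (-r x - ε), abs_nonneg (deriv hh (-r x - ε))]
      exact mul_le_mul a1 (S.hCr x (by linarith)) bp bn
    · rw [indicator_of_notMem (show x ∉ {x | -2 < r x} from h2), hh_deriv0 (by linarith [not_lt.1 h2])]; simp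
  have cE := cφ.continuous.neg.rexp
  have cηc := (cd_cx cη).continuous
  have c1 := fun j => cont_dz ((cd_cx cη).of_le one_le_two) (ee j)
  have c2 := fun j => cont_db ((cd_cx cη).of_le one_le_two) (ee j)
  have mm : ∀ {a f : FC}, Continuous a → MemLp f 2 → (∀ x, x ∉ K → f x = 0) →
    MemLp (fun x => a x * f x) 2 := fun ha hf hz => by
      obtain ⟨M, _, hM⟩ := mem_mulc Kk ha; exact (hM _ hf hz).1
  have mΔ : MemLp Δ 2 := hΔ.memLp_of_hasCompactSupport (hcs_of Kk Δz)
  have iA : Integrable fun x => ‖cx η x * Δ x + ∑ j, dz (ee j) (cx η) x * q j x‖ ^ 2 * Real.exp (-φ x) :=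
    int_sq_mul Kk ((mm cηc mΔ Δz).add (memLp_finsetSum _ fun j _ => mm (c1 j) (mq j) (qz j)))
      (fun x hx => by simp [qz _ x hx, Δz x hx]) cE
  have iB : ∀ j k, Integrable fun x => ‖db (ee k) (cx η) x * q j x - db (ee j) (cx η) x * q k x‖ ^ 2 *
        ((1/2) * Real.exp (-φ x)) := fun j k =>
    int_sq_mul Kk ((mm (c2 k) (mq j) (qz j)).sub (mm (c2 j) (mq k) (qz k)))
      (fun x hx => by simp [qz _ x hx]) (continuous_const.mul cE)
  have ck : Continuous (kap r κ0 K0 ε) := by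
    have := S.hκ
    unfold kap mx
    refine this.add (continuous_const.mul (Continuous.mul (by fun_prop) (Continuous.pow ?_ 6)))
    exact Continuous.inv₀ (by fun_prop) fun x => (lt_max_of_lt_right h0).ne'
  have iL : ∀ j, Integrable fun x => ‖cx η x * q j x‖ ^ 2 * (kap r κ0 K0 ε x * Real.exp (-φ x)) := fun j =>
    int_sq_mul Kk (mm cηc (mq j) (qz j)) (fun x hx => by simp [qz _ x hx]) (ck.mul cE)
  have iB' := integrable_finsetSum Finset.univ fun j _ => integrable_finsetSum Finset.univ fun k _ => iB j k
  rw [← integral_finsetSum _ fun j _ => iL j] at key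
  simp only [← integral_finsetSum _ fun k _ => iB _ k] at key
  rw [← integral_finsetSum _ fun j _ => integrable_finsetSum Finset.univ fun k _ => iB j k,
    ← integral_add iA iB'] at key
  have iP : Integrable fun x => indicator {x | -2 < r x} (fun x => EE r ψ K0 x * ‖v x‖ ^ 2) x :=
    hv.2.indicator (measurableSet_lt measurable_const rc.measurable)
  have iΔ : Integrable fun x => ‖Δ x‖ ^ 2 * Real.exp (-ψ x) :=
    int_sq_mul Kk mΔ Δz S.hψ.continuous.neg.rexp
  rw [← integral_const_mul, ← integral_add iΔ (iP.const_mul _)]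
  refine le_trans (le_of_eq ?_) (key.trans (integral_mono (iA.add iB') (iΔ.add (iP.const_mul _)) fun x => ?_))
  · refine integral_congr_ae (.of_forall fun x => ?_)
    by_cases hx : x ∈ K
    · simp only [qv _ x hx, Eφ x hx, norm_mul, vsq, cx, Complex.norm_real, mul_pow, Real.norm_eq_abs,
        sq_abs, ← Finset.sum_mul, ← Finset.mul_sum]
      simp only [hη]; ring
    · simp only [qz _ x hx]; rw [show hh (-r x - ε) = 0 from ηz x hx]; simp
  · have RHS0 : 0 ≤ 243 * Cr * indicator {x | -2 < r x} (fun x => EE r ψ K0 x * ‖v x‖ ^ 2) x :=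
      mul_nonneg (by have := S.hCr0; positivity)
        (indicator_nonneg (fun x _ => mul_nonneg (EE_nonneg _ _ _ _) bp) x)
    simp only [Pi.add_apply]
    by_cases hx : x ∈ K
    · simp only [qv _ x hx]
      have B1 := pw2 (fun j => db (ee j) (cx η) x) (fun j => v x j)
      have A1 := pw1 (fun j => dz (ee j) (cx η) x) (fun j => v x j)
      simp only [dbη, ← vsq] at A1 B1
      have B2 : ∑ j, ∑ k, ‖db (ee k) (cx η) x * v x j - db (ee j) (cx η) x * v x k‖ ^ 2 *
        ((1/2) * Real.exp (-φ x)) = (∑ j, ∑ k, ‖db (ee k) (cx η) x * v x j - db (ee j) (cx η) x * v x k‖ ^ 2 *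
        (1/2)) * Real.exp (-φ x) := by simp only [Finset.sum_mul, mul_assoc]
      rw [B2]
      have SS := mul_le_mul_of_nonneg_right (Sη x hx) (sq_nonneg ‖v x‖)
      have e0 := Real.exp_pos (-φ x)
      have ind : indicator {x | -2 < r x} (fun x => EE r ψ K0 x * ‖v x‖ ^ 2) x =
        indicator {x | -2 < r x} (fun _ => 1) x * (Real.exp (-φ x) * ‖v x‖ ^ 2) := by
        by_cases h2 : -2 < r x
        · simp only [indicator_of_mem (show x ∈ {x | -2 < r x} from h2), one_mul, Eφ x hx]
        · simp only [indicator_of_notMem (show x ∉ {x | -2 < r x} from h2), zero_mul]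
      have ind2 : indicator {x | -2 < r x} (fun _ => 81 * Cr) x =
        81 * Cr * indicator {x | -2 < r x} (fun _ => (1:ℝ)) x := by
        by_cases h2 : -2 < r x
        · simp only [indicator_of_mem (show x ∈ {x | -2 < r x} from h2), mul_one]
        · simp only [indicator_of_notMem (show x ∉ {x | -2 < r x} from h2), mul_zero]
      rw [ind]; rw [ind2] at SS
      have A2 : ‖cx η x * Δ x + ∑ j, dz (ee j) (cx η) x * v x j‖ ^ 2 * Real.exp (-φ x) ≤
        ‖Δ x‖ ^ 2 * Real.exp (-ψ x) + (∑ j, ‖dz (ee j) (cx η) x‖ ^ 2) * ‖v x‖ ^ 2 * Real.exp (-φ x) := by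
        by_cases hd : Δ x = 0
        · rw [hd, mul_zero, zero_add, norm_zero]
          have := mul_le_mul_of_nonneg_right A1 e0.le
          simpa using this
        · have hr3 := hΔz x hd
          have d0 : ∀ j, dz (ee j) (cx η) x = 0 := fun j => by
            rw [dη, hh_deriv0 (by linarith)]; simp
          have e1 : cx η x = 1 := by simp only [cx, hη]; rw [hh_one (by linarith)]; simp
          have e2 : φ x = ψ x := by rw [eφ x (KU hx), ch_zero hr3.le, add_zero]
          simp [d0, e1, e2]
      have B3 := mul_le_mul_of_nonneg_right B1 e0.le
      have S3 := mul_le_mul_of_nonneg_right SS e0.le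
      nlinarith
    · simp only [qz _ x hx, Δz x hx]
      simp only [mul_zero, Finset.sum_const_zero, add_zero, norm_zero, sub_zero]
      simpa using RHS0

lemma absorb2 {r ψ κ0 : FR} {Cr M0 K0 : ℝ} (S : Setup r ψ κ0 Cr M0 K0) {v : EC → EC}
    (hv : Good (EE r ψ K0) v) {Δ : FC} (hΔ : Continuous Δ) (hΔz : ∀ x, Δ x ≠ 0 → r x < -3)
    (eD : ∀ G : FC, ContDiff ℝ 2 G → HasCompactSupport G → tsupport G ⊆ {x | r x < 0} →
      ∑ j, ∫ x, v x j * (dz (ee j) G x * EE r ψ K0 x) = - ∫ x, Δ x * (G x * EE r ψ K0 x))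
    (eZ : ∀ j k, ∀ G : FC, ContDiff ℝ 2 G → HasCompactSupport G → tsupport G ⊆ {x | r x < 0} →
      (∫ x, v x j * db (ee k) G x) - ∫ x, v x k * db (ee j) G x = 0) :
    Integrable (fun x => κ0 x * (EE r ψ K0 x * ‖v x‖ ^ 2)) ∧
    ∫ x, κ0 x * (EE r ψ K0 x * ‖v x‖ ^ 2) ≤ ∫ x, ‖Δ x‖ ^ 2 * Real.exp (-ψ x) := by
  set P : FR := fun x => EE r ψ K0 x * ‖v x‖ ^ 2 with hP
  have P0 : ∀ x, 0 ≤ P x := fun x => mul_nonneg (EE_nonneg _ _ _ _) bp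
  have Pm : Measurable P := S.Emeas.mul ((hv.1.norm).pow_const 2)
  have iP : Integrable P := hv.2
  have rc := S.hr.continuous
  have K0n := S.K0n
  have rm := rc.measurable
  have κm := S.hκ.measurable
  have hhm := hh_cd.continuous.measurable
  set ep : ℕ → ℝ := fun m => 1 / ((m : ℝ) + 1) with hep
  have ep0 : ∀ m, 0 < ep m := fun m => Nat.one_div_pos_of_nat
  have ep1 : ∀ m, ep m ≤ 1 := fun m => by
    rw [hep]; simp only; rw [div_le_one bp]; linarith [Nat.cast_nonneg (α := ℝ) m]
  set F : ℕ → FR := fun m x => hh (-r x - ep m) ^ 2 * kap r κ0 K0 (ep m) x * P x with hF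
  have k0 : ∀ m x, 0 ≤ kap r κ0 K0 (ep m) x := fun m x =>
    add_nonneg (S.hκ0 x) (mul_nonneg K0n (mul_nonneg (mx_nonneg _ _)
      (pow_nonneg (inv_nonneg.2 ((ep0 m).le.trans (le_max_right _ _))) _)))
  have Fm : ∀ m, Measurable (F m) := fun m => by
    rw [hF]; unfold kap mx; fun_prop
  have F0 : ∀ m x, 0 ≤ F m x := fun m x => mul_nonneg (mul_nonneg (sq_nonneg _) (k0 m x)) (P0 x)
  have iF : ∀ m, Integrable (F m) := fun m => by
    refine (iP.const_mul (M0 + K0 * (9 * ((ep m)⁻¹) ^ 6))).mono' (Fm m).aestronglyMeasurable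
      (.of_forall fun x => ?_)
    rw [Real.norm_of_nonneg (F0 m x)]
    by_cases hx : r x < 0
    · refine mul_le_mul_of_nonneg_right ?_ (P0 x)
      have h1 : hh (-r x - ep m) ^ 2 ≤ 1 := pow_le_one₀ (hh_nonneg _) (hh_le _)
      have h2 : mx 2 (r x + 3) ≤ 9 := by
        have : max 0 (r x + 3) ≤ 3 := max_le bn (by linarith)
        unfold mx; nlinarith [le_max_left 0 (r x + 3)]
      have h3 : (max (-r x) (ep m))⁻¹ ^ 6 ≤ (ep m)⁻¹ ^ 6 := by
        have := ep0 m
        gcongr; exact le_max_right _ _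
      have h4 : kap r κ0 K0 (ep m) x ≤ M0 + K0 * (9 * ((ep m)⁻¹) ^ 6) := by
        unfold kap
        have : 0 ≤ (max (-r x) (ep m))⁻¹ ^ 6 :=
          pow_nonneg (inv_nonneg.2 ((ep0 m).le.trans (le_max_right _ _))) _
        gcongr
        exact S.hκ1 x
      calc _ ≤ 1 * kap r κ0 K0 (ep m) x := by gcongr; exact k0 m x
        _ ≤ _ := by rw [one_mul]; exact h4
    · have : P x = 0 := by rw [hP]; simp only; rw [EE, indicator_of_notMem (by exact hx), zero_mul]
      simp [hF, this]
  set R : ℝ := (∫ x, ‖Δ x‖ ^ 2 * Real.exp (-ψ x)) + 243 * Cr *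
        ∫ x, indicator {x | -2 < r x} P x with hR
  have leR : ∀ m, ∫ x, F m x ≤ R := fun m => absorb1 S hv hΔ hΔz eD eZ (ep0 m) (ep1 m)
  have mI : MeasurableSet {x | -2 < r x} := measurableSet_lt measurable_const rm
  have iI : Integrable (indicator {x | -2 < r x} P) := iP.indicator mI
  have iκ : Integrable fun x => κ0 x * P x := by
    refine (iP.const_mul M0).mono' (κm.mul Pm).aestronglyMeasurable (.of_forall fun x => ?_)
    rw [Real.norm_of_nonneg (mul_nonneg (S.hκ0 x) (P0 x))]
    exact mul_le_mul_of_nonneg_right (S.hκ1 x) (P0 x)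
  refine ⟨iκ, ?_⟩
  have key : ∫⁻ x, ENNReal.ofReal (κ0 x * P x + 243 * Cr * indicator {x | -2 < r x} P x) ≤
      ENNReal.ofReal R := by
    calc _ ≤ ∫⁻ x, liminf (fun m => ENNReal.ofReal (F m x)) atTop := by
          refine lintegral_mono fun x => ?_
          by_cases hx : r x < 0
          · have ct : ContinuousAt (fun e : ℝ => hh (-r x - e) ^ 2 * kap r κ0 K0 e x * P x) 0 := by
              have h1 : Continuous fun e : ℝ => hh (-r x - e) := hh_cd.continuous.comp (by fun_prop)
              have h2 : ContinuousAt (fun e : ℝ => (max (-r x) e)⁻¹) 0 :=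
                ContinuousAt.inv₀ (by fun_prop) (by rw [max_eq_left (by linarith)]; linarith)
              unfold kap
              exact ((h1.continuousAt.pow 2).mul (continuousAt_const.add (continuousAt_const.mul
                (continuousAt_const.mul (h2.pow 6))))).mul continuousAt_const
            have t1 : Tendsto (fun m => F m x) atTop (𝓝 _) :=
              ct.tendsto.comp tendsto_one_div_add_atTop_nhds_zero_nat
            have t2 : Tendsto (fun m => ENNReal.ofReal (F m x)) atTop (𝓝 _) := (ENNReal.continuous_ofReal.tendsto _).comp t1
            rw [t2.liminf_eq]
            refine ENNReal.ofReal_le_ofReal ?_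
            simp only [sub_zero]
            by_cases h2 : -2 < r x
            · rw [indicator_of_mem (by exact h2), ← add_mul]
              refine mul_le_mul_of_nonneg_right ?_ (P0 x)
              have e1 : max (-r x) 0 = -r x := max_eq_left (by linarith)
              unfold kap; rw [e1]
              set t := -r x with ht
              have t0 : 0 < t := by linarith
              have m1 : 1 ≤ mx 2 (r x + 3) := by
                have : 1 ≤ max 0 (r x + 3) := le_max_of_le_right (by linarith)
                unfold mx; nlinarith
              have q1 : 1 / 64 ≤ hh t ^ 2 * (t⁻¹) ^ 6 := by
                rcases le_total t 1 with h | h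
                · have := hh_ge t0.le h
                  have h6 : (t ^ 3) ^ 2 ≤ hh t ^ 2 := by gcongr
                  rw [inv_pow, ← div_eq_mul_inv, le_div_iff₀ bp]
                  nlinarith [pow_pos t0 6, pow_mul t 3 2]
                · rw [hh_one h, inv_pow, one_pow, one_mul, ← one_div]
                  apply one_div_le_one_div_of_le bp
                  calc t ^ 6 ≤ 2 ^ 6 := by gcongr; linarith
                    _ = 64 := by norm_num
              have q2 : K0 / 64 ≤ hh t ^ 2 * (K0 * (mx 2 (r x + 3) * t⁻¹ ^ 6)) := by
                calc K0 / 64 = K0 * (1 / 64 * 1) := by ring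
                  _ ≤ K0 * ((hh t ^ 2 * (t⁻¹) ^ 6) * mx 2 (r x + 3)) := by gcongr
                  _ = _ := by ring
              have := S.hK0
              have := S.hκ1 x
              have : 0 ≤ hh t ^ 2 * κ0 x := mul_nonneg (sq_nonneg _) (S.hκ0 x)
              rw [mul_add]; linarith
            · rw [indicator_of_notMem (by exact h2), mul_zero, add_zero]
              refine mul_le_mul_of_nonneg_right ?_ (P0 x)
              rw [hh_one (by linarith [not_lt.1 h2]), one_pow, one_mul]
              unfold kap
              have := mul_nonneg K0n (mul_nonneg (mx_nonneg 2 (r x + 3)) (pow_nonneg (inv_nonneg.2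
                (le_max_right (-r x) 0)) 6))
              linarith
          · have : P x = 0 := by rw [hP]; simp only; rw [EE, indicator_of_notMem (by exact hx), zero_mul]
            have h2 : indicator {x | -2 < r x} P x = 0 := by
              unfold indicator; split_ifs <;> simp [this]
            rw [this, h2]; simp
      _ ≤ liminf (fun m => ∫⁻ x, ENNReal.ofReal (F m x)) atTop :=
          lintegral_liminf_le fun m => (Fm m).ennreal_ofReal
      _ ≤ liminf (fun _ : ℕ => ENNReal.ofReal R) atTop := by
          refine liminf_le_liminf (.of_forall fun m => ?_)
          rw [← ofReal_integral_eq_lintegral_ofReal (iF m) (.of_forall (F0 m))]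
          exact ENNReal.ofReal_le_ofReal (leR m)
      _ = _ := by rw [liminf_const]
  have g0 : ∀ x, 0 ≤ κ0 x * P x + 243 * Cr * indicator {x | -2 < r x} P x := fun x =>
    add_nonneg (mul_nonneg (S.hκ0 x) (P0 x)) (mul_nonneg (by have := S.hCr0; positivity)
      (indicator_nonneg (fun x _ => P0 x) x))
  have R0 : 0 ≤ R := add_nonneg (integral_nonneg fun x => by positivity)
    (mul_nonneg (by have := S.hCr0; positivity) (integral_nonneg fun x => indicator_nonneg (fun x _ => P0 x) x))
  have iS : Integrable fun x => κ0 x * P x + 243 * Cr * indicator {x | -2 < r x} P x := iκ.add (iI.const_mul _)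
  rw [← ofReal_integral_eq_lintegral_ofReal iS (.of_forall g0),
    ENNReal.ofReal_le_ofReal_iff R0, integral_add iκ (iI.const_mul _), integral_const_mul] at key
  linarith

lemma amgm {N A B : ℝ} (hN : 0 ≤ N) (hA : 0 ≤ A) (hB : 0 ≤ B)
    (h : ∀ s, 0 < s → 2 * N ≤ s * A + s⁻¹ * B) : N ^ 2 ≤ A * B := by
  rcases hN.eq_or_lt with h0 | h0
  · rw [← h0]; simpa using mul_nonneg hA hB
  rcases hA.eq_or_lt with a0 | a0
  · have := h (B / N + 1) bp
    rw [← a0, mul_zero, zero_add, inv_mul_eq_div, le_div_iff₀ bp] at this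
    have e : B / N * N = B := div_mul_cancel₀ _ h0.ne'
    nlinarith
  · have := h (N / A) bp
    rw [div_mul_cancel₀ _ a0.ne', inv_div, div_mul_eq_mul_div, ← sub_le_iff_le_add', le_div_iff₀ h0] at this
    nlinarith

lemma EE_lower {r ψ κ0 : FR} {Cr M0 K0 : ℝ} (S : Setup r ψ κ0 Cr M0 K0) {K : SC}
    (hK : IsCompact K) (h : K ⊆ {x | r x < 0}) : ∃ c, 0 < c ∧ ∀ x ∈ K, c ≤ EE r ψ K0 x := by
  obtain ⟨c, c0, hc⟩ := hK.exists_forall_le' (f := fun x => Real.exp (-(ψ x + ch K0 (r x)))) (a := 0)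
    (((S.cdφ.continuousOn.mono h).neg).rexp) (fun x _ => Real.exp_pos _)
  exact ⟨c, c0, fun x hx => by rw [EE, indicator_of_mem (h hx)]; exact hc x hx⟩

lemma proj_meas {v : EC → EC} (hv : Measurable v) (j : Fin n) : Measurable fun x => v x j :=
  (EuclideanSpace.proj (𝕜 := ℂ) j).continuous.measurable.comp hv

lemma good_int {r ψ κ0 : FR} {Cr M0 K0 : ℝ} (S : Setup r ψ κ0 Cr M0 K0) {a : EC → EC}
    (ha : Good (EE r ψ K0) a) {w : FC} (hw : Continuous w) (hc : HasCompactSupport w)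
    (hs : tsupport w ⊆ {x | r x < 0}) (j : Fin n) : Integrable fun x => a x j * w x := by
  obtain ⟨c, c0, hcE⟩ := EE_lower S hc hs
  have h1 := memLp_ind ha (isClosed_tsupport w).measurableSet c0 hcE (EE_nonneg _ _ _) j
  have h2 := h1.integrable_mul (hw.memLp_of_hasCompactSupport (p := 2) hc)
  refine h2.congr (.of_forall fun x => ?_)
  simp only [Pi.mul_apply]
  by_cases hx : x ∈ tsupport w
  · rw [indicator_of_mem hx]
  · rw [image_eq_zero_of_notMem_tsupport hx, mul_zero, mul_zero]

lemma ts_db {f : FC} (X : EC) : tsupport (db X f) ⊆ tsupport f :=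
  closure_minimal (fun x hx => by
    by_contra h
    exact hx (db_zero (isClosed_tsupport f) (fun y hy => image_eq_zero_of_notMem_tsupport hy) h X).2.1)
    (isClosed_tsupport f)
lemma ts_dz {f : FC} (X : EC) : tsupport (dz X f) ⊆ tsupport f :=
  closure_minimal (fun x hx => by
    by_contra h
    exact hx (db_zero (isClosed_tsupport f) (fun y hy => image_eq_zero_of_notMem_tsupport hy) h X).2.2)
    (isClosed_tsupport f)

lemma cont_vec {w : Fin n → FC} (h : ∀ j, Continuous (w j)) : Continuous (vec w) :=
  (PiLp.continuous_toLp 2 _).comp (continuous_pi h)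

lemma inner_vec (w : Fin n → FC) (x y : EC) : inner ℂ (vec w x) y = ∑ j, conj (w j x) * y j := by
  rw [PiLp.inner_apply]; simp [vec, mul_comm]

set_option maxHeartbeats 1000000 in
lemma apriori {r ψ κ0 : FR} {Cr M0 K0 : ℝ} (S : Setup r ψ κ0 Cr M0 K0)
    (hψ0 : ∀ x, r x < 0 → 0 ≤ ψ x) {u0 : FC} (hu : ContDiff ℝ 2 u0) {c : ℝ} (hc : 0 < c)
    (hα : ∀ x, r x < 0 → (∃ j, db (ee j) u0 x ≠ 0) → c ≤ κ0 x) {v : Fin n → FC}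
    (hv : ∀ j, ContDiff ℝ 2 (v j)) (hvc : ∀ j, HasCompactSupport (v j))
    (hvs : ∀ j, tsupport (v j) ⊆ {x | r x < -3}) :
    ‖∫ x, (∑ j, conj (db (ee j) u0 x) * v j x) * wt ψ x‖ ^ 2 ≤
      (c⁻¹ * ∫ x in {x | r x < 0}, ∑ j, ‖db (ee j) u0 x‖ ^ 2) *
        ∫ x, ‖∑ j, dl ψ (ee j) (v j) x‖ ^ 2 * Real.exp (-ψ x) := by
  set E := EE r ψ K0 with hE
  have E0 := EE_nonneg r ψ K0
  have Epos : ∀ x, r x < 0 → 0 < E x := fun x hx => by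
    rw [hE, EE, indicator_of_mem (by exact hx)]; exact Real.exp_pos _
  have Ez : ∀ x, ¬ r x < 0 → E x = 0 := fun x hx => by rw [hE, EE, indicator_of_notMem (by exact hx)]
  have E3 : ∀ x, r x < -3 → (E x : ℂ) = wt ψ x := fun x hx => by
    rw [hE, EE, indicator_of_mem (show x ∈ {x | r x < 0} from lt_trans hx bn), ch_zero hx.le, add_zero]; rfl
  have E1 : ∀ x, E x ≤ indicator {x | r x < 0} (fun _ => (1:ℝ)) x := fun x => by
    by_cases hx : r x < 0
    · rw [hE, EE, indicator_of_mem (by exact hx), indicator_of_mem (by exact hx), Real.exp_le_one_iff]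
      have : 0 ≤ ch K0 (r x) := mul_nonneg (mul_nonneg S.K0n (mx_nonneg _ _))
        (pow_nonneg (inv_nonneg.2 (by linarith)) _)
      linarith [hψ0 x hx]
    · rw [Ez x hx]; exact indicator_nonneg (fun _ _ => zero_le_one) x
  have Ele : ∀ x, E x ≤ 1 := fun x => (E1 x).trans (by
    by_cases hx : x ∈ {x | r x < 0}
    · rw [indicator_of_mem hx]
    · rw [indicator_of_notMem hx]; exact zero_le_one)
  have oD := S.op
  have fin : volume {x | r x < 0} < ⊤ :=
    (measure_mono fun x (hx : r x < 0) => hx.le).trans_lt S.hc.measure_lt_top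
  have goodC : ∀ w : Fin n → FC, (∀ j, Continuous (w j)) → Good E (vec w) := fun w hw => by
    have cw := cont_vec hw
    refine ⟨cw.measurable, ?_⟩
    have h1 : IntegrableOn (fun x => ‖vec w x‖ ^ 2) {x | r x < 0} :=
      ((cw.norm.pow 2).continuousOn.integrableOn_compact S.hc).mono_set fun x (hx : r x < 0) => hx.le
    refine ((integrable_indicator_iff oD.measurableSet).2 h1).mono'
      (S.Emeas.mul (cw.measurable.norm.pow_const 2)).aestronglyMeasurable (.of_forall fun x => ?_)
    rw [Real.norm_of_nonneg (mul_nonneg (E0 x) bp)]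
    have := mul_le_mul_of_nonneg_right (E1 x) (sq_nonneg ‖vec w x‖)
    refine this.trans (le_of_eq ?_)
    by_cases hx : x ∈ {x | r x < 0}
    · rw [indicator_of_mem hx, indicator_of_mem hx, one_mul]
    · rw [indicator_of_notMem hx, indicator_of_notMem hx, zero_mul]
  set tt : Fin n → Fin n → (FC) → EC → EC := fun j k g x =>
    ((E x)⁻¹ : ℝ) • (conj (db (ee k) g x) • ee j - conj (db (ee j) g x) • ee k) with htt
  set T : Set (EC → EC) := {t | ∃ j k g, ContDiff ℝ 2 g ∧ HasCompactSupport g ∧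
    tsupport g ⊆ {x | r x < 0} ∧ t = tt j k g} with hT
  have cdb : ∀ {g : FC}, ContDiff ℝ 2 g → ∀ j, Continuous (db (ee j) g) := fun hg j =>
    cont_db (hg.of_le one_le_two) _
  have gT : ∀ t ∈ T, Good E t := by
    rintro t ⟨j, k, g, hg, gc, gs, rfl⟩
    set w : EC → EC := fun x => conj (db (ee k) g x) • ee j - conj (db (ee j) g x) • ee k with hw
    have cw : Continuous w := ((cont_conj (cdb hg k)).smul continuous_const).sub
      ((cont_conj (cdb hg j)).smul continuous_const)
    have wz : ∀ x, x ∉ tsupport g → w x = 0 := fun x hx => by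
      have h1 := image_eq_zero_of_notMem_tsupport fun h => hx (ts_db (ee j) h)
      have h2 := image_eq_zero_of_notMem_tsupport fun h => hx (ts_db (ee k) h)
      simp [hw, h1, h2]
    obtain ⟨d, d0, hd⟩ := EE_lower S gc gs
    have mt : Measurable (tt j k g) := (S.Emeas.inv).smul cw.measurable
    refine ⟨mt, ?_⟩
    have h1 : Integrable fun x => ‖w x‖ ^ 2 :=
      (cw.norm.pow 2).integrable_of_hasCompactSupport (hcs_of gc fun x hx => by simp [wz x hx])
    refine (h1.const_mul d⁻¹).mono' (S.Emeas.mul (mt.norm.pow_const 2)).aestronglyMeasurable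
      (.of_forall fun x => ?_)
    rw [Real.norm_of_nonneg (mul_nonneg (E0 x) bp)]
    change E x * ‖(E x)⁻¹ • w x‖ ^ 2 ≤ _
    by_cases hx : x ∈ tsupport g
    · have e0 := Epos x (gs hx)
      rw [norm_smul, Real.norm_of_nonneg (inv_nonneg.2 e0.le), mul_pow, ← mul_assoc,
        show E x * (E x)⁻¹ ^ 2 = (E x)⁻¹ by field_simp]
      gcongr; exact hd x hx
    · rw [wz x hx]; simp
  have pair : ∀ j k g, ContDiff ℝ 2 g → HasCompactSupport g → tsupport g ⊆ {x | r x < 0} →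
      ∀ a : EC → EC, Good E a → ∫ x, E x • inner ℂ (tt j k g x) (a x) =
        (∫ x, a x j * db (ee k) g x) - ∫ x, a x k * db (ee j) g x := by
    intro j k g hg gc gs a ha
    have i1 := good_int S ha (cdb hg k) (hcs_db gc _) ((ts_db (ee k)).trans gs) j
    have i2 := good_int S ha (cdb hg j) (hcs_db gc _) ((ts_db (ee j)).trans gs) k
    rw [← integral_sub i1 i2]
    refine integral_congr_ae (.of_forall fun x => ?_)
    have e : ∀ i (y : EC), inner ℂ (ee i) y = y i := fun i y => by
      rw [ee, EuclideanSpace.inner_single_left]; simp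
    simp only [htt]
    by_cases hx : r x < 0
    · have := (Epos x hx).ne'
      rw [show ((E x)⁻¹ : ℝ) • (conj (db (ee k) g x) • ee j - conj (db (ee j) g x) • ee k) =
        (((E x)⁻¹ : ℝ) : ℂ) • (conj (db (ee k) g x) • ee j - conj (db (ee j) g x) • ee k) from
        (Complex.coe_smul _ _).symm]
      rw [inner_smul_left, inner_sub_left, inner_smul_left, inner_smul_left, e, e, Complex.real_smul,
        Complex.conj_ofReal, Complex.conj_conj, Complex.conj_conj, ← mul_assoc, ← Complex.ofReal_mul,
        mul_inv_cancel₀ this, Complex.ofReal_one]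
      ring
    · have h1 := image_eq_zero_of_notMem_tsupport fun h => hx (((ts_db (ee j)).trans gs) h)
      have h2 := image_eq_zero_of_notMem_tsupport fun h => hx (((ts_db (ee k)).trans gs) h)
      simp [h1, h2]
  have closed : ∀ f : FC, ContDiff ℝ 2 f → ∀ t ∈ T,
      ∫ x, E x • inner ℂ (t x) (vec (fun j => db (ee j) f) x) = 0 := by
    rintro f hf t ⟨j, k, g, hg, gc, gs, rfl⟩
    rw [pair j k g hg gc gs _ (goodC _ (cdb hf))]
    simp only [vec]
    rw [ibp_db _ (c1_db hf _) (hg.of_le one_le_two) gc, ibp_db _ (c1_db hf _) (hg.of_le one_le_two) gc,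
      sub_eq_zero]
    congr 1
    exact integral_congr_ae (.of_forall fun x => by simp only; rw [db_db_comm hf.contDiffAt])
  obtain ⟨v1, gv1, ov1, dv1⟩ := decompW S.Emeas E0 T gT (goodC v fun j => (hv j).continuous)
  set Δ : FC := fun x => ∑ j, dl ψ (ee j) (v j) x with hΔ
  have vz : ∀ j x, ¬ r x < -3 → v j x = 0 := fun j x hx =>
    image_eq_zero_of_notMem_tsupport fun h => hx (hvs j h)
  have dz0 : ∀ j x, ¬ r x < -3 → dl ψ (ee j) (v j) x = 0 := fun j x hx => by
    have h1 := image_eq_zero_of_notMem_tsupport fun h => hx (((ts_dz (ee j)).trans (hvs j)) h)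
    rw [dl, h1, vz j x hx]; simp
  have Δc : Continuous Δ := continuous_finsetSum _ fun j _ => (c1_dl S.hψ (hv j) _).continuous
  have Δz : ∀ x, Δ x ≠ 0 → r x < -3 := fun x hx => by
    by_contra h; exact hx (Finset.sum_eq_zero fun j _ => dz0 j x h)
  have rhs : ∀ f : FC, ∫ x, E x • inner ℂ (vec (fun j => db (ee j) f) x) (vec v x) =
      ∫ x, (∑ j, conj (db (ee j) f x) * v j x) * wt ψ x := fun f => by
    refine integral_congr_ae (.of_forall fun x => ?_)
    simp only [inner_vec, Complex.real_smul]
    by_cases hx : r x < -3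
    · rw [E3 x hx, mul_comm]; rfl
    · simp [vec, vz _ x hx]
  have main := absorb2 S gv1 Δc Δz ?_ ?_
  rotate_left
  · intro G hG Gc Gs
    have hG' : ContDiff ℝ 2 fun x => conj (G x) := Complex.conjCLE.contDiff.comp hG
    have := dv1 _ (goodC _ (cdb hG')) (closed _ hG')
    rw [rhs] at this
    have dG : ∀ x, DifferentiableAt ℝ G x := fun x => hG.differentiable two_ne_zero x
    have cc : ∀ j x, conj (db (ee j) (fun x => conj (G x)) x) = dz (ee j) G x := fun j x => by
      rw [db_conj (dG x), Complex.conj_conj]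
    simp only [inner_vec, cc] at this
    have iv : ∀ j, Integrable fun x => v1 x j * (dz (ee j) G x * E x) := fun j => by
      have h1 := good_int S gv1 (cont_dz (hG.of_le one_le_two) (ee j)) (hcs_dz Gc _)
        ((ts_dz (ee j)).trans Gs) j
      refine h1.norm.mono' ?_ (.of_forall fun x => ?_)
      · exact ((proj_meas gv1.1 j).mul ((cont_dz (hG.of_le one_le_two) (ee j)).measurable.mul
          (Complex.measurable_ofReal.comp S.Emeas))).aestronglyMeasurable
      · rw [← mul_assoc, norm_mul]
        refine mul_le_of_le_one_right (norm_nonneg _) ?_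
        rw [Complex.norm_real, Real.norm_of_nonneg (E0 x)]
        exact Ele x
    rw [← integral_finsetSum _ fun j _ => iv j]
    have e1 : ∫ x, ∑ j, v1 x j * (dz (ee j) G x * E x) = ∫ x, (∑ j, dz (ee j) G x * v j x) * wt ψ x := by
      rw [← this]
      refine integral_congr_ae (.of_forall fun x => ?_)
      simp only [Complex.real_smul, Finset.mul_sum]
      exact Finset.sum_congr rfl fun j _ => by ring
    rw [e1]
    have dvw : ∀ j, ContDiff ℝ 1 fun x => v j x * wt ψ x := fun j =>
      ((hv j).of_le one_le_two).mul (cd_wt (S.hψ.of_le one_le_two))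
    have e2 : ∀ j, ∫ x, (v j x * wt ψ x) * dz (ee j) G x = - ∫ x, dl ψ (ee j) (v j) x * (G x * E x) := fun j => by
      rw [ibp_dz _ (dvw j) (hG.of_le one_le_two) Gc]
      congr 1
      refine integral_congr_ae (.of_forall fun x => ?_)
      simp only
      rw [dz_cE (S.hψ.differentiable two_ne_zero x) ((hv j).differentiable two_ne_zero x)]
      by_cases hx : r x < -3
      · rw [E3 x hx]; ring
      · rw [dz0 j x hx]; simp
    have i3 : ∀ j, Integrable fun x => (v j x * wt ψ x) * dz (ee j) G x := fun j =>
      (((dvw j).continuous).mul (cont_dz (hG.of_le one_le_two) _)).integrable_of_hasCompactSupport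
        ((hcs_dz Gc _).mul_left)
    have i4 : ∀ j, Integrable fun x => dl ψ (ee j) (v j) x * (G x * E x) := fun j => by
      have : Integrable fun x => dl ψ (ee j) (v j) x * (G x * wt ψ x) :=
        ((c1_dl S.hψ (hv j) _).continuous.mul (hG.continuous.mul
          (cd_wt S.hψ).continuous)).integrable_of_hasCompactSupport ((hcs_dl (hvc j) _).mul_right)
      refine this.congr (.of_forall fun x => ?_)
      by_cases hx : r x < -3
      · simp only [E3 x hx]
      · simp [dz0 j x hx]
    calc _ = ∑ j, ∫ x, (v j x * wt ψ x) * dz (ee j) G x := by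
          rw [← integral_finsetSum _ fun j _ => i3 j]
          refine integral_congr_ae (.of_forall fun x => ?_)
          simp only [Finset.sum_mul]
          exact Finset.sum_congr rfl fun j _ => by ring
      _ = _ := by
          simp only [e2, Finset.sum_neg_distrib]
          rw [← integral_finsetSum _ fun j _ => i4 j]
          simp only [hΔ, Finset.sum_mul]; rfl
  · intro j k G hG Gc Gs
    rw [← pair j k G hG Gc Gs _ gv1]
    exact ov1 _ ⟨j, k, G, hG, Gc, Gs, rfl⟩
  have key := dv1 _ (goodC _ (cdb hu)) (closed _ hu)
  rw [rhs] at key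
  rw [← key]
  set α : EC → EC := vec (fun j => db (ee j) u0) with hαd
  have cα : Continuous α := cont_vec (cdb hu)
  have iα : IntegrableOn (fun x => ‖α x‖ ^ 2) {x | r x < 0} :=
    ((cα.norm.pow 2).continuousOn.integrableOn_compact S.hc).mono_set fun x (hx : r x < 0) => hx.le
  have α2 : ∀ x, ∑ j, ‖db (ee j) u0 x‖ ^ 2 = ‖α x‖ ^ 2 := fun x => (vec_sq _ x).symm
  simp only [α2]
  refine (amgm (norm_nonneg _) (mul_nonneg (inv_pos.2 hc).le (integral_nonneg fun x => by positivity))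
    (integral_nonneg fun x => mul_nonneg (mul_nonneg (E0 x) bp) (S.hκ0 x)) ?_).trans
    (mul_le_mul_of_nonneg_left (b := ∫ x, E x * ‖v1 x‖ ^ 2 * κ0 x) ?_
      (mul_nonneg (inv_pos.2 hc).le (integral_nonneg fun x => by positivity)))
  · intro s s0
    rw [← integral_indicator oD.measurableSet]
    have iα' := (integrable_indicator_iff oD.measurableSet).2 iα
    have i1 : Integrable fun x => E x * ‖v1 x‖ ^ 2 * κ0 x := main.1.congr (.of_forall fun x => by ring)
    rw [← integral_const_mul, ← integral_const_mul, ← integral_const_mul, ← integral_add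
      ((iα'.const_mul _).const_mul _) (i1.const_mul _)]
    refine (mul_le_mul_of_nonneg_left (norm_integral_le_integral_norm _) zero_le_two).trans ?_
    rw [← integral_const_mul]
    refine integral_mono_of_nonneg (.of_forall fun x => by positivity)
      (((iα'.const_mul _).const_mul _).add (i1.const_mul _)) (.of_forall fun x => ?_)
    simp only [Pi.add_apply]
    rw [norm_smul, Real.norm_of_nonneg (E0 x)]
    have hin := norm_inner_le_norm (𝕜 := ℂ) (α x) (v1 x)
    by_cases hx : r x < 0
    · rw [indicator_of_mem (by exact hx)]
      have e1 : E x ≤ 1 := Ele x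
      have e0 := E0 x
      have k0 := S.hκ0 x
      by_cases h0 : α x = 0
      · have : ‖inner ℂ (α x) (v1 x)‖ ≤ 0 := by simpa [h0] using hin
        have h2 : E x * ‖inner ℂ (α x) (v1 x)‖ ≤ 0 := mul_nonpos_of_nonneg_of_nonpos e0 this
        have : 0 ≤ s * (c⁻¹ * ‖α x‖ ^ 2) + s⁻¹ * (E x * ‖v1 x‖ ^ 2 * κ0 x) := by positivity
        linarith
      · have hκ : c ≤ κ0 x := hα x hx (by
          by_contra! hn
          exact h0 (by ext j; simpa [hαd, vec] using hn j))
        have h1 : 2 * (‖α x‖ * ‖v1 x‖) ≤ s * (c⁻¹ * ‖α x‖ ^ 2) + s⁻¹ * (‖v1 x‖ ^ 2 * c) := by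
          have : s * (c⁻¹ * ‖α x‖ ^ 2) + s⁻¹ * (‖v1 x‖ ^ 2 * c) - 2 * (‖α x‖ * ‖v1 x‖) =
            s * c⁻¹ * (‖α x‖ - s⁻¹ * c * ‖v1 x‖) ^ 2 := by field_simp; ring
          have : 0 ≤ s * c⁻¹ * (‖α x‖ - s⁻¹ * c * ‖v1 x‖) ^ 2 := by positivity
          linarith
        calc 2 * (E x * ‖inner ℂ (α x) (v1 x)‖) ≤ E x * (2 * (‖α x‖ * ‖v1 x‖)) := by
              nlinarith [mul_le_mul_of_nonneg_left hin e0]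
          _ ≤ E x * (s * (c⁻¹ * ‖α x‖ ^ 2) + s⁻¹ * (‖v1 x‖ ^ 2 * c)) := by gcongr
          _ = E x * (s * (c⁻¹ * ‖α x‖ ^ 2)) + s⁻¹ * (E x * ‖v1 x‖ ^ 2 * c) := by ring
          _ ≤ 1 * (s * (c⁻¹ * ‖α x‖ ^ 2)) + s⁻¹ * (E x * ‖v1 x‖ ^ 2 * κ0 x) := by gcongr
          _ = _ := by rw [one_mul]
    · have h1 : EE r ψ K0 x = 0 := Ez x hx
      rw [indicator_of_notMem (by exact hx), Ez x hx]; simp [h1]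
  · refine le_trans (le_of_eq ?_) main.2
    exact integral_congr_ae (.of_forall fun x => by ring)

lemma db_congr {f g : FC} {x : EC} (h : f =ᶠ[𝓝 x] g) (X : EC) : db X f x = db X g x := by
  rw [db, db, h.fderiv_eq]
lemma cont_tsupp {Y : Type*} [TopologicalSpace Y] [Zero Y] {f : EC → Y} {D : SC} (hD : IsOpen D) (hf : ContinuousOn f D)
    (ht : tsupport f ⊆ D) : Continuous f := by
  refine continuous_iff_continuousAt.2 fun x => ?_
  by_cases hx : x ∈ D
  · exact hf.continuousAt (hD.mem_nhds hx)
  · have : f =ᶠ[𝓝 x] fun _ => 0 := notMem_tsupport_iff_eventuallyEq.1 fun h => hx (ht h)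
    exact continuousAt_const.congr this.symm

set_option maxHeartbeats 400000 in
lemma apriori2 {Ω : SC} (hΩ : IsPseudoconvex Ω) {ψ κ0 : FR} {u0 : FC} {c M : ℝ}
    (hψ : ContDiffOn ℝ 2 ψ Ω) (hψ0 : ∀ x ∈ Ω, 0 ≤ ψ x) (hψM : ∀ x ∈ Ω, ψ x ≤ M)
    (hκ : ContinuousOn κ0 Ω) (hκ0 : ∀ x ∈ Ω, 0 ≤ κ0 x)
    (hl : ∀ x ∈ Ω, ∀ X, κ0 x * ‖X‖ ^ 2 ≤ leviForm ψ x X)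
    (hu : ContDiffOn ℝ 2 u0 Ω) (hc : 0 < c)
    (hα : ∀ x ∈ Ω, (∃ j, db (ee j) u0 x ≠ 0) → c ≤ κ0 x)
    (hi : IntegrableOn (fun x => ∑ j, ‖db (ee j) u0 x‖ ^ 2) Ω)
    {g : Fin n → FC} (hg : ∀ j, ContDiff ℝ 2 (g j)) (gc : ∀ j, HasCompactSupport (g j))
    (gs : ∀ j, tsupport (g j) ⊆ Ω) :
    ‖∫ x, ∑ j, db (ee j) u0 x * g j x‖ ^ 2 ≤
      (c⁻¹ * ∫ x in Ω, ∑ j, ‖db (ee j) u0 x‖ ^ 2) * (Real.exp M *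
        ∫ x, ‖∑ j, db (ee j) (g j) x‖ ^ 2) := by
  have oΩ := hΩ.1
  set K : SC := ⋃ j, tsupport (g j) with hK
  have Kk : IsCompact K := isCompact_iUnion fun j => gc j
  obtain ⟨r, hr, rc, rΩ, lr, rK⟩ := exhaustion hΩ Kk (iUnion_subset gs)
  obtain ⟨ψ', U1, cψ, oU1, sU1, -, eψ⟩ := glob rc oΩ rΩ hψ
  obtain ⟨u, U2, cu, oU2, sU2, -, eu⟩ := glob rc oΩ rΩ hu
  obtain ⟨χ, cχ, hχ, tχ, ⟨U3, -, sU3, -, eχ⟩, χ01⟩ := cut rc oΩ rΩ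
  set κ : FR := fun x => χ x * κ0 x with hκd
  have κs : tsupport κ ⊆ Ω := (tsupport_mul_subset_left).trans tχ
  have κc : Continuous κ := cont_tsupp oΩ (cχ.continuous.continuousOn.mul hκ) κs
  have κ0' : ∀ x, 0 ≤ κ x := fun x => by
    by_cases hx : x ∈ Ω
    · exact mul_nonneg (χ01 x).1 (hκ0 x hx)
    · rw [image_eq_zero_of_notMem_tsupport fun h => hx (κs h)]
  obtain ⟨M0, hM0⟩ := κc.bounded_above_of_compact_support (hχ.mul_right)
  have hM0' : ∀ x, κ x ≤ max M0 0 := fun x => ((le_abs_self _).trans (hM0 x)).trans (le_max_left _ _)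
  have cdr : Continuous fun x => ∑ j, ‖dz (ee j) (cx r) x‖ ^ 2 :=
    continuous_finsetSum _ fun j _ => (cont_dz ((cd_cx hr).of_le one_le_two) _).norm.pow 2
  obtain ⟨Cr, hCr⟩ := rc.exists_bound_of_continuousOn cdr.continuousOn
  have eκ : ∀ x, r x < 0 → κ x = κ0 x := fun x hx => by
    simp only [hκd]; rw [eχ x (sU3 hx.le), one_mul]
  have evu : ∀ x, r x < 0 → u =ᶠ[𝓝 x] u0 := fun x hx =>
    by filter_upwards [oU2.mem_nhds (sU2 hx.le)] with y hy using eu y hy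
  have S : Setup r ψ' κ (max Cr 0) (max M0 0) (64 * (243 * max Cr 0 + max M0 0)) :=
    { hr := hr, hc := rc, hlr := lr, hψ := cψ, hκ := κc, hκ0 := κ0', hκ1 := hM0'
      hlψ := fun x hx X => by
        rw [eκ x hx, levi_congr (show ψ' =ᶠ[𝓝 x] ψ from by
          filter_upwards [oU1.mem_nhds (sU1 hx.le)] with y hy using eψ y hy)]
        exact hl x (rΩ hx.le) X
      hCr := fun x hx => ((le_abs_self _).trans (hCr x hx)).trans (le_max_left _ _)
      hCr0 := le_max_right _ _, hM0 := le_max_right _ _, hK0 := le_rfl }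
  set v : Fin n → FC := fun j x => conj (g j x) * (Real.exp (ψ' x) : ℝ) with hv
  have ce : ContDiff ℝ 2 fun x => ((Real.exp (ψ' x) : ℝ) : ℂ) := cd_cx cψ.exp
  have cv : ∀ j, ContDiff ℝ 2 (v j) := fun j => (Complex.conjCLE.contDiff.comp (hg j)).mul ce
  have gz : ∀ j x, x ∉ tsupport (g j) → g j x = 0 := fun j x hx => image_eq_zero_of_notMem_tsupport hx
  have vc : ∀ j, HasCompactSupport (v j) := fun j => hcs_of (gc j) fun x hx => by simp [hv, gz j x hx]
  have vs : ∀ j, tsupport (v j) ⊆ {x | r x < -3} := fun j =>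
    (closure_minimal (fun x hx => by
      by_contra h; exact hx (by simp [hv, gz j x h])) (isClosed_tsupport (g j))).trans
      fun x hx => rK x (mem_iUnion.2 ⟨j, hx⟩)
  have ew : ∀ x, ((Real.exp (ψ' x) : ℝ) : ℂ) * wt ψ' x = 1 := fun x => by
    simp only [wt, cx]; rw [← Complex.ofReal_mul, ← Real.exp_add]; simp
  have key := apriori S (fun x hx => by rw [eψ x (sU1 hx.le)]; exact hψ0 x (rΩ hx.le)) cu hc
    (fun x hx ⟨j, hj⟩ => by
      rw [eκ x hx]; rw [db_congr (evu x hx)] at hj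
      exact hα x (rΩ hx.le) ⟨j, hj⟩) cv vc vs
  have e1 : ∫ x, (∑ j, conj (db (ee j) u x) * v j x) * wt ψ' x =
      conj (∫ x, ∑ j, db (ee j) u0 x * g j x) := by
    rw [← integral_conj]
    refine integral_congr_ae (.of_forall fun x => ?_)
    simp only [map_sum, map_mul, Finset.sum_mul]
    refine Finset.sum_congr rfl fun j _ => ?_
    by_cases hx : x ∈ tsupport (g j)
    · have := rK x (mem_iUnion.2 ⟨j, hx⟩)
      rw [db_congr (evu x (by linarith))]
      linear_combination conj (db (ee j) u0 x) * conj (g j x) * ew x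
    · simp [hv, gz j x hx]
  rw [e1, Complex.norm_conj] at key
  refine key.trans (mul_le_mul ?_ ?_ (integral_nonneg fun x => by positivity)
    (mul_nonneg (inv_pos.2 hc).le (integral_nonneg fun x => by positivity)))
  · refine mul_le_mul_of_nonneg_left ?_ (inv_pos.2 hc).le
    rw [setIntegral_congr_fun (g := fun x => ∑ j, ‖db (ee j) u0 x‖ ^ 2) S.op.measurableSet fun x hx => by
      simp only [db_congr (evu x hx)]]
    exact setIntegral_mono_set hi (.of_forall fun x => by positivity)
      (HasSubset.Subset.eventuallyLE fun x (hx : r x < 0) => rΩ hx.le)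
  · rw [← integral_const_mul]
    have cG : Continuous fun x => ∑ j, db (ee j) (g j) x :=
      continuous_finsetSum _ fun j _ => cont_db ((hg j).of_le one_le_two) _
    have zG : ∀ x, x ∉ K → ∑ j, db (ee j) (g j) x = 0 := fun x hx =>
      Finset.sum_eq_zero fun j _ => image_eq_zero_of_notMem_tsupport fun h =>
        hx (mem_iUnion.2 ⟨j, ts_db _ h⟩)
    refine integral_mono_of_nonneg (.of_forall fun x => by positivity)
      (Continuous.integrable_of_hasCompactSupport (continuous_const.mul (cG.norm.pow 2))
        (hcs_of Kk fun x hx => by simp [zG x hx])) (.of_forall fun x => ?_)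
    have e2 : (∑ j, dl ψ' (ee j) (v j) x) = conj (∑ j, db (ee j) (g j) x) * (Real.exp (ψ' x) : ℝ) := by
      rw [map_sum, Finset.sum_mul]
      refine Finset.sum_congr rfl fun j _ => ?_
      have h1 := dz_cE (cψ.differentiable two_ne_zero x) ((cv j).differentiable two_ne_zero x) (ee j)
      have h2 : (fun y => v j y * wt ψ' y) = fun y => conj (g j y) := by
        ext y; linear_combination conj (g j y) * ew y
      rw [h2, dz_conj ((hg j).differentiable two_ne_zero x)] at h1
      linear_combination -((Real.exp (ψ' x) : ℝ) : ℂ) * h1 - dl ψ' (ee j) (v j) x * ew x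
    simp only
    rw [e2, norm_mul, Complex.norm_conj, Complex.norm_real, Real.norm_of_nonneg (Real.exp_pos _).le]
    by_cases hx : x ∈ K
    · have hx3 := rK x hx
      have hM : ψ' x ≤ M := by rw [eψ x (sU1 (show r x ≤ 0 by linarith))]; exact hψM x (rΩ (show r x ≤ 0 by linarith))
      have e3 : Real.exp (ψ' x) * Real.exp (-ψ' x) = 1 := by rw [← Real.exp_add]; simp
      calc _ = ‖∑ j, db (ee j) (g j) x‖ ^ 2 * Real.exp (ψ' x) := by
            linear_combination ‖∑ j, db (ee j) (g j) x‖ ^ 2 * Real.exp (ψ' x) * e3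
        _ ≤ ‖∑ j, db (ee j) (g j) x‖ ^ 2 * Real.exp M := by gcongr
        _ = _ := mul_comm _ _
    · rw [zG x hx]; simp

lemma cs_int {α : Type*} [MeasurableSpace α] {μ : Measure α} {f g : α → ℂ} (hf : AEStronglyMeasurable f μ)
    (hg : AEStronglyMeasurable g μ) :
    ‖∫ x, f x * g x ∂μ‖ₑ ≤ eLpNorm f 2 μ * eLpNorm g 2 μ := by
  refine (enorm_integral_le_lintegral_enorm _).trans ?_
  rw [← eLpNorm_one_eq_lintegral_enorm]
  have := eLpNorm_smul_le_mul_eLpNorm (p := 2) (q := 2) (r := 1) hg hf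
  rwa [show f • g = fun x => f x * g x from rfl] at this

lemma hol_of_db {f : FC} {x : EC} (hf : DifferentiableAt ℝ f x)
    (h : ∀ j, db (ee j) f x = 0) : DifferentiableAt ℂ f x := by
  have h1 : ∀ j, fderiv ℝ f x (I • ee j) = I * fderiv ℝ f x (ee j) := by
    intro j
    have := h j
    simp only [db] at this
    linear_combination (-2 * I) * this + fderiv ℝ f x (I • ee j) * Complex.I_sq
  have h2 : ∀ (c : ℂ) j, fderiv ℝ f x (c • ee j) = c * fderiv ℝ f x (ee j) := by
    intro c j
    have : c • ee j = c.re • ee j + c.im • (I • ee j) := by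
      conv_lhs => rw [← Complex.re_add_im c]
      rw [add_smul, mul_smul]; rfl
    rw [this, map_add, map_smul, map_smul, h1]
    simp only [Complex.real_smul]
    linear_combination (fderiv ℝ f x (ee j)) * Complex.re_add_im c
  have h3 : ∀ w : EC, fderiv ℝ f x w = ∑ j, w j * fderiv ℝ f x (ee j) := by
    intro w
    conv_lhs => rw [sum_ee w]
    rw [map_sum]; exact Finset.sum_congr rfl fun j _ => h2 _ _
  rw [differentiableAt_iff_restrictScalars ℝ hf]
  refine ⟨⟨⟨⟨fderiv ℝ f x, map_add _⟩, fun c w => ?_⟩, (fderiv ℝ f x).continuous⟩, rfl⟩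
  simp only [RingHom.id_apply]
  rw [h3, h3, smul_eq_mul, Finset.mul_sum]
  refine Finset.sum_congr rfl fun j _ => ?_
  simp; ring

lemma db_of_hol {f : FC} {x : EC} (hf : DifferentiableAt ℂ f x) (X : EC) :
    db X f x = 0 := by
  have := hf.fderiv_restrictScalars ℝ
  simp only [db, this, ContinuousLinearMap.coe_restrictScalars', map_smul, smul_eq_mul]
  linear_combination (fderiv ℂ f x X / 2) * Complex.I_sq

lemma rot_int (c : ℂ) (hc : ‖c‖ = 1) (g : FC) : ∫ t, g (c • t) = ∫ t, g t := by
  have c0 : c ≠ 0 := by rintro rfl; simp at hc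
  let e : EC ≃ₗᵢ[ℝ] EC := ⟨(LinearEquiv.smulOfNeZero ℂ EC c c0).restrictScalars ℝ, fun x => by
    change ‖c • x‖ = ‖x‖
    rw [norm_smul, hc, one_mul]⟩
  exact e.measurePreserving.integral_comp e.toMeasurableEquiv.measurableEmbedding g

lemma mean_value {f : FC} {x : EC} {ε : ℝ} (h0 : 0 < ε)
    (hf : ∀ y ∈ closedBall x ε, DifferentiableAt ℂ f y) : mol ε f x = f x := by
  have hp : (0:ℝ) ≤ 2 * Real.pi := by positivity
  have mc := (mo_cd (n := n) ε).continuous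
  let G : EC → ℝ → ℂ := fun t θ => mo ε t • f (x - circleMap 0 1 θ • t)
  have nc : ∀ θ, ‖circleMap 0 1 θ‖ = 1 := fun θ => by simp
  have z : ∀ θ, mol ε f x = ∫ t in closedBall (0:EC) ε, G t θ := by
    intro θ
    rw [mol_eq, setIntegral_eq_integral_of_forall_compl_eq_zero,
      ← rot_int (circleMap 0 1 θ) (nc θ)]
    · refine integral_congr_ae (ae_of_all _ fun t => ?_)
      simp only [G]
      rw [mo_radial (show ‖circleMap 0 1 θ • t‖ = ‖t‖ by rw [norm_smul, nc, one_mul])]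
    · intro t ht
      simp only [G]
      rw [mo_zero h0.le (by simpa using (not_le.1 (fun h => ht (by simpa using h))).le), zero_smul]
  have mb : ∀ t ∈ closedBall (0:EC) ε, ∀ l : ℂ, ‖l‖ ≤ 1 → x - l • t ∈ closedBall x ε := by
    intro t ht l hl
    rw [mem_closedBall_zero_iff] at ht
    rw [mem_closedBall, dist_eq_norm, sub_sub_cancel_left, norm_neg, norm_smul]
    nlinarith [norm_nonneg l, norm_nonneg t]
  have cG : ContinuousOn (Function.uncurry G) (closedBall (0:EC) ε ×ˢ Icc 0 (2 * Real.pi)) := by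
    have cf : ContinuousOn f (closedBall x ε) := fun y hy => (hf y hy).continuousAt.continuousWithinAt
    simp only [G, Function.uncurry_def]
    refine (mc.comp continuous_fst).continuousOn.smul (cf.comp (Continuous.continuousOn ?_) ?_)
    · exact continuous_const.sub (((continuous_circleMap 0 1).comp continuous_snd).smul continuous_fst)
    · rintro ⟨t, θ⟩ ⟨ht, -⟩
      exact mb t ht _ (nc θ).le
  have iG : Integrable (Function.uncurry G) ((volume.restrict (closedBall (0:EC) ε)).prod
      (volume.restrict (Ioc 0 (2 * Real.pi)))) := by
    rw [Measure.prod_restrict]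
    exact (cG.integrableOn_compact ((isCompact_closedBall (0:EC) ε).prod
      isCompact_Icc)).mono_set (Set.prod_mono le_rfl Ioc_subset_Icc_self)
  have sw := integral_integral_swap iG
  have e1 : ∫ θ in Ioc 0 (2 * Real.pi), ∫ t in closedBall (0:EC) ε, G t θ =
      (2 * Real.pi : ℝ) • mol ε f x := by
    simp only [← z, integral_const]
    congr 1
    rw [measureReal_def, Measure.restrict_apply_univ, Real.volume_Ioc, sub_zero, ENNReal.toReal_ofReal hp]
  have e2 : ∀ t ∈ closedBall (0:EC) ε, ∫ θ in Ioc 0 (2 * Real.pi), G t θ = (2 * Real.pi) • (mo ε t • f x) := by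
    intro t ht
    have d : ∀ l ∈ closedBall (0:ℂ) 1, DifferentiableAt ℂ (fun l : ℂ => f (x - l • t)) l := fun l hl =>
      (hf _ (mb t ht l (by simpa using hl))).comp l (by fun_prop)
    have := circleAverage_of_differentiable_on_off_countable (f := fun l : ℂ => f (x - l • t)) (c := 0)
      (R := 1) countable_empty (fun l hl => (d l (by simpa using hl)).continuousAt.continuousWithinAt)
      (fun l hl => d l (ball_subset_closedBall (by simpa using hl.1)))
    simp only [Real.circleAverage, zero_smul, sub_zero] at this
    simp only [G]
    rw [integral_smul, ← intervalIntegral.integral_of_le hp, smul_comm, ← this, smul_inv_smul₀ bp]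
  rw [e1, setIntegral_congr_fun measurableSet_closedBall e2, integral_smul] at sw
  have := smul_right_injective ℂ (show (2 * Real.pi) ≠ 0 by positivity) sw
  rw [← this, integral_smul_const, setIntegral_eq_integral_of_forall_compl_eq_zero, mo_int h0, one_smul]
  intro t ht
  exact mo_zero h0.le (by simpa using (not_le.1 (fun h => ht (by simpa using h))).le)

lemma weyl {Ω : SC} (hΩ : IsOpen Ω) {h : FC} (hh : MemLp h 2)
    (hw : ∀ g : FC, ContDiff ℝ 2 g → HasCompactSupport g → tsupport g ⊆ Ω → ∀ j,
      ∫ x, h x * db (ee j) g x = 0) :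
    ∃ G : FC, DifferentiableOn ℂ G Ω ∧ ∀ᵐ x, x ∈ Ω → h x = G x := by
  have li := locint_of_memLp hh
  have hol : ∀ ε : ℝ, 0 < ε → ∀ x, closedBall x ε ⊆ Ω → DifferentiableAt ℂ (mol ε h) x := by
    intro ε h0 x hx
    refine hol_of_db ((mol_cd h0.le li).differentiable bn x) fun j => ?_
    rw [mol_db h0.le li, hw _ (moT_cd ε x) (moT_hcs h0.le x) ((moT_tsupp h0.le x).trans hx), neg_zero]
  have l2 := mol_L2 hh
  have lm : ∀ ε : ℝ, 0 < ε → ∀ x, closedBall x (2 * ε) ⊆ Ω →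
      Tendsto (fun e => mol e h x) (𝓝[>] 0) (𝓝 (mol ε h x)) := by
    intro ε h0 x hx
    rw [tendsto_iff_edist_tendsto_0]
    have b : ∀ᶠ e in 𝓝[>] (0:ℝ), edist (mol e h x) (mol ε h x) ≤
        (∫⁻ x, ‖mol e h x - h x‖ₑ ^ 2) ^ (1/2 : ℝ) * eLpNorm (moT ε x) 2 volume := by
      filter_upwards [Ioo_mem_nhdsGT h0] with e he
      have m1 := (mol_cd he.1.le li)
      rw [← mean_value h0 (f := mol e h), edist_eq_enorm_sub, mol_C, mol_C, ← integral_sub]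
      · simp only [← sub_mul]
        rw [eLp_sq (fun x => mol e h x - h x), ← ENNReal.rpow_natCast, ← ENNReal.rpow_mul]
        norm_num
        exact cs_int (m1.continuous.aestronglyMeasurable.sub hh.1)
          (moT_cd ε x).continuous.aestronglyMeasurable
      · exact li_mul m1.continuous.locallyIntegrable (moT_cd ε x).continuous (moT_hcs h0.le x)
      · exact li_mul li (moT_cd ε x).continuous (moT_hcs h0.le x)
      · intro y hy
        refine hol e he.1 y (subset_trans (fun w hw => ?_) hx)
        rw [mem_closedBall] at *
        linarith [dist_triangle w y x, he.2]
    refine tendsto_of_tendsto_of_tendsto_of_le_of_le' tendsto_const_nhds ?_ (Eventually.of_forall fun _ => zero_le) b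
    have mm : MemLp (moT ε x) 2 := (moT_cd ε x).continuous.memLp_of_hasCompactSupport (moT_hcs h0.le x)
    have := ENNReal.Tendsto.mul_const (b := eLpNorm (moT ε x) 2 volume)
      ((ENNReal.continuous_rpow_const (y := (1/2:ℝ))).continuousAt.tendsto.comp l2)
      (Or.inr mm.eLpNorm_ne_top)
    simpa using this
  have ex : ∀ x ∈ Ω, ∃ ε : ℝ, 0 < ε ∧ closedBall x (3 * ε) ⊆ Ω := by
    intro x hx
    obtain ⟨r, r0, hr⟩ := nhds_basis_closedBall.mem_iff.1 (hΩ.mem_nhds hx)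
    exact ⟨r / 3, by positivity, by rwa [mul_div_cancel₀ r bn]⟩
  have key : ∀ x ∈ Ω, ∃ ε : ℝ, 0 < ε ∧ closedBall x ε ⊆ Ω ∧ ∀ y ∈ ball x ε,
      Tendsto (fun e => mol e h y) (𝓝[>] 0) (𝓝 (mol ε h y)) := by
    intro x hx
    obtain ⟨ε, h0, hε⟩ := ex x hx
    refine ⟨ε, h0, (closedBall_subset_closedBall (by linarith)).trans hε, fun y hy => lm ε h0 y ?_⟩
    refine subset_trans (fun w hw => ?_) hε
    rw [mem_closedBall] at *; rw [mem_ball] at hy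
    linarith [dist_triangle w y x]
  refine ⟨fun x => limUnder (𝓝[>] (0:ℝ)) fun e => mol e h x, fun x hx => ?_, ?_⟩
  · obtain ⟨ε, h0, hε, hy⟩ := key x hx
    refine ((hol ε h0 x hε).congr_of_eventuallyEq ?_).differentiableWithinAt
    filter_upwards [ball_mem_nhds x h0] with y hb using (hy y hb).limUnder_eq
  · have cl : Tendsto (fun k : ℕ => 1 / ((k:ℝ) + 1)) atTop (𝓝[>] 0) :=
      tendsto_nhdsWithin_iff.2 ⟨tendsto_one_div_add_atTop_nhds_zero_nat,
        Eventually.of_forall fun k => by simp only [mem_Ioi]; positivity⟩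
    have tm : TendstoInMeasure volume (fun k : ℕ => mol (1 / ((k:ℝ) + 1)) h) atTop h := by
      refine tendstoInMeasure_of_tendsto_eLpNorm (p := 2) bn (fun k =>
        (mol_cd bp li).continuous.aestronglyMeasurable) hh.1 ?_
      have := (ENNReal.continuous_rpow_const (y := (1/2:ℝ))).continuousAt.tendsto.comp (l2.comp cl)
      simp only [ENNReal.zero_rpow_of_pos (show (0:ℝ) < 1/2 by norm_num)] at this
      refine this.congr fun k => ?_
      simp only [Function.comp]
      rw [eLp_sq (fun x => mol (1 / ((k:ℝ) + 1)) h x - h x), ← ENNReal.rpow_natCast, ← ENNReal.rpow_mul]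
      norm_num; rfl
    obtain ⟨s, hs, hae⟩ := tm.exists_seq_tendsto_ae
    filter_upwards [hae] with x hx hxΩ
    obtain ⟨ε, h0, hε, hy⟩ := key x hxΩ
    have t := hy x (mem_ball_self h0)
    rw [t.limUnder_eq]
    exact tendsto_nhds_unique hx (t.comp (cl.comp hs.tendsto_atTop))

lemma db_add {f g : FC} {x X : EC} (hf : DifferentiableAt ℝ f x)
    (hg : DifferentiableAt ℝ g x) : db X (fun y => f y + g y) x = db X f x + db X g x := by
  simp only [db, fderiv_fun_add hf hg, ContinuousLinearMap.add_apply]; ring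

lemma db_cmul {f : FC} {x X : EC} (hf : DifferentiableAt ℝ f x) (c : ℂ) :
    db X (fun y => c * f y) x = c * db X f x := by
  simp only [db, fderiv_const_mul hf, ContinuousLinearMap.smul_apply, smul_eq_mul]; ring

lemma int_sq {f : FC} (hf : MemLp f 2) : ∫ x, ‖f x‖ ^ 2 = (eLpNorm f 2 volume).toReal ^ 2 := by
  rw [integral_eq_lintegral_of_nonneg_ae (ae_of_all _ fun x => by positivity) (by exact hf.1.norm.pow 2),
    ← ENNReal.toReal_pow, ← eLp_sq]
  congr 2; ext x
  rw [ENNReal.ofReal_pow (norm_nonneg _), ofReal_norm]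

def fld (Ω : SC) : Submodule ℂ (Fin n → FC) where
  carrier := {g | ∀ j, ContDiff ℝ 2 (g j) ∧ ∃ K, IsCompact K ∧ K ⊆ Ω ∧ ∀ x, x ∉ K → g j x = 0}
  add_mem' := by
    intro a b ha hb j
    obtain ⟨h1, K, hK, hK', hz⟩ := ha j
    obtain ⟨h2, L, hL, hL', hw⟩ := hb j
    refine ⟨h1.add h2, K ∪ L, hK.union hL, union_subset hK' hL', fun x hx => ?_⟩
    rw [mem_union, not_or] at hx
    simp [hz x hx.1, hw x hx.2]
  zero_mem' := fun j => ⟨contDiff_const, ∅, isCompact_empty, empty_subset _, fun _ _ => rfl⟩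
  smul_mem' := by
    intro c a ha j
    obtain ⟨h1, K, hK, hK', hz⟩ := ha j
    exact ⟨h1.const_smul c, K, hK, hK', fun x hx => by simp [hz x hx]⟩

lemma dbar_rep {Ω : SC} (hΩ : IsOpen Ω) {u0 : FC} (hu : ContDiffOn ℝ 2 u0 Ω) {B : ℝ} (hB : 0 ≤ B)
    (hb : ∀ g : Fin n → FC, (∀ j, ContDiff ℝ 2 (g j)) → (∀ j, HasCompactSupport (g j)) →
      (∀ j, tsupport (g j) ⊆ Ω) → ‖∫ x, ∑ j, db (ee j) u0 x * g j x‖ ^ 2 ≤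
        B * ∫ x, ‖∑ j, db (ee j) (g j) x‖ ^ 2) :
    ∃ h : FC, MemLp h 2 ∧ ∫⁻ x, ‖h x‖ₑ ^ 2 ≤ ENNReal.ofReal B ∧
      ∀ g : FC, ContDiff ℝ 2 g → HasCompactSupport g → tsupport g ⊆ Ω → ∀ j,
        ∫ x, db (ee j) u0 x * g x = - ∫ x, h x * db (ee j) g x := by
  have gc : ∀ g : fld Ω, ∀ j, HasCompactSupport (g.1 j) := fun g j => by
    obtain ⟨-, K, hK, -, hz⟩ := g.2 j; exact HasCompactSupport.intro hK hz
  have gs : ∀ g : fld Ω, ∀ j, tsupport (g.1 j) ⊆ Ω := fun g j => by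
    obtain ⟨-, K, hK, h, hz⟩ := g.2 j
    refine subset_trans (closure_minimal (fun x hx => ?_) hK.isClosed) h
    by_contra hn; exact hx (hz x hn)
  have gd : ∀ g : fld Ω, ∀ j, Differentiable ℝ (g.1 j) := fun g j => (g.2 j).1.differentiable bn
  have mA : ∀ g : fld Ω, MemLp (fun x => ∑ j, db (ee j) (g.1 j) x) 2 := fun g =>
    memLp_finsetSum _ fun j _ => (cont_db ((g.2 j).1.of_le bn) _).memLp_of_hasCompactSupport
      (hcs_db (gc g j) _)
  have cu : ∀ j, ContinuousOn (db (ee j) u0) Ω := fun j => by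
    have := hu.continuousOn_fderiv_of_isOpen hΩ bn
    exact ((this.clm_apply continuousOn_const).add (continuousOn_const.mul
      (this.clm_apply continuousOn_const))).div_const 2
  have il : ∀ g : fld Ω, ∀ j, Integrable fun x => db (ee j) u0 x * g.1 j x := fun g j => by
    have ts : tsupport (fun x => db (ee j) u0 x * g.1 j x) ⊆ tsupport (g.1 j) :=
      closure_mono (Function.support_mul_subset_right _ _)
    exact (cont_tsupp hΩ ((cu j).mul (g.2 j).1.continuous.continuousOn)
      (ts.trans (gs g j))).integrable_of_hasCompactSupport (gc g j).mul_left
  let A : fld Ω →ₗ[ℂ] Lp ℂ 2 (volume : Measure EC) :=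
    { toFun := fun g => (mA g).toLp _
      map_add' := fun a b => by
        rw [← MemLp.toLp_add]
        refine MemLp.toLp_congr _ _ (ae_of_all _ fun x => ?_)
        simp only [Pi.add_apply, ← Finset.sum_add_distrib]
        exact Finset.sum_congr rfl fun j _ => db_add (gd a j x) (gd b j x)
      map_smul' := fun c a => by
        rw [RingHom.id_apply, ← MemLp.toLp_const_smul]
        refine MemLp.toLp_congr _ _ (ae_of_all _ fun x => ?_)
        simp only [Pi.smul_apply, smul_eq_mul, Finset.mul_sum]
        exact Finset.sum_congr rfl fun j _ => db_cmul (gd a j x) c }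
  let l : fld Ω →ₗ[ℂ] ℂ :=
    { toFun := fun g => ∫ x, ∑ j, db (ee j) u0 x * g.1 j x
      map_add' := fun a b => by
        rw [← integral_add (integrable_finsetSum _ fun j _ => il a j) (integrable_finsetSum _ fun j _ => il b j)]
        congr 1; ext x
        rw [← Finset.sum_add_distrib]
        exact Finset.sum_congr rfl fun j _ => mul_add _ _ _
      map_smul' := fun c a => by
        rw [RingHom.id_apply, ← integral_smul]
        congr 1; ext x
        rw [Finset.smul_sum]
        exact Finset.sum_congr rfl fun j _ => mul_left_comm _ _ _ }
  obtain ⟨u, hu1, hu2⟩ := hilb_rep A l (Real.sqrt_nonneg B) (fun g => by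
    refine abs_le_of_sq_le_sq' ?_ bp |>.2
    rw [mul_pow, Real.sq_sqrt hB]
    have := hb g.1 (fun j => (g.2 j).1) (gc g) (gs g)
    rw [int_sq (mA g), ← Lp.norm_toLp _ (mA g)] at this
    exact this)
  have hm : MemLp (fun x => conj (u x)) 2 := (Lp.memLp u).star
  refine ⟨fun x => - conj (u x), hm.neg, ?_, fun g hg hc ht j => ?_⟩
  · simp only [enorm_neg, RCLike.enorm_conj]
    rw [eLp_sq, ← ENNReal.ofReal_toReal (Lp.memLp u).eLpNorm_ne_top, ← Lp.norm_def,
      ← ENNReal.ofReal_pow (norm_nonneg _)]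
    refine ENNReal.ofReal_le_ofReal ((pow_le_pow_left₀ (norm_nonneg _) hu1 2).trans ?_)
    rw [Real.sq_sqrt hB]
  · have mem : (Pi.single j g : Fin n → FC) ∈ fld Ω := by
      intro i
      by_cases h : i = j
      · subst h; rw [Pi.single_eq_same]
        exact ⟨hg, tsupport g, hc, ht, fun x hx => image_eq_zero_of_notMem_tsupport hx⟩
      · rw [Pi.single_eq_of_ne h]
        exact ⟨contDiff_const, ∅, isCompact_empty, empty_subset _, fun _ _ => rfl⟩
    have := hu2 ⟨_, mem⟩
    have e1 : l ⟨_, mem⟩ = ∫ x, db (ee j) u0 x * g x := by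
      change ∫ x, ∑ i, db (ee i) u0 x * (Pi.single j g : Fin n → FC) i x = _
      congr 1; ext x
      rw [Finset.sum_eq_single j, Pi.single_eq_same]
      · intro i _ h; rw [Pi.single_eq_of_ne h]; simp
      · simp
    rw [e1, L2.inner_def] at this
    rw [this, ← integral_neg]
    refine integral_congr_ae ?_
    filter_upwards [(mA ⟨_, mem⟩).coeFn_toLp] with x hx
    have hx' : (A ⟨_, mem⟩) x = _ := hx
    rw [hx', RCLike.inner_apply, Finset.sum_eq_single j]
    · simp only [Pi.single_eq_same]; ring
    · intro i _ h
      simp only [Pi.single_eq_of_ne h]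
      simp [db, show (0 : FC) = fun _ => (0:ℂ) from rfl]
    · simp

lemma ibp_loc {Ω : SC} (hΩ : IsOpen Ω) {u g : FC} (hu : ContDiffOn ℝ 2 u Ω)
    (hg : ContDiff ℝ 2 g) (hc : HasCompactSupport g) (ht : tsupport g ⊆ Ω) (X : EC) :
    ∫ x, u x * db X g x = - ∫ x, db X u x * g x := by
  obtain ⟨v, U, hv, hU, hK, -, he⟩ := glob hc hΩ ht hu
  have := ibp_db X (hv.of_le bn) (hg.of_le bn) hc
  refine Eq.trans (integral_congr_ae (ae_of_all _ fun x => ?_)) (this.trans (congrArg _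
    (integral_congr_ae (ae_of_all _ fun x => ?_))))
  · by_cases hx : x ∈ tsupport g
    · simp only [he x (hK hx)]
    · have : db X g x = 0 := image_eq_zero_of_notMem_tsupport (fun h => hx (ts_db X h))
      simp only [this, mul_zero]
  · by_cases hx : x ∈ tsupport g
    · simp only [db_congr (show v =ᶠ[𝓝 x] u by
        filter_upwards [hU.mem_nhds (hK hx)] with y hy using he y hy)]
    · simp only [image_eq_zero_of_notMem_tsupport hx, mul_zero]

theorem dbar {Ω : SC} (hΩ : IsPseudoconvex Ω) {ψ κ0 : FR} {u0 : FC} {c M : ℝ}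
    (hψ : ContDiffOn ℝ 2 ψ Ω) (hψ0 : ∀ x ∈ Ω, 0 ≤ ψ x) (hψM : ∀ x ∈ Ω, ψ x ≤ M)
    (hκ : ContinuousOn κ0 Ω) (hκ0 : ∀ x ∈ Ω, 0 ≤ κ0 x)
    (hl : ∀ x ∈ Ω, ∀ X, κ0 x * ‖X‖ ^ 2 ≤ leviForm ψ x X)
    (hu : ContDiffOn ℝ 2 u0 Ω) (hc : 0 < c)
    (hα : ∀ x ∈ Ω, (∃ j, db (ee j) u0 x ≠ 0) → c ≤ κ0 x)
    (hi : IntegrableOn (fun x => ∑ j, ‖db (ee j) u0 x‖ ^ 2) Ω)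
    (h2 : MemLp (Ω.indicator u0) 2) :
    ∃ G : FC, DifferentiableOn ℂ G Ω ∧ ∫⁻ x in Ω, ‖G x - u0 x‖ₑ ^ 2 ≤
      ENNReal.ofReal (c⁻¹ * (∫ x in Ω, ∑ j, ‖db (ee j) u0 x‖ ^ 2) * Real.exp M) := by
  have B0 : 0 ≤ c⁻¹ * (∫ x in Ω, ∑ j, ‖db (ee j) u0 x‖ ^ 2) * Real.exp M := by
    have : 0 ≤ ∫ x in Ω, ∑ j, ‖db (ee j) u0 x‖ ^ 2 := integral_nonneg fun x => by positivity
    positivity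
  obtain ⟨h, hm, hb, he⟩ := dbar_rep hΩ.1 hu B0 (fun g hg gc gs =>
    (apriori2 hΩ hψ hψ0 hψM hκ hκ0 hl hu hc hα hi hg gc gs).trans_eq (by ring))
  obtain ⟨G, hG, ha⟩ := weyl hΩ.1 (h2.sub hm) (fun g hg gc gs j => by
    have c1 : Continuous (db (ee j) g) := cont_db (hg.of_le bn) _
    simp only [Pi.sub_apply, sub_mul]
    rw [integral_sub (li_mul (locint_of_memLp h2) c1 (hcs_db gc _)) (li_mul (locint_of_memLp hm) c1 (hcs_db gc _)),
      sub_eq_zero, ← neg_inj, ← he g hg gc gs j, neg_eq_iff_eq_neg, ← ibp_loc hΩ.1 hu hg gc gs]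
    congr 1; ext x
    by_cases hx : x ∈ Ω
    · rw [indicator_of_mem hx]
    · rw [image_eq_zero_of_notMem_tsupport (show x ∉ tsupport (db (ee j) g) from fun h => hx (gs (ts_db _ h)))]; simp)
  refine ⟨G, hG, le_trans ?_ hb⟩
  rw [setLIntegral_congr_fun_ae (g := fun x => ‖h x‖ₑ ^ 2) hΩ.1.measurableSet]
  · exact setLIntegral_le_lintegral _ _
  · filter_upwards [ha] with x hx hxΩ
    rw [← hx hxΩ, Pi.sub_apply, indicator_of_mem hxΩ, sub_sub_cancel_left, enorm_neg]

lemma hol_c2 {U : SC} (hU : IsOpen U) {f : FC} (hf : DifferentiableOn ℂ f U) :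
    ContDiffOn ℝ 2 f U := by
  intro x hx
  obtain ⟨r, r0, hr⟩ := nhds_basis_closedBall.mem_iff.1 (hU.mem_nhds hx)
  have li : LocallyIntegrable ((closedBall x r).indicator f) :=
    ((integrable_indicator_iff measurableSet_closedBall).2
      ((hf.continuousOn.mono hr).integrableOn_compact (isCompact_closedBall x r))).locallyIntegrable
  refine ((mol_cd (half_pos r0).le li).contDiffAt.congr_of_eventuallyEq ?_).contDiffWithinAt
  filter_upwards [ball_mem_nhds x (half_pos r0)] with y hy
  have sub : closedBall y (r/2) ⊆ ball x r := fun w hw => by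
    rw [mem_closedBall] at hw; rw [mem_ball] at *
    linarith [dist_triangle w y x]
  have m : ∀ w ∈ closedBall y (r/2), DifferentiableAt ℂ ((closedBall x r).indicator f) w := by
    intro w hw
    refine ((hf w (hr (ball_subset_closedBall (sub hw)))).differentiableAt
      (hU.mem_nhds (hr (ball_subset_closedBall (sub hw))))).congr_of_eventuallyEq ?_
    filter_upwards [isOpen_ball.mem_nhds (sub hw)] with v hv
    rw [indicator_of_mem (ball_subset_closedBall hv)]
  rw [mean_value (half_pos r0) m, indicator_of_mem]
  exact ball_subset_closedBall (sub (mem_closedBall_self (half_pos r0).le))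

lemma hol_at {U : SC} (hU : IsOpen U) {f : FC} (hf : DifferentiableOn ℂ f U) {x : EC}
    (hx : x ∈ U) : DifferentiableAt ℂ f x := (hf x hx).differentiableAt (hU.mem_nhds hx)

lemma hol_fd {U : SC} (hU : IsOpen U) {f : FC} (hf : DifferentiableOn ℂ f U) (Y : EC) :
    DifferentiableOn ℂ (fun w => fderiv ℂ f w Y) U := by
  intro x hx
  have c2 : ContDiffAt ℝ 2 f x := (hol_c2 hU hf x hx).contDiffAt (hU.mem_nhds hx)
  have ev : ∀ X, (fun w => fderiv ℂ f w X) =ᶠ[𝓝 x] fun w => fderiv ℝ f w X := fun X => by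
    filter_upwards [hU.mem_nhds hx] with w hw
    rw [(hol_at hU hf hw).fderiv_restrictScalars ℝ]; rfl
  have c1 : DifferentiableAt ℝ (fderiv ℝ f) x :=
    (c2.fderiv_right (m := 1) bn).differentiableAt bn
  refine ((hol_of_db (c1.clm_apply (differentiableAt_const Y)) fun j => ?_).congr_of_eventuallyEq
    (ev Y)).differentiableWithinAt
  have e2 : (fun w => fderiv ℝ f w (I • ee j)) =ᶠ[𝓝 x] fun w => I * fderiv ℝ f w (ee j) := by
    filter_upwards [ev (I • ee j), ev (ee j)] with w h1 h2
    rw [← h1, ← h2, map_smul, smul_eq_mul]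
  have e3 := e2.fderiv_eq (𝕜 := ℝ)
  have e4 := congrArg (fun L => L Y) e3
  simp only [fderiv_const_mul (c1.clm_apply (differentiableAt_const (ee j))), ContinuousLinearMap.smul_apply,
    smul_eq_mul, fd_fd c2] at e4
  simp only [db, fd_fd c2]
  rw [fd_symm c2 _ Y, fd_symm c2 _ Y, e4]
  linear_combination (fderiv ℝ (fderiv ℝ f) x Y (ee j) / 2) * Complex.I_sq

lemma lint_scale (g : EC → ℝ≥0∞) (w : EC) {s : ℝ} (hs : 0 < s) :
    ∫⁻ t, g (w + s • t) = ENNReal.ofReal ((s ^ Module.finrank ℝ EC)⁻¹) * ∫⁻ t, g t := by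
  have e1 : ∫⁻ t, g (w + s • t) = ∫⁻ t, g (w + t) ∂(Measure.map (s • · ) (volume : Measure EC)) :=
    ((measurableEmbedding_const_smul₀ hs.ne').lintegral_map fun t => g (w + t)).symm
  rw [e1, Measure.map_addHaar_smul _ hs.ne', lintegral_smul_measure, lintegral_add_left_eq_self,
    abs_of_pos bp, smul_eq_mul]

lemma sup_bound : ∃ K : ℝ, 0 < K ∧ ∀ (z : EC) (s : ℝ), 0 < s → s ≤ 1 → ∀ (f : FC) (N : ℝ), 0 ≤ N →
    DifferentiableOn ℂ f (ball z s) → ∫⁻ x in ball z s, ‖f x‖ₑ ^ 2 ≤ ENNReal.ofReal (N ^ 2) →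
    ∀ w ∈ ball z (s/2), s ^ Module.finrank ℝ EC * ‖f w‖ ≤ K * N := by
  have h0 : (0:ℝ) < 1/2 := by norm_num
  have mm : MemLp (moT (1/2) (0 : EC)) 2 :=
    (moT_cd _ _).continuous.memLp_of_hasCompactSupport (moT_hcs h0.le _)
  refine ⟨(eLpNorm (moT (1/2) (0 : EC)) 2 volume).toReal + 1, by positivity, ?_⟩
  intro z s s0 s1 f N N0 hf hN w hw
  rw [mem_ball] at hw
  set d := Module.finrank ℝ EC
  have mb : ∀ t : EC, ‖t‖ ≤ 1/2 → w + s • t ∈ ball z s := fun t ht => by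
    rw [mem_ball]
    have : dist (w + s • t) w = s * ‖t‖ := by
      rw [dist_eq_norm, add_sub_cancel_left, norm_smul, Real.norm_of_nonneg s0.le]
    nlinarith [dist_triangle (w + s • t) w z]
  have sm : (fun t : EC => w + s • t) = fun t => w + (s : ℂ) • t := rfl
  have mv := mean_value (x := (0 : EC)) h0 (f := fun t => f (w + s • t)) (fun t ht => by
    refine DifferentiableAt.comp (𝕜 := ℂ) t (hol_at isOpen_ball hf (mb t (by simpa using ht))) ?_
    rw [sm]; fun_prop)
  rw [mol_C, smul_zero, add_zero, ← setIntegral_eq_integral_of_forall_compl_eq_zero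
    (s := closedBall (0:EC) (1/2))] at mv
  swap
  · intro t ht; rw [moT_zero h0.le ht, mul_zero]
  have cf : ContinuousOn (fun t => f (w + s • t)) (closedBall (0:EC) (1/2)) :=
    hf.continuousOn.comp (by fun_prop) fun t ht => mb t (by simpa using ht)
  have b1 := cs_int (μ := volume.restrict (closedBall (0:EC) (1/2)))
    (cf.aestronglyMeasurable measurableSet_closedBall)
    (g := moT (1/2) 0) (moT_cd (1/2) (0:EC)).continuous.aestronglyMeasurable
  rw [mv] at b1
  have b2 : eLpNorm (fun t => f (w + s • t)) 2 (volume.restrict (closedBall (0:EC) (1/2))) ^ 2 ≤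
      ENNReal.ofReal (((s ^ d)⁻¹ * N) ^ 2) := by
    rw [← eLpNorm_indicator_eq_eLpNorm_restrict measurableSet_closedBall, ← eLp_sq]
    calc _ ≤ ∫⁻ t, (fun x => (ball z s).indicator (fun x => ‖f x‖ₑ ^ 2) x) (w + s • t) := by
          refine lintegral_mono fun t => ?_
          by_cases ht : t ∈ closedBall (0:EC) (1/2)
          · rw [indicator_of_mem ht]; simp only
            rw [indicator_of_mem (mb t (by simpa using ht))]
          · rw [indicator_of_notMem ht]; simp
      _ ≤ ENNReal.ofReal ((s ^ d)⁻¹) * ENNReal.ofReal (N ^ 2) := by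
          rw [lint_scale _ _ s0, lintegral_indicator measurableSet_ball]; gcongr
      _ ≤ _ := by
          rw [← ENNReal.ofReal_mul bp]
          refine ENNReal.ofReal_le_ofReal ?_
          have : (1:ℝ) ≤ (s ^ d)⁻¹ := (one_le_inv₀ bp).2 (pow_le_one₀ s0.le s1)
          rw [mul_pow]
          exact mul_le_mul_of_nonneg_right (by nlinarith) bp
  rw [ENNReal.ofReal_pow bp, ENNReal.pow_le_pow_left_iff two_ne_zero] at b2
  have b3 : ‖f w‖ ≤ ((s ^ d)⁻¹ * N) * (eLpNorm (moT (1/2) (0 : EC)) 2 volume).toReal := by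
    rw [← ENNReal.ofReal_le_ofReal_iff bp, ofReal_norm, ENNReal.ofReal_mul bp,
      ENNReal.ofReal_toReal mm.eLpNorm_ne_top]
    exact b1.trans (mul_le_mul' b2 (eLpNorm_mono_measure _ Measure.restrict_le_self))
  have sd : 0 < s ^ d := by positivity
  calc s ^ d * ‖f w‖ ≤ s ^ d * (((s ^ d)⁻¹ * N) * (eLpNorm (moT (1/2) (0 : EC)) 2 volume).toReal) := by gcongr
    _ = (eLpNorm (moT (1/2) (0 : EC)) 2 volume).toReal * N := by field_simp
    _ ≤ _ := by nlinarith

lemma line_cauchy {f : FC} {z : EC} {s B : ℝ} (hs : 0 < s) (hf : DifferentiableOn ℂ f (ball z (2 * s)))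
    (hb : ∀ w ∈ ball z (2 * s), ‖f w‖ ≤ B) {w : EC} (hw : w ∈ ball z s) (X : EC) :
    s * ‖fderiv ℂ f w X‖ ≤ 2 * B * ‖X‖ := by
  rw [mem_ball] at hw
  by_cases hX : X = 0
  · simp [hX]
  have X0 : 0 < ‖X‖ := norm_pos_iff.2 hX
  have mb : ∀ l : ℂ, ‖l‖ ≤ s / (2 * ‖X‖) → w + l • X ∈ ball z (2 * s) := fun l hl => by
    rw [mem_ball]
    have : dist (w + l • X) w = ‖l‖ * ‖X‖ := by rw [dist_eq_norm, add_sub_cancel_left, norm_smul]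
    have h2 : ‖l‖ * ‖X‖ ≤ s / 2 := (mul_le_mul_of_nonneg_right hl X0.le).trans_eq (by field_simp)
    linarith [dist_triangle (w + l • X) w z]
  have r0 : 0 < s / (2 * ‖X‖) := by positivity
  have d : ∀ l ∈ closedBall (0:ℂ) (s / (2 * ‖X‖)), HasDerivAt (fun l : ℂ => f (w + l • X))
      (fderiv ℂ f (w + l • X) X) l := fun l hl => by
    have := (hol_at isOpen_ball hf (mb l (by simpa using hl))).hasFDerivAt.comp_hasDerivAt l
      (((hasDerivAt_id l).smul_const X).const_add w)
    exact HasDerivAt.congr_deriv this (by simp)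
  have := Complex.norm_deriv_le_of_forall_mem_sphere_norm_le (f := fun l : ℂ => f (w + l • X)) (c := 0) r0
    (DifferentiableOn.diffContOnCl (by
      rw [closure_ball _ r0.ne']
      exact fun l hl => (d l hl).differentiableAt.differentiableWithinAt))
    (fun l hl => hb _ (mb l (by rw [mem_sphere_zero_iff_norm] at hl; exact hl.le)))
  rw [(d 0 (by simp [r0.le])).deriv, zero_smul, add_zero, le_div_iff₀ r0] at this
  calc s * ‖fderiv ℂ f w X‖ = (‖fderiv ℂ f w X‖ * (s / (2 * ‖X‖))) * (2 * ‖X‖) := by field_simp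
    _ ≤ B * (2 * ‖X‖) := by gcongr
    _ = _ := by ring

def D2 (f : FC) (z X Y : EC) : ℂ := fderiv ℂ (fun w => fderiv ℂ f w Y) z X

lemma cauchy : ∃ K : ℝ, 0 < K ∧ ∀ (z : EC) (s : ℝ), 0 < s → s ≤ 1 → ∀ (f : FC) (N : ℝ), 0 ≤ N →
    DifferentiableOn ℂ f (ball z s) → ∫⁻ x in ball z s, ‖f x‖ₑ ^ 2 ≤ ENNReal.ofReal (N ^ 2) →
    s ^ (Module.finrank ℝ EC + 2) * ‖f z‖ ≤ K * N ∧
    (∀ X, s ^ (Module.finrank ℝ EC + 2) * ‖fderiv ℂ f z X‖ ≤ K * N * ‖X‖) ∧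
    ∀ X Y, s ^ (Module.finrank ℝ EC + 2) * ‖D2 f z X Y‖ ≤ K * N * ‖X‖ * ‖Y‖ := by
  obtain ⟨K, K0, hK⟩ := sup_bound (n := n)
  refine ⟨128 * K, by positivity, fun z s s0 s1 f N N0 hf hN => ?_⟩
  have sb := hK z s s0 s1 f N N0 hf hN
  set d := Module.finrank ℝ EC
  have sd : 0 < s ^ d := by positivity
  have b1 : ∀ w ∈ ball z (2 * (s/4)), ‖f w‖ ≤ K * N / s ^ d := fun w hw => by
    rw [le_div_iff₀' sd]; exact sb w (by convert hw using 1; ring)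
  have f1 : DifferentiableOn ℂ f (ball z (2 * (s/4))) := hf.mono (ball_subset_ball (by linarith))
  have b2 : ∀ Y, ∀ w ∈ ball z (s/4), ‖fderiv ℂ f w Y‖ ≤ 8 * (K * N / s ^ d) * ‖Y‖ / s := fun Y w hw => by
    rw [le_div_iff₀' s0]
    have := line_cauchy bp f1 b1 hw Y
    linarith
  have b3 : ∀ X Y, s/8 * ‖D2 f z X Y‖ ≤ 2 * (8 * (K * N / s ^ d) * ‖Y‖ / s) * ‖X‖ := fun X Y =>
    line_cauchy (s := s/8) bp ((hol_fd isOpen_ball hf Y).mono (ball_subset_ball (by linarith)))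
      (fun w hw => b2 Y w (by convert hw using 1; ring)) (mem_ball_self bp) X
  have s2 : s ^ 2 ≤ 1 := pow_le_one₀ s0.le s1
  refine ⟨?_, fun X => ?_, fun X Y => ?_⟩
  · have := sb z (mem_ball_self bp)
    rw [pow_add]
    nlinarith [mul_nonneg K0.le N0, mul_nonneg sd.le (norm_nonneg (f z))]
  · have := b2 X z (mem_ball_self bp)
    calc s ^ (d + 2) * ‖fderiv ℂ f z X‖ ≤ s ^ (d + 2) * (8 * (K * N / s ^ d) * ‖X‖ / s) := by gcongr
      _ = (8 * (K * N) * ‖X‖) * s := by field_simp; ring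
      _ ≤ (8 * (K * N) * ‖X‖) * 1 := by gcongr
      _ ≤ _ := by nlinarith [mul_nonneg (mul_nonneg K0.le N0) (norm_nonneg X)]
  · have h := b3 X Y
    calc s ^ (d + 2) * ‖D2 f z X Y‖ = (8 * s ^ (d + 1)) * (s / 8 * ‖D2 f z X Y‖) := by ring
      _ ≤ (8 * s ^ (d + 1)) * (2 * (8 * (K * N / s ^ d) * ‖Y‖ / s) * ‖X‖) := by gcongr
      _ = _ := by field_simp; ring

lemma taylor22 {f : FR} {x : EC} (hf : ContDiffAt ℝ 2 f x) {c : ℝ} (hc : 0 < c) :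
    ∃ d > 0, ∀ z ∈ ball x d, ∀ w ∈ ball x d,
      |f w - f z - fderiv ℝ f z (w - z) - (1/2) * fderiv ℝ (fderiv ℝ f) x (w - z) (w - z)|
        ≤ c * ‖w - z‖ ^ 2 := by
  have h1 := ((hf.fderiv_right (m := 1) bn).hasStrictFDerivAt bn).isLittleO
  have h2 := (Asymptotics.isLittleO_iff.1 h1) hc
  obtain ⟨d1, hd1, hdd⟩ := Metric.eventually_nhds_iff.1 h2
  obtain ⟨d2, hd2, hd⟩ := Metric.eventually_nhds_iff.1 (ev_cd hf)
  refine ⟨min d1 d2, by positivity, fun z hz w hw => ?_⟩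
  set S := fderiv ℝ (fderiv ℝ f) x
  let G : FR := fun y => f y - fderiv ℝ f z (y - z) - (1/2) * S (y - z) (y - z)
  have hG : ∀ y, y ∈ ball x (min d1 d2) →
      HasFDerivAt G (fderiv ℝ f y - fderiv ℝ f z - S (y - z)) y := by
    intro y hy
    have d0 : DifferentiableAt ℝ f y := hd (lt_of_lt_of_le (mem_ball.1 hy) (min_le_right _ _))
    have i1 : HasFDerivAt (fun y => y - z) (ContinuousLinearMap.id ℝ EC) y :=
      (hasFDerivAt_id y).sub_const z
    have a2 : HasFDerivAt (fun y => S (y - z) (y - z)) (S (y - z) + S.flip (y - z)) y := by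
      have := (S.hasFDerivAt.comp y i1).clm_apply i1
      refine this.congr_fderiv ?_
      ext z; simp
    refine ((d0.hasFDerivAt.sub ((fderiv ℝ f z).hasFDerivAt.comp y i1)).sub
      (a2.const_mul (1/2))).congr_fderiv ?_
    ext v
    simp only [sub_apply, smul_apply, add_apply, ContinuousLinearMap.flip_apply, smul_eq_mul,
      ContinuousLinearMap.comp_apply, ContinuousLinearMap.id_apply]
    rw [show S v (y - z) = S (y - z) v from fd_symm hf _ _]; ring
  have hseg : segment ℝ z w ⊆ ball x (min d1 d2) := (convex_ball _ _).segment_subset hz hw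
  have key := Convex.norm_image_sub_le_of_norm_hasFDerivWithin_le (𝕜 := ℝ) (f := G)
    (s := segment ℝ z w) (C := c * ‖w - z‖) (x := z) (y := w)
    (f' := fun y => fderiv ℝ f y - fderiv ℝ f z - S (y - z))
    (fun y hy => (hG y (hseg hy)).hasFDerivWithinAt)
    (fun y hy => by
      have := @hdd (y, z) (by
        rw [Prod.dist_eq]
        exact max_lt (lt_of_lt_of_le (mem_ball.1 (hseg hy)) (min_le_left _ _))
          (lt_of_lt_of_le (mem_ball.1 hz) (min_le_left _ _)))
      refine this.trans (mul_le_mul_of_nonneg_left ?_ hc.le)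
      obtain ⟨a, b, ha, hb, hab, rfl⟩ := hy
      have e : a • z + b • w - z = b • (w - z) := by
        rw [show a = 1 - b by linarith]; module
      simp only [e]
      rw [norm_smul, Real.norm_of_nonneg hb]
      nlinarith [norm_nonneg (w - z)]) (convex_segment _ _) (left_mem_segment _ _ _)
      (right_mem_segment _ _ _)
  simp only [G, sub_self, sub_zero, map_zero, mul_zero] at key
  rw [Real.norm_eq_abs] at key
  rw [pow_two, ← mul_assoc]
  convert key using 2
  ring

def Pol (L : EC →L[ℝ] ℝ) (S : EC →L[ℝ] EC →L[ℝ] ℝ) (h : EC) : ℂ :=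
  (L h : ℂ) - I * (L (I • h) : ℝ) + ((S h h : ℝ) - (S (I • h) (I • h) : ℝ) - 2 * I * (S h (I • h) : ℝ)) / 4

lemma pol_hol (L : EC →L[ℝ] ℝ) (S : EC →L[ℝ] EC →L[ℝ] ℝ) (hS : ∀ X Y, S X Y = S Y X)
    (z : EC) : Differentiable ℂ (fun w => Pol L S (w - z)) := by
  intro w
  let J : EC →L[ℝ] EC := (I • ContinuousLinearMap.id ℂ EC).restrictScalars ℝ
  have hJ : ∀ h, J h = I • h := fun h => by simp [J]
  have i1 : HasFDerivAt (fun y => y - z) (ContinuousLinearMap.id ℝ EC) w :=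
    (hasFDerivAt_id w).sub_const z
  have i2 : HasFDerivAt (fun y => I • (y - z)) J w := by
    have := (J.hasFDerivAt (x := w - z)).comp w i1
    refine (this.congr_fderiv (by ext; simp)).congr_of_eventuallyEq (Eventually.of_forall fun y => ?_)
    simp [hJ]
  have of : ∀ {f : FR} {f' : EC →L[ℝ] ℝ}, HasFDerivAt f f' w →
      HasFDerivAt (fun y => ((f y : ℝ) : ℂ)) (Complex.ofRealCLM.comp f') w := fun h =>
    Complex.ofRealCLM.hasFDerivAt.comp w h
  have l1 := of (L.hasFDerivAt.comp w i1)
  have l2 := of (L.hasFDerivAt.comp w i2)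
  have s1 := of ((S.hasFDerivAt.comp w i1).clm_apply i1)
  have s2 := of ((S.hasFDerivAt.comp w i2).clm_apply i2)
  have s3 := of ((S.hasFDerivAt.comp w i1).clm_apply i2)
  have hP := (l1.sub (l2.const_mul I)).add (((s1.sub s2).sub (s3.const_mul (2 * I))).mul_const (4⁻¹ : ℂ))
  have hP' : HasFDerivAt (fun w => Pol L S (w - z)) _ w :=
    hP.congr_of_eventuallyEq (Eventually.of_forall fun y => by simp [Pol, div_eq_mul_inv])
  refine hol_of_db hP'.differentiableAt fun j => ?_
  unfold db
  rw [hP'.fderiv]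
  have e1 : ∀ X : EC, L (I • I • X) = - L X := fun X => by
    rw [smul_smul, Complex.I_mul_I, neg_one_smul, map_neg]
  have e2 : ∀ X Y : EC, S Y (I • I • X) = - S Y X := fun X Y => by
    rw [smul_smul, Complex.I_mul_I, neg_one_smul, map_neg]
  simp only [add_apply, sub_apply, smul_apply, ContinuousLinearMap.comp_apply, hJ, smul_eq_mul,
    ContinuousLinearMap.id_apply, Complex.ofRealCLM_apply, ContinuousLinearMap.flip_apply,
    Function.comp_apply, e1, e2]
  generalize ee j = X
  generalize w - z = h
  rw [hS (I • X) h, hS (I • I • X), hS X h, hS X (I • h), hS (I • X) (I • h), e2]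
  simp [Complex.ext_iff]
  constructor <;> ring

lemma sph {K : SC} (hK : IsCompact K) {q g : FR} (hq : Continuous q)
    (hg : Continuous g) (g0 : ∀ x, 0 ≤ g x) (h : ∀ x ∈ K, g x = 0 → 0 < q x) :
    ∃ A c : ℝ, 0 ≤ A ∧ 0 < c ∧ ∀ x ∈ K, c ≤ q x + A * g x := by
  have hK' : IsCompact (K ∩ {x | q x ≤ 0}) := hK.inter_right (isClosed_le hq continuous_const)
  obtain ⟨m, hm, hm'⟩ := hK'.exists_forall_le' hg.continuousOn (a := 0) (fun x hx =>
    lt_of_le_of_ne (g0 x) fun e => absurd (h x hx.1 e.symm) (not_lt.2 hx.2))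
  obtain ⟨M, hM⟩ := (hK.image hq).bddBelow
  have hA : (0:ℝ) ≤ (|M| + 1) / m := by positivity
  obtain ⟨c, hc, hc'⟩ := hK.exists_forall_le' (f := fun x => q x + (|M| + 1) / m * g x) (a := 0)
    (by fun_prop) (fun x hx => by
      rcases le_or_gt (q x) 0 with hx0 | hx0
      · have h1 := hm' x ⟨hx, hx0⟩
        have h2 : M ≤ q x := hM ⟨x, hx, rfl⟩
        have h3 : |M| + 1 ≤ (|M| + 1) / m * g x := by
          rw [div_mul_eq_mul_div, le_div_iff₀ hm]; gcongr
        have := neg_abs_le M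
        linarith
      · have := mul_nonneg hA (g0 x)
        linarith)
  exact ⟨_, c, hA, hc, hc'⟩

lemma ev_levi {r : FR} {p : EC} (hr : ContDiffAt ℝ 2 r p) {c : ℝ} (hc : 0 < c)
    (h : ∀ X, 2 * c * ‖X‖ ^ 2 ≤ leviForm r p X) :
    ∀ᶠ w in 𝓝 p, ∀ X, c * ‖X‖ ^ 2 ≤ leviForm r w X := by
  have h1 : ContinuousAt (fderiv ℝ (fderiv ℝ r)) p :=
    ((hr.fderiv_right (m := 1) bn).fderiv_right (m := 0) bn).continuousAt
  have h2 := hr.eventually bn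
  have h3 : ∀ᶠ w in 𝓝 p, ‖fderiv ℝ (fderiv ℝ r) w - fderiv ℝ (fderiv ℝ r) p‖ < c :=
    have h4 : ContinuousAt (fun w => ‖fderiv ℝ (fderiv ℝ r) w - fderiv ℝ (fderiv ℝ r) p‖) p :=
      ContinuousAt.norm (E := EC →L[ℝ] EC →L[ℝ] ℝ) (h1.sub continuousAt_const)
    h4.eventually_lt_const (by beta_reduce; rw [sub_self]; exact (norm_zero (E := EC →L[ℝ] EC →L[ℝ] ℝ)).trans_lt hc)
  filter_upwards [h2, h3] with w hw hd X
  have hh := h X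
  rw [levi_eq hw]
  rw [levi_eq hr] at hh
  have b : ∀ Y : EC, ‖Y‖ = ‖X‖ → fderiv ℝ (fderiv ℝ r) p Y Y - c * ‖X‖ ^ 2 ≤
      fderiv ℝ (fderiv ℝ r) w Y Y := by
    intro Y hY
    have := (ContinuousLinearMap.le_opNorm₂ (fderiv ℝ (fderiv ℝ r) w - fderiv ℝ (fderiv ℝ r) p) Y Y)
    rw [hY] at this
    have h3 : |fderiv ℝ (fderiv ℝ r) w Y Y - fderiv ℝ (fderiv ℝ r) p Y Y| ≤ c * ‖X‖ ^ 2 := by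
      refine this.trans ?_
      rw [mul_assoc, ← pow_two]; gcongr
    linarith [(abs_le.1 h3).1]
  have b1 := b X rfl
  have b2 := b (I • X) (by simp [norm_smul])
  nlinarith [sq_nonneg ‖X‖]

lemma geom {Ω : SC} {p : EC} (hΩ : IsOpen Ω) (hp : IsStrictPscPtC2 Ω p)
    {V : SC} (hV : V ∈ 𝓝 p) :
    ∃ R > 0, R ≤ 1 ∧ ball p R ⊆ V ∧ ∃ (r : FR) (P : EC → FC) (c Lp : ℝ), 0 < c ∧
      1 ≤ Lp ∧ ContDiffOn ℝ 2 r (ball p R) ∧ r p = 0 ∧ (∀ w ∈ ball p R, w ∈ Ω ↔ r w < 0) ∧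
      (∀ w ∈ ball p R, ∀ X, c * ‖X‖ ^ 2 ≤ leviForm r w X) ∧
      (∀ w ∈ ball p R, ∀ z ∈ ball p R, |r w - r z| ≤ Lp * ‖w - z‖) ∧
      (∀ z, Differentiable ℂ (P z)) ∧ (∀ z, P z z = 0) ∧
      ∀ z ∈ ball p R, ∀ w ∈ ball p R, (P z w).re ≤ r w - r z - c * ‖w - z‖ ^ 2 ∧ ‖P z w‖ ≤ Lp := by
  obtain ⟨hpf, W, hW, hpW, ρ, hρ, hΩW, -, hlev⟩ := hp
  have hρp : ContDiffAt ℝ 2 ρ p := hρ.contDiffAt (hW.mem_nhds hpW)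
  have hiff : ∀ w ∈ W, (w ∈ Ω ↔ ρ w < 0) := fun w hw => by
    have := Set.ext_iff.1 hΩW w
    simp only [mem_inter_iff, mem_setOf_eq] at this
    tauto
  have hp0 : ρ p = 0 := by
    refine le_antisymm (le_of_not_gt fun h => ?_) (le_of_not_gt fun h => ?_)
    · have h1 : ∀ᶠ w in 𝓝 p, 0 < ρ w ∧ w ∈ W :=
        (hρp.continuousAt.eventually_const_lt h).and (hW.mem_nhds hpW)
      obtain ⟨w, hw, hw'⟩ := mem_closure_iff_nhds.1 hpf.1 _ h1
      exact absurd ((hiff w hw.2).1 hw') (not_lt.2 hw.1.le)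
    · rw [hΩ.frontier_eq] at hpf
      exact hpf.2 ((hiff p hpW).2 h)
  obtain ⟨A, c0, hA, hc0, hAc⟩ := sph (isCompact_sphere (0 : EC) 1)
    (q := fun X => (fderiv ℝ (fderiv ℝ ρ) p X X + fderiv ℝ (fderiv ℝ ρ) p (I • X) (I • X)) / 4)
    (g := fun X => (fderiv ℝ ρ p X) ^ 2 + (fderiv ℝ ρ p (I • X)) ^ 2)
    (by fun_prop) (by fun_prop) (fun x => by positivity) (fun X hX hg => by
      have hX0 : X ≠ 0 := by rintro rfl; simp at hX
      have h1 : fderiv ℝ ρ p X = 0 := by nlinarith [sq_nonneg (fderiv ℝ ρ p X), sq_nonneg (fderiv ℝ ρ p (I • X))]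
      have h2 : fderiv ℝ ρ p (I • X) = 0 := by nlinarith [sq_nonneg (fderiv ℝ ρ p X), sq_nonneg (fderiv ℝ ρ p (I • X))]
      have := hlev p ⟨hpf, hpW⟩ X hX0 (by simp [cderiv, h1, h2])
      rwa [levi_eq hρp] at this)
  let cc : ℝ → ℝ := fun t => t + 2 * A * t ^ 2
  have hcc : ContDiff ℝ 2 cc := by fun_prop
  let r : FR := fun w => cc (ρ w)
  have hr : ContDiffOn ℝ 2 r W := hcc.comp_contDiffOn hρ
  have hrp : ContDiffAt ℝ 2 r p := hr.contDiffAt (hW.mem_nhds hpW)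
  have d1 : deriv cc = fun t => 1 + 4 * A * t := by
    ext t
    have := ((hasDerivAt_id t).add (((hasDerivAt_id t).pow 2).const_mul (2 * A)))
    rw [show cc = _ from rfl]
    refine (this.congr_deriv ?_).deriv
    simp; ring
  have d2 : deriv (deriv cc) 0 = 4 * A := by
    rw [d1]
    refine ((((hasDerivAt_id (0:ℝ)).const_mul (4 * A)).const_add 1).congr_deriv ?_).deriv
    simp
  have hL : ∀ X, c0 * ‖X‖ ^ 2 ≤ leviForm r p X := by
    intro X
    have e1 : leviForm r p X = (fderiv ℝ (fderiv ℝ ρ) p X X + fderiv ℝ (fderiv ℝ ρ) p (I • X) (I • X)) / 4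
        + A * ((fderiv ℝ ρ p X) ^ 2 + (fderiv ℝ ρ p (I • X)) ^ 2) := by
      rw [show r = fun y => cc (ρ y) from rfl, levi_comp hρp hcc.contDiffAt, hp0, d2, d1, levi_eq hρp]
      ring
    rcases eq_or_ne X 0 with rfl | hX
    · rw [e1]; simp
    · have hn : ‖X‖ ≠ 0 := norm_ne_zero_iff.2 hX
      have := hAc (‖X‖⁻¹ • X) (by simp [norm_smul, hn])
      rw [e1]
      have e2 : I • (‖X‖⁻¹ • X) = ‖X‖⁻¹ • (I • X) := smul_comm _ _ _
      simp only [e2, map_smul, smul_apply, smul_eq_mul] at this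
      have h3 := mul_le_mul_of_nonneg_right this (sq_nonneg ‖X‖)
      refine h3.trans (le_of_eq ?_)
      field_simp
  set S := fderiv ℝ (fderiv ℝ r) p with hS
  have hSs : ∀ X Y, S X Y = S Y X := fun X Y => fd_symm hrp X Y
  obtain ⟨dT, hdT, hT⟩ := taylor22 hrp (c := c0 / 2) bp
  have hlv := ev_levi hrp (c := c0 / 2) bp (fun X => by have := hL X; linarith)
  obtain ⟨K, s, hs, hlip⟩ := (hrp.of_le (by norm_num : (1 : WithTop ℕ∞) ≤ 2)).exists_lipschitzOnWith
  have hfb : ∀ᶠ w in 𝓝 p, ‖fderiv ℝ r w‖ ≤ ‖fderiv ℝ r p‖ + 1 := by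
    have h1 : ContinuousAt (fun w => ‖fderiv ℝ r w‖) p :=
      (hrp.fderiv_right (m := 1) bn).continuousAt.norm
    exact (h1.eventually_lt_const (lt_add_one _)).mono fun _ h => h.le
  have hsg : ∀ᶠ w in 𝓝 p, -1 < 2 * A * ρ w := by
    have h1 : ContinuousAt (fun w => 2 * A * ρ w) p := continuousAt_const.mul hρp.continuousAt
    exact h1.eventually_const_lt (by simp [hp0])
  have hall := ((hlv.and hfb).and hsg).and ((hW.eventually_mem hpW).and
    ((eventually_mem_set.2 hs).and (eventually_mem_set.2 hV)))
  obtain ⟨R0, hR0, hR⟩ := Metric.eventually_nhds_iff.1 hall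
  let R := min (min R0 dT) 1
  have hRb : ∀ w ∈ ball p R, dist w p < R0 := fun w hw =>
    lt_of_lt_of_le (mem_ball.1 hw) ((min_le_left _ _).trans (min_le_left _ _))
  have hRT : ball p R ⊆ ball p dT := ball_subset_ball ((min_le_left _ _).trans (min_le_right _ _))
  set M := ‖fderiv ℝ r p‖ + 1
  have hM : 1 ≤ M := by simp [M]
  refine ⟨R, by positivity, min_le_right _ _, fun w hw => (hR (hRb w hw)).2.2.2, r,
    fun z w => Pol (fderiv ℝ r z) S (w - z), c0 / 2, max (K : ℝ) (4 * M + 4 * ‖S‖), by positivity,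
    le_max_of_le_right (by have := norm_nonneg S; linarith), hr.mono fun w hw => (hR (hRb w hw)).2.1, by simp [r, cc, hp0], ?_, ?_, ?_, ?_, ?_, ?_⟩
  · intro w hw
    obtain ⟨⟨_, h1⟩, h2, _⟩ := hR (hRb w hw)
    rw [hiff w h2]
    have e : r w = ρ w * (1 + 2 * A * ρ w) := by simp only [r, cc]; ring
    rw [e]
    have h3 : 0 < 1 + 2 * A * ρ w := by linarith
    exact ⟨fun h => mul_neg_of_neg_of_pos h h3, fun h => by by_contra h'; nlinarith⟩
  · exact fun w hw X => (hR (hRb w hw)).1.1.1 X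
  · intro w hw z hz
    have := hlip.dist_le_mul w (hR (hRb w hw)).2.2.1 z (hR (hRb z hz)).2.2.1
    rw [Real.dist_eq, dist_eq_norm] at this
    refine this.trans ?_
    gcongr
    exact le_max_left _ _
  · exact fun z => pol_hol _ _ hSs z
  · intro z; simp [Pol]
  · intro z hz w hw
    have hT' := (abs_le.1 (hT z (hRT hz) w (hRT hw))).1
    have hl := hL (w - z)
    rw [levi_eq hrp] at hl
    constructor
    · have : (Pol (fderiv ℝ r z) S (w - z)).re = fderiv ℝ r z (w - z) +
          (S (w - z) (w - z) - S (I • (w - z)) (I • (w - z))) / 4 := by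
        simp [Pol]
      rw [this]
      linarith
    · have hn : ‖w - z‖ ≤ 2 := by
        have h1 := lt_of_lt_of_le (mem_ball.1 hw) (min_le_right _ _)
        have h2 := lt_of_lt_of_le (mem_ball.1 hz) (min_le_right _ _)
        rw [← dist_eq_norm]
        linarith [dist_triangle_right w z p]
      have hf := (hR (hRb z hz)).1.1.2
      have hi : ‖I • (w - z)‖ ≤ 2 := by simpa [norm_smul] using hn
      have b1 : ∀ h : EC, ‖h‖ ≤ 2 → ‖((fderiv ℝ r z h : ℝ) : ℂ)‖ ≤ 2 * M := fun h hh => by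
        rw [Complex.norm_real]
        refine ((fderiv ℝ r z).le_opNorm h).trans ?_
        nlinarith [norm_nonneg h]
      have b2 : ∀ h k : EC, ‖h‖ ≤ 2 → ‖k‖ ≤ 2 → ‖((S h k : ℝ) : ℂ)‖ ≤ 4 * ‖S‖ := fun h k hh hk => by
        rw [Complex.norm_real]
        refine (S.le_opNorm₂ h k).trans ?_
        have := mul_le_mul hh hk (norm_nonneg k) bn
        nlinarith [norm_nonneg S]
      refine le_max_of_le_right ?_
      unfold Pol
      refine (norm_add_le _ _).trans ?_
      refine (add_le_add (norm_sub_le _ _) le_rfl).trans ?_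
      rw [norm_div]
      have c3 := norm_sub_le ((S (w - z) (w - z) : ℂ) - (S (I • (w - z)) (I • (w - z)) : ℝ)) (2 * I * (S (w - z) (I • (w - z)) : ℝ))
      have c4 := norm_sub_le (S (w - z) (w - z) : ℂ) (S (I • (w - z)) (I • (w - z)) : ℝ)
      have c1 := b1 _ hn
      have c2 := b1 _ hi
      have c5 := b2 _ _ hn hn
      have c6 := b2 _ _ hi hi
      have c7 := b2 _ _ hn hi
      simp only [norm_mul, Complex.norm_I, one_mul, mul_one, Complex.norm_ofNat] at c3 ⊢
      linarith

structure Geo (Ω : SC) (p : EC) (V : SC) (R : ℝ) (r : FR)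
    (P : EC → FC) (c Lp : ℝ) : Prop where
  R0 : 0 < R
  R1 : R ≤ 1
  sV : ball p R ⊆ V
  c0 : 0 < c
  L1 : 1 ≤ Lp
  cd : ContDiffOn ℝ 2 r (ball p R)
  rp : r p = 0
  iff : ∀ w ∈ ball p R, w ∈ Ω ↔ r w < 0
  lev : ∀ w ∈ ball p R, ∀ X, c * ‖X‖ ^ 2 ≤ leviForm r w X
  lip : ∀ w ∈ ball p R, ∀ z ∈ ball p R, |r w - r z| ≤ Lp * ‖w - z‖
  dP : ∀ z, Differentiable ℂ (P z)
  P0 : ∀ z, P z z = 0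
  bP : ∀ z ∈ ball p R, ∀ w ∈ ball p R, (P z w).re ≤ r w - r z - c * ‖w - z‖ ^ 2 ∧ ‖P z w‖ ≤ Lp

lemma weight {Ω : SC} {p : EC} {V : SC} {R : ℝ} {r : FR}
    {P : EC → FC} {c Lp : ℝ} (hΩ : IsOpen Ω) (g : Geo Ω p V R r P c Lp) :
    ∃ (ψ κ : FR) (M R2 c1 : ℝ), 0 < R2 ∧ R2 < R ∧ 0 < c1 ∧ ContDiffOn ℝ 2 ψ Ω ∧
      (∀ x ∈ Ω, 0 ≤ ψ x) ∧ (∀ x ∈ Ω, ψ x ≤ M) ∧ ContinuousOn κ Ω ∧ (∀ x ∈ Ω, 0 ≤ κ x) ∧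
      (∀ x ∈ Ω, ∀ X, κ x * ‖X‖ ^ 2 ≤ leviForm ψ x X) ∧ (∀ x ∈ Ω ∩ ball p R2, c1 ≤ κ x) := by
  classical
  have R0 := g.R0
  have c0 := g.c0
  have L1 := g.L1
  set ε := c / 2 with hε
  have e0 : 0 < ε := by positivity
  set a := ε * R ^ 2 / 4 with ha
  have a0 : 0 < a := by positivity
  let q : ℝ → ℝ := fun s => -ε * s + a
  have hq : ContDiff ℝ 2 q := by fun_prop
  let σ : FR := fun w => r w + q (‖w - p‖ ^ 2)
  have hB : ∀ x ∈ ball p R, ball p R ∈ 𝓝 x := fun x hx => isOpen_ball.mem_nhds hx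
  have hσ : ∀ x ∈ ball p R, ContDiffAt ℝ 2 σ x := fun x hx =>
    (g.cd.contDiffAt (hB x hx)).add (hq.comp (cd_nsq p)).contDiffAt
  have hfar : ∀ x ∈ Ω, R / 2 < ‖x - p‖ → x ∈ ball p R → σ x ≤ 0 := by
    intro x hx h1 h2
    have h3 := (g.iff x h2).1 hx
    have : (R / 2) ^ 2 ≤ ‖x - p‖ ^ 2 := by gcongr
    simp only [σ, q]
    nlinarith
  have hev : ∀ x ∈ Ω, x ∉ ball p R → ∀ᶠ y in 𝓝 x, y ∈ ball p R → σ y ≤ 0 := by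
    intro x hx h
    have h1 : R / 2 < ‖x - p‖ := by
      rw [mem_ball, dist_eq_norm] at h
      linarith
    filter_upwards [hΩ.mem_nhds hx,
      (by fun_prop : Continuous fun y : EC => ‖y - p‖).continuousAt.eventually_const_lt h1]
      with y hy1 hy2 using hfar y hy1 hy2
  have mz : ∀ k s, s ≤ 0 → mx (k + 1) s = 0 := fun k s hs => by simp [mx, max_eq_left hs]
  let E : (FR) → FR := fun f x => if x ∈ ball p R then f x else 0
  have hE : ∀ f, ∀ x ∈ ball p R, E f =ᶠ[𝓝 x] f := fun f x hx => by
    filter_upwards [hB x hx] with y hy using if_pos hy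
  have hE0 : ∀ m : ℝ → ℝ, (∀ s ≤ 0, m s = 0) → ∀ x ∈ Ω, x ∉ ball p R →
      E (fun y => m (σ y)) =ᶠ[𝓝 x] fun _ => 0 := fun m hm x hx h => by
    filter_upwards [hev x hx h] with y hy
    simp only [E]
    split_ifs with hy'
    · exact hm _ (hy hy')
    · rfl
  have dm : deriv (mx 3) = fun s => 3 * mx 2 s := by
    ext s; rw [(mx_hd 1 s).deriv]; norm_num
  have dm2 : ∀ s, 0 ≤ deriv (deriv (mx 3)) s := fun s => by
    rw [dm, ((mx_hd 0 s).const_mul 3).deriv]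
    have := mx_nonneg 1 s
    norm_num; positivity
  have m3 := mz 2
  have m2 : ∀ s ≤ 0, 3 * ε * mx 2 s = 0 := fun s hs => by rw [mz 1 s hs, mul_zero]
  have hsl : ∀ x ∈ ball p R, ∀ X, ε * ‖X‖ ^ 2 ≤ leviForm σ x X := by
    intro x hx X
    have hdq : deriv q = fun _ => -ε := by
      ext s
      exact ((((hasDerivAt_id s).const_mul (-ε)).add_const a).congr_deriv (by simp)).deriv
    rw [show σ = fun w => r w + q (‖w - p‖ ^ 2) from rfl, levi_add (g := fun w => q (‖w - p‖ ^ 2)) (g.cd.contDiffAt (hB x hx))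
      (hq.comp (cd_nsq p)).contDiffAt, levi_comp (c := q) (f := fun w => ‖w - p‖ ^ 2)
      (cd_nsq p).contDiffAt hq.contDiffAt, levi_nsq, hdq]
    have := g.lev x hx X
    rw [show c = 2 * ε by rw [hε]; ring] at this
    simp only [deriv_const, zero_mul, zero_div, add_zero]
    linarith
  set R2 := min (R / 2) (a / (2 * (Lp + ε))) with hR2
  refine ⟨E fun y => mx 3 (σ y), E fun y => 3 * ε * mx 2 (σ y), a ^ 3, R2, 3 * ε * (a / 2) ^ 2,
    by positivity, (min_le_left _ _).trans_lt (by linarith), by positivity, ?_, ?_, ?_, ?_, ?_, ?_, ?_⟩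
  · intro x hx
    by_cases h : x ∈ ball p R
    · exact ((mx_cd.contDiffAt.comp x (hσ x h)).congr_of_eventuallyEq (hE _ x h)).contDiffWithinAt
    · exact (contDiffAt_const.congr_of_eventuallyEq (hE0 _ m3 x hx h)).contDiffWithinAt
  · intro x _
    simp only [E]
    split_ifs
    · exact mx_nonneg _ _
    · exact le_rfl
  · intro x hx
    simp only [E]
    split_ifs with h
    · refine pow_le_pow_left₀ (le_max_left _ _) (max_le a0.le ?_) 3
      have := (g.iff x h).1 hx
      have h3 : 0 ≤ ε * ‖x - p‖ ^ 2 := by positivity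
      simp only [σ, q]; linarith
    · positivity
  · intro x hx
    have hmc : Continuous fun s => 3 * ε * mx 2 s := by unfold mx; fun_prop
    by_cases h : x ∈ ball p R
    · exact (ContinuousAt.congr (hmc.continuousAt.comp (hσ x h).continuousAt)
        (hE _ x h).symm).continuousWithinAt
    · exact (continuousAt_const.congr (hE0 _ m2 x hx h).symm).continuousWithinAt
  · intro x _
    simp only [E]
    split_ifs
    · have := mx_nonneg 2 (σ x)
      positivity
    · exact le_rfl
  · intro x hx X
    by_cases h : x ∈ ball p R
    · rw [levi_congr (hE _ x h), (hE (fun y => 3 * ε * mx 2 (σ y)) x h).eq_of_nhds,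
        levi_comp (hσ x h) mx_cd.contDiffAt]
      have h1 := hsl x h X
      have h2 := mx_nonneg 2 (σ x)
      have h3 := mul_le_mul_of_nonneg_left h1 (by positivity : 0 ≤ 3 * mx 2 (σ x))
      have h4 : 0 ≤ deriv (deriv (mx 3)) (σ x) * ((fderiv ℝ σ x X) ^ 2 + (fderiv ℝ σ x (I • X)) ^ 2) / 4 := by
        have := dm2 (σ x)
        positivity
      rw [show deriv (mx 3) (σ x) = 3 * mx 2 (σ x) by rw [dm]]
      linarith
    · rw [levi_congr (hE0 _ m3 x hx h), (hE0 _ m2 x hx h).eq_of_nhds]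
      simp [leviForm]
  · rintro x ⟨hx, hx2⟩
    rw [mem_ball, dist_eq_norm] at hx2
    have hxR : x ∈ ball p R := by
      rw [mem_ball, dist_eq_norm]; linarith [min_le_left (R / 2) (a / (2 * (Lp + ε)))]
    simp only [E, if_pos hxR]
    have h1 := (abs_le.1 (g.lip x hxR p (mem_ball_self R0))).1
    rw [g.rp] at h1
    have h2 : ‖x - p‖ * (2 * (Lp + ε)) ≤ a :=
      (le_div_iff₀ bp).1 (hx2.le.trans (min_le_right _ _))
    have h3 : ‖x - p‖ ≤ 1 := by linarith [min_le_left (R / 2) (a / (2 * (Lp + ε))), g.R1]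
    have h4 : ‖x - p‖ ^ 2 ≤ ‖x - p‖ := by nlinarith [norm_nonneg (x - p)]
    have h5 : a / 2 ≤ σ x := by simp only [σ, q]; nlinarith
    have h6 : (a / 2) ^ 2 ≤ mx 2 (σ x) := pow_le_pow_left₀ bp (h5.trans (le_max_right _ _)) 2
    gcongr

lemma l2_iff {μ : Measure EC} {f : FC} {a : ℝ} (ha : 0 ≤ a) :
    ∫⁻ x, ‖f x‖ₑ ^ 2 ∂μ ≤ ENNReal.ofReal (a ^ 2) ↔ eLpNorm f 2 μ ≤ ENNReal.ofReal a := by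
  have : ∫⁻ x, ‖f x‖ₑ ^ 2 ∂μ = eLpNorm f 2 μ ^ 2 := by
    rw [eLpNorm_eq_lintegral_rpow_enorm_toReal bn bn,
      ← ENNReal.rpow_natCast, ← ENNReal.rpow_mul]; norm_num
  rw [this, ENNReal.ofReal_pow ha]
  exact ENNReal.pow_le_pow_left_iff two_ne_zero

lemma geo_z {Ω : SC} {p : EC} {V : SC} {R : ℝ} {r : FR}
    {P : EC → FC} {c Lp : ℝ} (g : Geo Ω p V R r P c Lp) {r0 : ℝ} (h2 : 2 * r0 ≤ R) {z : EC}
    (hz : z ∈ Ω ∩ ball p r0) : z ∈ ball p R ∧ 0 < -r z ∧ -r z ≤ Lp * ‖z - p‖ ∧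
      ball z (-r z / (2 * Lp)) ⊆ Ω ∩ ball p (2 * r0) := by
  have L1 := g.L1
  have hz2 := mem_ball_iff_norm.1 hz.2
  have hzR : z ∈ ball p R := mem_ball_iff_norm.2 (by linarith [norm_nonneg (z - p)])
  have h1 := (g.iff z hzR).1 hz.1
  have h3 := (abs_le.1 (g.lip z hzR p (mem_ball_self g.R0))).1
  rw [g.rp] at h3
  refine ⟨hzR, by linarith, by linarith, fun w hw => ?_⟩
  have hw' := (lt_div_iff₀ bp).1 (mem_ball_iff_norm.1 hw)
  have hn : ‖w - p‖ ≤ ‖w - z‖ + ‖z - p‖ := norm_sub_le_norm_sub_add_norm_sub _ _ _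
  have hw2 : w ∈ ball p (2 * r0) := mem_ball_iff_norm.2 (by nlinarith)
  have hwR := ball_subset_ball h2 hw2
  have h4 := (abs_le.1 (g.lip w hwR z hzR)).2
  exact ⟨(g.iff w hwR).2 (by linarith), hw2⟩

lemma small_log {K : ℝ} : ∃ η > 0, η ≤ Real.exp (-1) ∧ ∀ t, 0 < t → t < η → K * (t * -Real.log t) ≤ 1 := by
  have h1 : ContinuousAt (fun t : ℝ => K * -(t * Real.log t)) 0 :=
    (continuous_const.mul Real.continuous_mul_log.neg).continuousAt
  obtain ⟨η, h0, hη⟩ := Metric.eventually_nhds_iff.1 (h1.eventually_lt_const (u := 1) (by simp))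
  refine ⟨min η (Real.exp (-1)), lt_min h0 (Real.exp_pos _), min_le_right _ _, fun t t0 ht => ?_⟩
  have := @hη t (by simpa [abs_of_pos t0] using ht.trans_le (min_le_left _ _))
  rw [mul_neg]; exact this.le

set_option maxHeartbeats 600000 in
lemma loc {Ω : SC} {p : EC} {V : SC} {R : ℝ} {r : FR}
    {P : EC → FC} {c Lp : ℝ} (hΩ : IsPseudoconvex Ω) (g : Geo Ω p V R r P c Lp)
    (A : ℕ) (hA : 1 ≤ A) : ∃ r0 C K0 : ℝ, 0 < r0 ∧ 2 * r0 ≤ R ∧ 0 ≤ C ∧ 0 ≤ K0 ∧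
      ∀ z ∈ Ω ∩ ball p r0, ∀ (F : FC) (N : ℝ), 0 ≤ N → DifferentiableOn ℂ F (Ω ∩ ball p R) →
        ∫⁻ x in Ω ∩ ball p R, ‖F x‖ₑ ^ 2 ≤ ENNReal.ofReal (N ^ 2) →
        ∃ G, DifferentiableOn ℂ G Ω ∧
          ∫⁻ x in Ω, ‖G x‖ₑ ^ 2 ≤ ENNReal.ofReal (((1 + C * (-r z * -Real.log (-r z))) * N) ^ 2) ∧
          ∫⁻ x in ball z (-r z / (2 * Lp)),
            ‖G x - F x * Complex.exp ((K0 * -Real.log (-r z) : ℝ) * P z x)‖ₑ ^ 2 ≤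
            ENNReal.ofReal ((C * (-r z) ^ A * N) ^ 2) := by
  have oΩ := hΩ.1
  have L1 := g.L1
  have c0 := g.c0
  obtain ⟨ψ, κ, M, R2, c1, hR2, hR2R, hc1, w1, w2, w3, w4, w5, w6, w7⟩ := weight oΩ g
  set R1 := R2 / 2
  obtain ⟨χ, hχ, χc, χt, ⟨U, oU, hU, -, U1⟩, χ01⟩ := cut (isCompact_closedBall p R1)
    (isOpen_ball (x := p) (ε := R2)) (closedBall_subset_ball (by simp only [R1]; linarith))
  have hcχ : ContDiff ℝ 2 (cx χ) := Complex.ofRealCLM.contDiff.comp hχ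
  have ccχ : HasCompactSupport (cx χ) := χc.comp_left (g := fun t : ℝ => (t : ℂ)) (by simp)
  have tsχ : tsupport (cx χ) ⊆ ball p R2 :=
    (closure_mono (fun x hx h => hx (by simp [cx, h]) : Function.support (cx χ) ⊆ Function.support χ)).trans χt
  choose Bj hBj using fun j => (cont_db (hcχ.of_le bn) (ee j)).bounded_above_of_compact_support
    (hcs_db ccχ (ee (n := n) j))
  set B := ∑ j, Bj j ^ 2
  have hB : ∀ x, ∑ j, ‖db (ee j) (cx χ) x‖ ^ 2 ≤ B := fun x =>
    Finset.sum_le_sum fun j _ => pow_le_pow_left₀ (norm_nonneg _) (hBj j x) 2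
  have B0 : 0 ≤ B := Finset.sum_nonneg fun j _ => sq_nonneg _
  set c' := c * (R1 / 2) ^ 2
  have hc' : 0 < c' := by positivity
  set K0 : ℝ := A / c'
  have K00 : 0 ≤ K0 := by positivity
  obtain ⟨η, η0, η1, hη⟩ := small_log (K := K0)
  set C1 := √(c1⁻¹ * (B * 9) * Real.exp M)
  have C10 : 0 ≤ C1 := Real.sqrt_nonneg _
  set r0 := min (R1 / 2) (η / Lp)
  have hr0 : 2 * r0 ≤ R1 := by linarith [min_le_left (R1 / 2) (η / Lp)]
  have hr0R : 2 * r0 ≤ R := hr0.trans (by simp only [R1]; linarith)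
  refine ⟨r0, 2 * K0 + C1, K0, by positivity, hr0R, by positivity, K00, ?_⟩
  intro z hz F N hN hF hFN
  obtain ⟨hzR, t0, tL, hb⟩ := geo_z g hr0R hz
  have hz2 := mem_ball_iff_norm.1 hz.2
  set t := -r z with ht
  have htη : t < η := by
    have h1 : ‖z - p‖ < η / Lp := hz2.trans_le (min_le_right _ _)
    rw [lt_div_iff₀ bp] at h1
    linarith
  have hL1 : 1 ≤ -Real.log t := by
    have := Real.log_le_log t0 (htη.le.trans η1)
    rw [Real.log_exp] at this; linarith
  have hkt := hη t t0 htη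
  set k := K0 * -Real.log t with hk
  have k0 : 0 ≤ k := by positivity
  have hE : Real.exp (k * t) ≤ 1 + 2 * (k * t) := by
    have h1 : |k * t| ≤ 1 := by rw [abs_of_nonneg bp]; linarith
    have h2 := (abs_le.1 (Real.abs_exp_sub_one_le h1)).2
    rw [abs_of_nonneg bp] at h2; linarith
  set E1 := Real.exp (k * t)
  have E0 : 0 < E1 := Real.exp_pos _
  have E3 : E1 ≤ 3 := by linarith
  have oD : IsOpen (Ω ∩ ball p R) := oΩ.inter isOpen_ball
  set D := Ω ∩ ball p R
  let e : FC := fun x => Complex.exp ((k : ℝ) * P z x)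
  have he : Differentiable ℂ e := ((g.dP z).const_mul _).cexp
  have ne : ∀ x, ‖e x‖ = Real.exp (k * (P z x).re) := fun x => by
    simp only [e, Complex.norm_exp, Complex.re_ofReal_mul]
  have hn1 : ∀ x ∈ D, ‖e x‖ ≤ E1 := fun x hx => by
    rw [ne]
    have h1 := (g.bP z hzR x hx.2).1
    have h2 := (g.iff x hx.2).1 hx.1
    refine Real.exp_le_exp.2 (mul_le_mul_of_nonneg_left ?_ k0)
    have : 0 ≤ c * ‖x - z‖ ^ 2 := by positivity
    linarith
  have hn2 : ∀ x ∈ D, x ∉ U → ‖e x‖ ≤ E1 * t ^ A := fun x hx hxU => by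
    rw [ne]
    have h1 := (g.bP z hzR x hx.2).1
    have h2 := (g.iff x hx.2).1 hx.1
    have h3 : R1 < ‖x - p‖ := by
      by_contra h
      exact hxU (hU (mem_closedBall_iff_norm.2 (not_lt.1 h)))
    have hn : ‖x - p‖ ≤ ‖x - z‖ + ‖z - p‖ := norm_sub_le_norm_sub_add_norm_sub _ _ _
    have h4 : R1 / 2 ≤ ‖x - z‖ := by linarith
    have h5 : c' ≤ c * ‖x - z‖ ^ 2 := by
      simp only [c']
      have : 0 ≤ R1 / 2 := by simp only [R1]; positivity
      gcongr
    have h6 : t ^ A = Real.exp (-(k * c')) := by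
      have : -(k * c') = Real.log t * A := by
        simp only [hk, K0]
        field_simp
      rw [this, mul_comm, Real.exp_nat_mul, Real.exp_log t0]
    rw [h6, ← Real.exp_add]
    refine Real.exp_le_exp.2 ?_
    rw [← sub_eq_add_neg, ← mul_sub]
    exact mul_le_mul_of_nonneg_left (by linarith) k0
  let F' : FC := D.indicator F
  have F'e : ∀ x ∈ D, F' x = F x := fun x hx => indicator_of_mem hx F
  have F'0 : ∀ x, x ∉ D → F' x = 0 := fun x hx => indicator_of_notMem hx F
  have hF' : DifferentiableOn ℂ F' D := hF.congr F'e
  have mF' : AEStronglyMeasurable F' volume :=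
    (aestronglyMeasurable_indicator_iff oD.measurableSet).2
      (hF.continuousOn.aestronglyMeasurable oD.measurableSet)
  have nF' : eLpNorm F' 2 volume ≤ ENNReal.ofReal N := by
    rw [← l2_iff hN]
    refine le_trans (le_of_eq ?_) hFN
    rw [← lintegral_indicator oD.measurableSet]
    refine lintegral_congr fun x => ?_
    by_cases hx : x ∈ D
    · rw [indicator_of_mem hx, F'e x hx]
    · rw [indicator_of_notMem hx, F'0 x hx]; simp
  have lF' : MemLp F' 2 := ⟨mF', nF'.trans_lt ENNReal.ofReal_lt_top⟩
  have iF' : Integrable fun x => ‖F' x‖ ^ 2 := lF'.integrable_norm_pow two_ne_zero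
  have iFN : ∫ x, ‖F' x‖ ^ 2 ≤ N ^ 2 := by
    rw [int_sq lF']
    exact pow_le_pow_left₀ ENNReal.toReal_nonneg (ENNReal.toReal_le_of_le_ofReal hN nF') 2
  have cFe : ∀ x ∈ D, DifferentiableAt ℂ (fun y => F' y * e y) x := fun x hx =>
    (hol_at oD hF' hx).mul (he x)
  let u0 : FC := fun x => cx χ x * (F' x * e x)
  have R2D : ∀ x ∈ Ω, x ∉ D → cx χ =ᶠ[𝓝 x] fun _ => 0 := fun x hx h =>
    notMem_tsupport_iff_eventuallyEq.1 fun h' => h ⟨hx, ball_subset_ball hR2R.le (tsχ h')⟩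
  have hu : ContDiffOn ℝ 2 u0 Ω := by
    intro x hx
    by_cases h : x ∈ D
    · have h1 : ContDiffAt ℝ 2 (fun y => F' y * e y) x :=
        (hol_c2 oD (f := fun y => F' y * e y) fun y hy => (cFe y hy).differentiableWithinAt).contDiffAt
          (oD.mem_nhds h)
      exact (hcχ.contDiffAt.mul h1).contDiffWithinAt
    · have : u0 =ᶠ[𝓝 x] fun _ => 0 := (R2D x hx h).mono fun y hy => by simp only [u0, hy, zero_mul]
      exact (contDiffAt_const.congr_of_eventuallyEq this).contDiffWithinAt
  have hdb : ∀ x ∈ Ω, ∀ j, db (ee j) u0 x = db (ee j) (cx χ) x * (F' x * e x) := by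
    intro x hx j
    by_cases h : x ∈ D
    · rw [db_mul (hcχ.differentiable bn x) ((cFe x h).restrictScalars ℝ),
        db_of_hol (cFe x h), mul_zero, zero_add]
    · have : u0 =ᶠ[𝓝 x] fun _ => 0 := (R2D x hx h).mono fun y hy => by simp only [u0, hy, zero_mul]
      rw [db_congr this, F'0 x h]; simp [db]
  have hQ : ∀ x ∈ Ω, ∑ j, ‖db (ee j) u0 x‖ ^ 2 ≤ B * (E1 * t ^ A) ^ 2 * ‖F' x‖ ^ 2 := by
    intro x hx
    have e1 : ∑ j, ‖db (ee j) u0 x‖ ^ 2 = (∑ j, ‖db (ee j) (cx χ) x‖ ^ 2) * ‖e x‖ ^ 2 * ‖F' x‖ ^ 2 := by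
      rw [Finset.sum_mul, Finset.sum_mul]
      refine Finset.sum_congr rfl fun j _ => ?_
      rw [hdb x hx j, norm_mul, norm_mul]; ring
    rw [e1]
    by_cases h : x ∈ D
    · by_cases hxU : x ∈ U
      · have : ∀ j, db (ee j) (cx χ) x = 0 := fun j => by
          have h1 : cx χ =ᶠ[𝓝 x] fun _ => 1 := by
            filter_upwards [oU.mem_nhds hxU] with y hy
            simp [cx, U1 y hy]
          rw [db_congr h1]; simp [db]
        simp only [this, norm_zero]
        simp only [ne_eq, OfNat.ofNat_ne_zero, not_false_eq_true, zero_pow, Finset.sum_const_zero, zero_mul]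
        positivity
      · gcongr
        · exact hB x
        · exact hn2 x h hxU
    · rw [F'0 x h]; simp
  have cQ : ContinuousOn (fun x => ∑ j, ‖db (ee j) u0 x‖ ^ 2) Ω := by
    have : ∀ X, ContinuousOn (fun x => fderiv ℝ u0 x X) Ω := fun X =>
      (hu.continuousOn_fderiv_of_isOpen oΩ bn).clm_apply continuousOn_const
    refine continuousOn_finsetSum _ fun j _ => ContinuousOn.pow (ContinuousOn.norm ?_) 2
    exact ((this _).add (continuousOn_const.mul (this _))).div_const _
  have iB : Integrable fun x => B * (E1 * t ^ A) ^ 2 * ‖F' x‖ ^ 2 := iF'.const_mul _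
  have hi : IntegrableOn (fun x => ∑ j, ‖db (ee j) u0 x‖ ^ 2) Ω := by
    refine Integrable.mono' iB.integrableOn (cQ.aestronglyMeasurable oΩ.measurableSet) ?_
    refine (ae_restrict_iff' oΩ.measurableSet).2 (ae_of_all _ fun x hx => ?_)
    rw [Real.norm_of_nonneg (Finset.sum_nonneg fun j _ => sq_nonneg _)]
    exact hQ x hx
  have hIQ : ∫ x in Ω, ∑ j, ‖db (ee j) u0 x‖ ^ 2 ≤ B * 9 * (t ^ A * N) ^ 2 := by
    refine (setIntegral_mono_on hi iB.integrableOn oΩ.measurableSet hQ).trans ?_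
    refine (setIntegral_le_integral iB (ae_of_all _ fun x => by positivity)).trans ?_
    rw [integral_const_mul]
    have : E1 ^ 2 ≤ 9 := by nlinarith
    calc _ ≤ B * (E1 * t ^ A) ^ 2 * N ^ 2 := by gcongr
      _ = B * E1 ^ 2 * (t ^ A * N) ^ 2 := by ring
      _ ≤ _ := by gcongr
  have hu1 : ∀ x ∈ Ω, ‖u0 x‖ ≤ E1 * ‖F' x‖ := by
    intro x hx
    by_cases h : x ∈ D
    · simp only [u0, norm_mul]
      have h1 : ‖cx χ x‖ ≤ 1 := by
        simp only [cx, Complex.norm_real, Real.norm_of_nonneg (χ01 x).1]; exact (χ01 x).2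
      calc _ ≤ 1 * (‖F' x‖ * E1) := by gcongr; exact hn1 x h
        _ = _ := by ring
    · simp only [u0, F'0 x h]; simp
  have mu : AEStronglyMeasurable u0 (volume.restrict Ω) :=
    hu.continuousOn.aestronglyMeasurable oΩ.measurableSet
  have nu : eLpNorm u0 2 (volume.restrict Ω) ≤ ENNReal.ofReal (E1 * N) := by
    refine (eLpNorm_le_mul_eLpNorm_of_ae_le_mul
      ((ae_restrict_iff' oΩ.measurableSet).2 (ae_of_all _ hu1)) 2).trans ?_
    rw [ENNReal.ofReal_mul E0.le]
    gcongr
    exact (eLpNorm_mono_measure _ Measure.restrict_le_self).trans nF'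
  have h2 : MemLp (Ω.indicator u0) 2 := by
    rw [memLp_indicator_iff_restrict oΩ.measurableSet]
    exact ⟨mu, nu.trans_lt ENNReal.ofReal_lt_top⟩
  obtain ⟨G, hG, hGn⟩ := dbar hΩ w1 w2 w3 w4 w5 w6 hu hc1 (fun x hx ⟨j, hj⟩ => w7 x ⟨hx, by
    refine tsχ (ts_db (ee j) (subset_tsupport _ fun h => hj ?_))
    rw [hdb x hx j, h, zero_mul]⟩) hi h2
  have hGC : ∫⁻ x in Ω, ‖G x - u0 x‖ₑ ^ 2 ≤ ENNReal.ofReal ((C1 * t ^ A * N) ^ 2) := by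
    refine hGn.trans (ENNReal.ofReal_le_ofReal ?_)
    have : (C1 * t ^ A * N) ^ 2 = c1⁻¹ * (B * 9 * (t ^ A * N) ^ 2) * Real.exp M := by
      rw [mul_assoc, mul_pow, Real.sq_sqrt bp]; ring
    rw [this]
    gcongr
  refine ⟨G, hG, ?_, ?_⟩
  · have h3 := (l2_iff bp).1 hGC
    have hL0 : 0 ≤ t * -Real.log t := by positivity
    rw [l2_iff bp]
    have e2 : G = (fun x => G x - u0 x) + u0 := by ext x; simp
    have mG : AEStronglyMeasurable (fun x => G x - u0 x) (volume.restrict Ω) :=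
      (hG.continuousOn.aestronglyMeasurable oΩ.measurableSet).sub mu
    rw [e2]
    refine (eLpNorm_add_le mG mu bn).trans ((add_le_add h3 nu).trans ?_)
    rw [← ENNReal.ofReal_add bp bp]
    refine ENNReal.ofReal_le_ofReal ?_
    have ht1 : t ≤ 1 := htη.le.trans (η1.trans (by rw [Real.exp_le_one_iff]; norm_num))
    have h4 : t ^ A ≤ t := by
      calc t ^ A ≤ t ^ 1 := pow_le_pow_of_le_one t0.le ht1 hA
        _ = t := pow_one t
    have h5 : t ≤ t * -Real.log t := le_mul_of_one_le_right t0.le hL1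
    have h6 : C1 * t ^ A + E1 ≤ 1 + (2 * K0 + C1) * (t * -Real.log t) := by
      have := mul_le_mul_of_nonneg_left (h4.trans h5) C10
      have : k * t = K0 * (t * -Real.log t) := by rw [hk]; ring
      nlinarith
    have := mul_le_mul_of_nonneg_right h6 hN
    rwa [add_mul] at this
  · have hs : ∀ x ∈ ball z (t / (2 * Lp)), x ∈ D ∧ u0 x = F x * e x := fun x hx => by
      have h1 := hb hx
      have hD : x ∈ D := ⟨h1.1, ball_subset_ball hr0R h1.2⟩
      refine ⟨hD, ?_⟩
      simp [u0, cx, U1 x (hU (ball_subset_closedBall (ball_subset_ball hr0 h1.2))), F'e x hD]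
    calc _ = ∫⁻ x in ball z (t / (2 * Lp)), ‖G x - u0 x‖ₑ ^ 2 :=
          setLIntegral_congr_fun measurableSet_ball fun x hx => by simp only [(hs x hx).2, e]
      _ ≤ ∫⁻ x in Ω, ‖G x - u0 x‖ₑ ^ 2 := lintegral_mono_set fun x hx => (hb hx).1
      _ ≤ _ := hGC.trans (ENNReal.ofReal_le_ofReal (by gcongr; linarith))

lemma fd_lin {ι : Type*} [Fintype ι] {G : FC} {E : ι → FC} (c : ι → ℂ) {w : EC}
    (hG : DifferentiableAt ℂ G w) (hE : ∀ k, DifferentiableAt ℂ (E k) w) (Y : EC) :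
    fderiv ℂ (fun w => G w - ∑ k, c k * E k w) w Y =
      fderiv ℂ G w Y - ∑ k, c k * fderiv ℂ (E k) w Y := by
  have h := hG.hasFDerivAt.sub (HasFDerivAt.fun_sum (u := Finset.univ) fun k _ =>
    (hE k).hasFDerivAt.const_mul (c k))
  have h' : HasFDerivAt (fun w => G w - ∑ k, c k * E k w) _ w := h
  rw [h'.fderiv]
  simp [ContinuousLinearMap.sum_apply]

lemma D2_lin {ι : Type*} [Fintype ι] {U : SC} (hU : IsOpen U) {G : FC}
    {E : ι → FC} (c : ι → ℂ) {z : EC} (hz : z ∈ U) (hG : DifferentiableOn ℂ G U)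
    (hE : ∀ k, DifferentiableOn ℂ (E k) U) (X Y : EC) :
    D2 (fun w => G w - ∑ k, c k * E k w) z X Y = D2 G z X Y - ∑ k, c k * D2 (E k) z X Y := by
  unfold D2
  have : (fun w => fderiv ℂ (fun w => G w - ∑ k, c k * E k w) w Y) =ᶠ[𝓝 z]
      fun w => fderiv ℂ G w Y - ∑ k, c k * fderiv ℂ (E k) w Y := by
    filter_upwards [hU.mem_nhds hz] with w hw
    exact fd_lin c (hol_at hU hG hw) (fun k => hol_at hU (hE k) hw) Y
  rw [this.fderiv_eq]
  exact fd_lin c (hol_at hU (hol_fd hU hG Y) hz) (fun k => hol_at hU (hol_fd hU (hE k) Y) hz) X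

lemma D2_mul {U : SC} (hU : IsOpen U) {f e : FC} {z : EC} (hz : z ∈ U)
    (hf : DifferentiableOn ℂ f U) (he : DifferentiableOn ℂ e U) (X Y : EC) :
    D2 (fun w => f w * e w) z X Y = f z * D2 e z X Y + fderiv ℂ f z X * fderiv ℂ e z Y +
      (e z * D2 f z X Y + fderiv ℂ e z X * fderiv ℂ f z Y) := by
  unfold D2
  have : (fun w => fderiv ℂ (fun w => f w * e w) w Y) =ᶠ[𝓝 z]
      fun w => f w * fderiv ℂ e w Y + e w * fderiv ℂ f w Y := by
    filter_upwards [hU.mem_nhds hz] with w hw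
    rw [fderiv_fun_mul (hol_at hU hf hw) (hol_at hU he hw)]; simp
  have h1 := (hol_at hU hf hz).hasFDerivAt.mul (hol_at hU (hol_fd hU he Y) hz).hasFDerivAt
  have h2 := (hol_at hU he hz).hasFDerivAt.mul (hol_at hU (hol_fd hU hf Y) hz).hasFDerivAt
  have h3 : HasFDerivAt (fun w => f w * fderiv ℂ e w Y + e w * fderiv ℂ f w Y) _ z := h1.add h2
  rw [this.fderiv_eq, h3.fderiv]
  simp; ring

lemma lin_solve {ι : Type*} [Fintype ι] [DecidableEq ι] (a : ι → ι → ℂ) {η m : ℝ}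
    (h : ∀ i k, ‖a i k - if i = k then 1 else 0‖ ≤ η) (hη : Fintype.card ι * η ≤ 1 / 2)
    (y : ι → ℂ) (m0 : 0 ≤ m) (hy : ∀ i, ‖y i‖ ≤ m) :
    ∃ c : ι → ℂ, (∀ i, ∑ k, c k * a i k = y i) ∧ ∀ k, ‖c k‖ ≤ 2 * m := by
  let T := Matrix.mulVecLin (Matrix.of a)
  have hT : ∀ c i, T c i = ∑ k, c k * a i k := fun c i => by
    simp [T, Matrix.mulVec, dotProduct, mul_comm]
  have key : ∀ c : ι → ℂ, ‖c‖ ≤ 2 * ‖T c‖ := by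
    intro c
    have h1 : ‖T c - c‖ ≤ 1 / 2 * ‖c‖ := by
      refine (pi_norm_le_iff_of_nonneg bp).2 fun i => ?_
      have e : (T c - c) i = ∑ k, c k * (a i k - if i = k then 1 else 0) := by
        simp [hT, mul_sub, Finset.sum_sub_distrib]
      rw [e]
      refine (norm_sum_le _ _).trans ?_
      calc _ ≤ ∑ _k : ι, ‖c‖ * η := Finset.sum_le_sum fun k _ => by
            rw [norm_mul]
            exact mul_le_mul (norm_le_pi_norm c k) (h i k) (norm_nonneg _) (norm_nonneg _)
        _ = Fintype.card ι * η * ‖c‖ := by simp; ring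
        _ ≤ _ := by gcongr
    have h2 := norm_sub_norm_le c (T c)
    rw [norm_sub_rev] at h2
    linarith
  have inj : Function.Injective T := by
    rw [injective_iff_map_eq_zero]
    intro c hc
    have := key c
    rw [hc, norm_zero, mul_zero] at this
    exact norm_le_zero_iff.1 this
  obtain ⟨c, hc⟩ := LinearMap.injective_iff_surjective.1 inj y
  refine ⟨c, fun i => by rw [← hT, hc], fun k => ?_⟩
  refine (norm_le_pi_norm c k).trans ((key c).trans ?_)
  rw [hc]
  have := (pi_norm_le_iff_of_nonneg m0).2 hy
  linarith

lemma bdd_l2 {S T : SC} (hST : S ⊆ T) (hT : MeasurableSet T) (hv : volume T ≠ ⊤)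
    {f : FC} {m : ℝ} (hm : 0 ≤ m) (hf : ∀ x ∈ T, ‖f x‖ ≤ m) :
    ∫⁻ x in S, ‖f x‖ₑ ^ 2 ≤ ENNReal.ofReal ((m * √(volume T).toReal) ^ 2) := by
  refine (lintegral_mono_set hST).trans ?_
  calc _ ≤ ∫⁻ _ in T, ENNReal.ofReal (m ^ 2) := setLIntegral_mono' hT fun x hx => by
        rw [ENNReal.ofReal_pow hm, ← ofReal_norm]
        gcongr
        exact hf x hx
    _ = _ := by
        rw [setLIntegral_const, mul_pow, Real.sq_sqrt ENNReal.toReal_nonneg,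
          ENNReal.ofReal_mul bp, ENNReal.ofReal_toReal hv]

lemma ext1 {Ω : SC} {p : EC} {V : SC} {R : ℝ} {r : FR}
    {P : EC → FC} {c Lp : ℝ} (hΩ : IsPseudoconvex Ω) (g : Geo Ω p V R r P c Lp)
    (b : ℕ) : ∃ r0 C K0 : ℝ, 0 < r0 ∧ 2 * r0 ≤ R ∧ Lp * r0 ≤ Real.exp (-1) ∧ 0 ≤ C ∧ 0 ≤ K0 ∧
      ∀ z ∈ Ω ∩ ball p r0, ∀ (F : FC) (N : ℝ), 0 ≤ N → DifferentiableOn ℂ F (Ω ∩ ball p R) →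
        ∫⁻ x in Ω ∩ ball p R, ‖F x‖ₑ ^ 2 ≤ ENNReal.ofReal (N ^ 2) →
        ∀ e : FC, e = (fun x => Complex.exp ((K0 * -Real.log (-r z) : ℝ) * P z x)) →
        ∃ G, DifferentiableOn ℂ G Ω ∧
          ∫⁻ x in Ω, ‖G x‖ₑ ^ 2 ≤ ENNReal.ofReal (((1 + C * (-r z * -Real.log (-r z))) * N) ^ 2) ∧
          ‖G z - F z * e z‖ ≤ C * (-r z) ^ b * N ∧
          (∀ X, ‖fderiv ℂ G z X - fderiv ℂ (fun x => F x * e x) z X‖ ≤ C * (-r z) ^ b * N * ‖X‖) ∧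
          ∀ X Y, ‖D2 G z X Y - D2 (fun x => F x * e x) z X Y‖ ≤ C * (-r z) ^ b * N * ‖X‖ * ‖Y‖ := by
  set d := Module.finrank ℝ EC with hd
  obtain ⟨r1, C, K0, h0, h2, C0, K00, H⟩ := loc hΩ g (d + 2 + b) (by omega)
  obtain ⟨K, hK, hc⟩ := cauchy (n := n)
  rw [← hd] at hc
  have L1 := g.L1
  set C2 := K * C * (2 * Lp) ^ (d + 2)
  have C20 : 0 ≤ C2 := by positivity
  set r0 := min r1 (Real.exp (-1) / Lp)
  have hr1 : r0 ≤ r1 := min_le_left _ _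
  have hre : Lp * r0 ≤ Real.exp (-1) := by
    have : r0 ≤ _ := min_le_right _ _
    rwa [le_div_iff₀' bp] at this
  replace h2 : 2 * r0 ≤ R := by linarith
  refine ⟨r0, C + C2, K0, lt_min h0 bp, h2, hre, by positivity, K00, ?_⟩
  intro z hz F N hN hF hFN e he
  obtain ⟨G, hG, hGn, hGs⟩ := H z ⟨hz.1, ball_subset_ball hr1 hz.2⟩ F N hN hF hFN
  obtain ⟨hzR, t0, tL, hb⟩ := geo_z g h2 hz
  set t := -r z
  have t1 : t / (2 * Lp) ≤ 1 := by
    rw [div_le_one bp]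
    have := mem_ball_iff_norm.1 hzR
    nlinarith [g.R1]
  have hbD : ball z (t / (2 * Lp)) ⊆ Ω ∩ ball p R := hb.trans
    (inter_subset_inter_right _ (ball_subset_ball h2))
  have hzb : z ∈ ball z (t / (2 * Lp)) := mem_ball_self bp
  have dG := hG.mono (hbD.trans inter_subset_left)
  have de : Differentiable ℂ e := by rw [he]; exact ((g.dP z).const_mul _).cexp
  have dF : DifferentiableOn ℂ (fun x => F x * e x) (ball z (t / (2 * Lp))) :=
    (hF.mono hbD).mul de.differentiableOn
  subst he
  obtain ⟨j0, j1, j2⟩ := hc z _ bp t1 _ (C * t ^ (d + 2 + b) * N) bp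
    (dG.sub dF) hGs
  have cancel : ∀ {x q : ℝ}, (t / (2 * Lp)) ^ (d + 2) * x ≤ K * (C * t ^ (d + 2 + b) * N) * q → 0 ≤ q →
      x ≤ (C + C2) * t ^ b * N * q := by
    intro x q h hq
    have e1 : K * (C * t ^ (d + 2 + b) * N) * q = (t / (2 * Lp)) ^ (d + 2) * (C2 * t ^ b * N * q) := by
      simp only [C2, div_pow]
      field_simp
      ring
    rw [e1] at h
    refine (le_of_mul_le_mul_left h bp).trans ?_
    gcongr
    linarith
  have ds : ∀ {w X}, w ∈ ball z (t / (2 * Lp)) → fderiv ℂ (fun x => G x - F x * Complex.exp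
      ((K0 * -Real.log t : ℝ) * P z x)) w X = fderiv ℂ G w X - fderiv ℂ (fun x => F x * Complex.exp
      ((K0 * -Real.log t : ℝ) * P z x)) w X := fun {w X} hw => by
    rw [fderiv_fun_sub (hol_at isOpen_ball dG hw) (hol_at isOpen_ball dF hw)]; rfl
  refine ⟨G, hG, hGn.trans (ENNReal.ofReal_le_ofReal ?_), ?_, fun X => ?_, fun X Y => ?_⟩
  · have : 0 ≤ t * -Real.log t := by
      refine mul_nonneg t0.le (neg_nonneg.2 (Real.log_nonpos t0.le ?_))
      have h3 := mem_ball_iff_norm.1 hz.2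
      have h4 : Real.exp (-1) ≤ 1 := Real.exp_le_one_iff.2 bn
      have h5 : Lp * ‖z - p‖ ≤ Lp * r0 := by gcongr
      linarith
    gcongr
    linarith
  · have := cancel (j0.trans_eq (mul_one _).symm) zero_le_one
    rwa [mul_one] at this
  · rw [← ds hzb]
    exact cancel (j1 X) (norm_nonneg _)
  · have h4 := D2_lin (ι := Unit) isOpen_ball (fun _ => 1) hzb dG (fun _ => dF) X Y
    simp only [Finset.univ_unique, Finset.sum_const, Finset.card_singleton, one_smul, one_mul] at h4
    rw [← h4, mul_assoc]
    exact cancel (by rw [← mul_assoc]; exact j2 X Y) bp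

lemma nrm_lin {ι : Type*} [Fintype ι] {μ : Measure EC} {G : FC} {E : ι → FC}
    {c : ι → ℂ} {a b m : ℝ} (mG : AEStronglyMeasurable G μ) (mE : ∀ k, AEStronglyMeasurable (E k) μ)
    (ha : 0 ≤ a) (hb : 0 ≤ b) (hm : 0 ≤ m) (hG : ∫⁻ x, ‖G x‖ₑ ^ 2 ∂μ ≤ ENNReal.ofReal (a ^ 2))
    (hE : ∀ k, ∫⁻ x, ‖E k x‖ₑ ^ 2 ∂μ ≤ ENNReal.ofReal (b ^ 2)) (hc : ∀ k, ‖c k‖ ≤ m) :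
    ∫⁻ x, ‖G x - ∑ k, c k * E k x‖ₑ ^ 2 ∂μ ≤ ENNReal.ofReal ((a + Fintype.card ι * (m * b)) ^ 2) := by
  rw [l2_iff ha] at hG
  rw [l2_iff bp]
  have e1 : (fun x => G x - ∑ k, c k * E k x) = G - ∑ k, c k • E k := by
    ext x; simp
  rw [e1]
  refine (eLpNorm_sub_le mG (Finset.aestronglyMeasurable_sum _ fun k _ => (mE k).const_smul _)
    bn).trans ?_
  rw [ENNReal.ofReal_add ha bp]
  refine add_le_add hG ((eLpNorm_sum_le (fun k _ => (mE k).const_smul _) bn).trans ?_)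
  calc _ ≤ ∑ _k : ι, ENNReal.ofReal (m * b) := Finset.sum_le_sum fun k _ => by
        rw [eLpNorm_const_smul, ENNReal.ofReal_mul hm, ← ofReal_norm]
        gcongr
        · exact hc k
        · exact (l2_iff hb).1 (hE k)
    _ = _ := by
        rw [Finset.sum_const, nsmul_eq_mul, ENNReal.ofReal_mul (p := (Fintype.card ι : ℝ)) bp, ENNReal.ofReal_natCast]
        rfl

lemma fd_mul {f e : FC} {z : EC} (hf : DifferentiableAt ℂ f z) (he : DifferentiableAt ℂ e z)
    (X : EC) : fderiv ℂ (fun w => f w * e w) z X = f z * fderiv ℂ e z X + e z * fderiv ℂ f z X := by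
  rw [fderiv_fun_mul hf he]; simp

def cF (k : ℂ) (Q : FC) (z : EC) : Option (Fin n) → FC
  | none => fun w => 1 - k * Q w
  | some j => fun w => (w - z) j

def cJ (z : EC) (f : FC) : Option (Fin n) → ℂ
  | none => f z
  | some j => fderiv ℂ f z (ee j)

lemma crd (z : EC) (j : Fin n) (x : EC) :
    HasFDerivAt (fun w : EC => (w - z) j) ((EuclideanSpace.proj j : EC →L[ℂ] ℂ)) x := by
  have h : HasFDerivAt (fun w : EC => (EuclideanSpace.proj j : EC →L[ℂ] ℂ) (w - z)) _ x :=
    ((EuclideanSpace.proj j : EC →L[ℂ] ℂ)).hasFDerivAt.comp x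
      ((hasFDerivAt_id x).sub_const z)
  exact h.congr_fderiv (by ext; simp)

lemma cF_diff {k : ℂ} {Q : FC} (z : EC) (hQ : Differentiable ℂ Q) :
    ∀ i, Differentiable ℂ (cF k Q z i)
  | none => (hQ.const_mul k).const_sub 1
  | some j => fun x => (crd z j x).differentiableAt

lemma cF_jet {k : ℂ} {Q : FC} {z : EC} (hQ : Differentiable ℂ Q) (h0 : Q z = 0)
    (i l : Option (Fin n)) :
    cJ z (fun w => cF k Q z l w * Complex.exp (k * Q w)) i = if i = l then 1 else 0 := by
  have de : HasFDerivAt (fun w => Complex.exp (k * Q w)) _ z :=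
    ((hQ z).hasFDerivAt.const_mul k).cexp
  have h1 := fun X => fd_mul (cF_diff (k := k) z hQ l z) de.differentiableAt X
  have h2 : ∀ X, fderiv ℂ (cF k Q z none) z X = - (k * fderiv ℂ Q z X) := fun X => by
    have : HasFDerivAt (cF k Q z none) _ z := ((hQ z).hasFDerivAt.const_mul k).const_sub 1
    rw [this.fderiv]; simp
  have h3 : ∀ j X, fderiv ℂ (cF k Q z (some j)) z X = X j := fun j X => by
    have : HasFDerivAt (cF k Q z (some j)) _ z := crd z j z
    rw [this.fderiv]; simp
  rw [de.fderiv] at h1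
  rcases i with _ | i <;> rcases l with _ | l
  · simp [cJ, cF, h0]
  · simp [cJ, cF]
  · simp only [cJ, h1, h2]; simp [cF, h0]
  · simp only [cJ, h1, h3]; simp [cF, h0, ee, Pi.single_apply, eq_comm]

lemma cJ_le {z : EC} {f h : FC} {m : ℝ} (h0 : ‖f z - h z‖ ≤ m)
    (h1 : ∀ X, ‖fderiv ℂ f z X - fderiv ℂ h z X‖ ≤ m * ‖X‖) : ∀ i, ‖cJ z f i - cJ z h i‖ ≤ m
  | none => h0
  | some j => (h1 (ee j)).trans_eq (by simp [ee])

set_option maxHeartbeats 1000000 in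
lemma star {Ω : SC} {p : EC} {V : SC} {R : ℝ} {r : FR}
    {P : EC → FC} {c Lp : ℝ} (hΩ : IsPseudoconvex Ω) (g : Geo Ω p V R r P c Lp) :
    ∃ r0 C : ℝ, 0 < r0 ∧ 2 * r0 ≤ R ∧ Lp * r0 ≤ Real.exp (-1) ∧ 0 ≤ C ∧
      ∀ z ∈ Ω ∩ ball p r0, ∀ f : FC, DifferentiableOn ℂ f (Ω ∩ ball p R) →
        ∫⁻ x in Ω ∩ ball p R, ‖f x‖ₑ ^ 2 ≤ 1 → f z = 0 → fderiv ℂ f z = 0 →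
        ∃ G, DifferentiableOn ℂ G Ω ∧
          ∫⁻ x in Ω, ‖G x‖ₑ ^ 2 ≤ ENNReal.ofReal ((1 + C * (-r z * -Real.log (-r z))) ^ 2) ∧
          G z = 0 ∧ fderiv ℂ G z = 0 ∧
          ∀ X Y, ‖D2 f z X Y - D2 G z X Y‖ ≤ C * -r z * ‖X‖ * ‖Y‖ := by
  set d := Module.finrank ℝ EC with hd
  obtain ⟨r1, C1, K0, h0, h2, hre, C10, K00, H⟩ := ext1 hΩ g (d + 4)
  obtain ⟨K, hK, hc⟩ := cauchy (n := n)
  rw [← hd] at hc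
  have L1 := g.L1
  set v := √(volume (ball p R)).toReal
  have v0 : 0 ≤ v := Real.sqrt_nonneg _
  set m3 := 3 + K0 * Lp
  set C3 := m3 * v
  have C30 : 0 ≤ C3 := by positivity
  set q : ℝ := ((Fintype.card (Option (Fin n)) : ℕ) : ℝ)
  have q0 : 0 ≤ q := Nat.cast_nonneg _
  set Q := q * (C1 * C3)
  have Q0 : 0 ≤ Q := by positivity
  set r0 := min r1 (1 / (2 * (Q + 1) * Lp))
  have hr1 : r0 ≤ r1 := min_le_left _ _
  have hrQ : 2 * (Q + 1) * Lp * r0 ≤ 1 := by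
    have : r0 ≤ _ := min_le_right _ _
    rwa [le_div_iff₀' bp] at this
  replace h2 : 2 * r0 ≤ R := by linarith
  replace hre : Lp * r0 ≤ Real.exp (-1) := by
    have : Lp * r0 ≤ Lp * r1 := by gcongr
    linarith
  set C := C1 + 2 * Q * (1 + C1) * (1 + K * (2 * Lp) ^ (d + 2))
  refine ⟨r0, C, lt_min h0 bp, h2, hre, by positivity, ?_⟩
  intro z hz f hf hfN fz fz'
  obtain ⟨hzR, t0, tL, hb⟩ := geo_z g h2 hz
  have hH := H z ⟨hz.1, ball_subset_ball hr1 hz.2⟩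
  have hPz := g.bP z hzR
  have P0 := g.P0 z
  set t := -r z with ht
  have hz2 := mem_ball_iff_norm.1 hz.2
  have tr : t ≤ Lp * r0 := tL.trans (by gcongr)
  have te : t ≤ Real.exp (-1) := tr.trans hre
  have t1 : t ≤ 1 := te.trans (Real.exp_le_one_iff.2 bn)
  have tQ : Q * t ≤ 1 / 2 := by nlinarith
  have hL1 : 1 ≤ -Real.log t := by
    have := Real.log_le_log t0 te
    rw [Real.log_exp] at this; linarith
  have hLt : -Real.log t ≤ 1 / t := by
    have := Real.one_sub_inv_le_log_of_pos t0
    rw [one_div]; linarith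
  set L := -Real.log t
  have htL : t * L ≤ 1 := by
    rw [le_div_iff₀' t0] at hLt; exact hLt
  have hpw : ∀ m : ℕ, t ^ (m + 1) ≤ t := fun m => by
    calc t ^ (m + 1) ≤ t ^ 1 := pow_le_pow_of_le_one t0.le t1 (by omega)
      _ = t := pow_one t
  have oD : IsOpen (Ω ∩ ball p R) := hΩ.1.inter isOpen_ball
  have hzD : z ∈ Ω ∩ ball p R := ⟨hz.1, hzR⟩
  set k : ℂ := ((K0 * L : ℝ) : ℂ) with hk
  set e : FC := fun x => Complex.exp (k * P z x) with he
  have de : Differentiable ℂ e := ((g.dP z).const_mul _).cexp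
  have ez : e z = 1 := by simp [he, P0]
  have hF : ∀ i, ∫⁻ x in Ω ∩ ball p R, ‖cF k (P z) z i x‖ₑ ^ 2 ≤ ENNReal.ofReal ((C3 / t) ^ 2) := by
    intro i
    have h3 : C3 / t = m3 / t * v := by simp only [C3]; ring
    rw [h3]
    refine bdd_l2 inter_subset_right measurableSet_ball measure_ball_lt_top.ne bp fun x hx => ?_
    rw [le_div_iff₀ t0]
    rcases i with _ | j
    · have h4 : ‖k‖ = K0 * L := by
        rw [hk, Complex.norm_real, Real.norm_of_nonneg bp]
      have h5 : ‖1 - k * P z x‖ ≤ 1 + K0 * L * Lp := by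
        refine (norm_sub_le _ _).trans ?_
        rw [norm_one, norm_mul, h4]
        gcongr
        exact (hPz x hx).2
      have h6 : K0 * Lp * (t * L) ≤ K0 * Lp * 1 := by gcongr
      calc _ ≤ (1 + K0 * L * Lp) * t := by gcongr; exact h5
        _ ≤ _ := by simp only [m3]; nlinarith
    · have h5 : ‖(x - z) j‖ ≤ ‖x - z‖ := PiLp.norm_apply_le _ _
      have h6 := norm_sub_le_norm_sub_add_norm_sub x p z
      rw [norm_sub_rev p z] at h6
      have h7 := mem_ball_iff_norm.1 hx
      have h8 := mem_ball_iff_norm.1 hzR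
      have h9 : ‖cF k (P z) z (some j) x‖ ≤ 2 := h5.trans (by linarith [g.R1])
      have : 0 ≤ K0 * Lp := by positivity
      have := mul_le_mul h9 t1 t0.le zero_le_two
      simp only [m3]; linarith
  choose E hE hEn hE0 hE1 hE2 using fun i => hH (cF k (P z) z i) (C3 / t) bp
    (cF_diff z (g.dP z) i).differentiableOn (hF i) e rfl
  obtain ⟨G0, hG, hGn, hG0, hG1, hG2⟩ := hH f 1 zero_le_one hf (by simpa using hfN) e rfl
  simp only [mul_one] at hGn hG0 hG1 hG2
  have hm1 : C1 * t ^ (d + 4) * (C3 / t) ≤ C1 * C3 * t := by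
    have : C1 * t ^ (d + 4) * (C3 / t) = C1 * C3 * t ^ (d + 2 + 1) := by field_simp; ring
    rw [this]
    gcongr
    exact hpw _
  have ha : ∀ i l, ‖cJ z (E l) i - if i = l then 1 else 0‖ ≤ C1 * C3 * t := fun i l => by
    rw [← cF_jet (k := k) (g.dP z) P0 i l]
    exact (cJ_le (hE0 l) (hE1 l) i).trans hm1
  have fe0 : ∀ X, fderiv ℂ (fun x => f x * e x) z X = 0 := fun X => by
    rw [fd_mul (hol_at oD hf hzD) (de z), fz, fz']; simp
  have hy : ∀ i, ‖cJ z G0 i‖ ≤ C1 * t ^ (d + 4) := fun i => by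
    have h3 := cJ_le hG0 hG1 i
    have h4 : cJ z (fun x => f x * e x) i = 0 := by
      rcases i with _ | j
      · simp [cJ, fz]
      · simp only [cJ, fe0]
    rwa [h4, sub_zero] at h3
  obtain ⟨a, ha1, ha2⟩ := lin_solve (fun i l => cJ z (E l) i) ha (by
    show q * _ ≤ _
    calc _ = Q * t := by simp only [Q]; ring
      _ ≤ _ := tQ) (cJ z G0) bp hy
  have dE : ∀ i, DifferentiableAt ℂ (E i) z := fun i => hol_at hΩ.1 (hE i) hz.1
  have dG0 := hol_at hΩ.1 hG hz.1
  have m1 : ∀ {F : FC}, DifferentiableOn ℂ F Ω → AEStronglyMeasurable F (volume.restrict Ω) :=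
    fun hF => hF.continuousOn.aestronglyMeasurable hΩ.1.measurableSet
  have hT0 : 0 ≤ t * L := by positivity
  have hT1 : t ≤ t * L := le_mul_of_one_le_right t0.le hL1
  refine ⟨fun w => G0 w - ∑ i, a i * E i w, ?_, ?_, ?_, ?_, ?_⟩
  · exact hG.sub (DifferentiableOn.fun_sum fun i _ => (hE i).const_mul (a i))
  · refine (nrm_lin (m1 hG) (fun i => m1 (hE i)) bp bp bp
      hGn hEn ha2).trans (ENNReal.ofReal_le_ofReal (pow_le_pow_left₀ bp ?_ 2))
    have h3 : q * (2 * (C1 * t ^ (d + 4)) * ((1 + C1 * (t * L)) * (C3 / t))) ≤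
        2 * Q * (1 + C1) * (t * L) := by
      calc _ = 2 * q * (C1 * t ^ (d + 4) * (C3 / t)) * (1 + C1 * (t * L)) := by ring
        _ ≤ 2 * q * (C1 * C3 * (t * L)) * (1 + C1 * 1) := by
          have := hm1.trans (mul_le_mul_of_nonneg_left hT1 (mul_nonneg C10 C30))
          gcongr
        _ = _ := by simp only [Q]; ring
    have h4 : 0 ≤ 2 * Q * (1 + C1) * (K * (2 * Lp) ^ (d + 2)) * (t * L) := by positivity
    show 1 + C1 * (t * L) + q * _ ≤ _
    simp only [C]
    linarith
  · have := ha1 none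
    simp only [cJ] at this
    simp [this]
  · have h3 : ∀ j, fderiv ℂ (fun w => G0 w - ∑ i, a i * E i w) z (ee j) = 0 := fun j => by
      have := ha1 (some j)
      simp only [cJ] at this
      rw [fd_lin a dG0 dE, this, sub_self]
    ext X
    rw [sum_ee X, map_sum]
    exact Finset.sum_eq_zero fun j _ => by rw [map_smul, h3, smul_zero]
  · intro X Y
    rw [D2_lin hΩ.1 a hz.1 hG hE]
    have h3 : D2 (fun x => f x * e x) z X Y = D2 f z X Y := by
      rw [D2_mul oD hzD hf de.differentiableOn, fz, fz', ez]; simp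
    have h4 : ∀ i, ‖a i * D2 (E i) z X Y‖ ≤
        2 * C1 * C3 * (1 + C1) * K * (2 * Lp) ^ (d + 2) * t * ‖X‖ * ‖Y‖ := fun i => by
      have s1 : t / (2 * Lp) ≤ 1 := by
        rw [div_le_one bp]; linarith
      have h5 := ((hc z _ bp s1 (E i) ((1 + C1) * (C3 / t)) bp
        ((hE i).mono (hb.trans inter_subset_left)) ((lintegral_mono_set
          (hb.trans inter_subset_left)).trans ((hEn i).trans (ENNReal.ofReal_le_ofReal (by
            gcongr
            exact mul_le_of_le_one_right C10 htL))))).2.2 X Y)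
      rw [norm_mul]
      calc _ ≤ 2 * (C1 * t ^ (d + 4)) * ‖D2 (E i) z X Y‖ := by gcongr; exact ha2 i
        _ = 2 * C1 * t ^ 2 * (2 * Lp) ^ (d + 2) * ((t / (2 * Lp)) ^ (d + 2) * ‖D2 (E i) z X Y‖) := by
          rw [div_pow]; field_simp; ring
        _ ≤ 2 * C1 * t ^ 2 * (2 * Lp) ^ (d + 2) * (K * ((1 + C1) * (C3 / t)) * ‖X‖ * ‖Y‖) := by gcongr
        _ = _ := by field_simp
    have h6 : ‖∑ i, a i * D2 (E i) z X Y‖ ≤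
        q * (2 * C1 * C3 * (1 + C1) * K * (2 * Lp) ^ (d + 2) * t * ‖X‖ * ‖Y‖) := by
      refine (norm_sum_le _ _).trans ((Finset.sum_le_sum fun i _ => h4 i).trans_eq ?_)
      rw [Finset.sum_const, nsmul_eq_mul]; rfl
    have h7 := hG2 X Y
    rw [h3] at h7
    have h8 : C1 * t ^ (d + 4) * ‖X‖ * ‖Y‖ ≤ C1 * t * ‖X‖ * ‖Y‖ := by
      have := hpw (d + 3)
      have : C1 * t ^ (d + 4) ≤ C1 * t := mul_le_mul_of_nonneg_left this C10
      gcongr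
    have h9 : D2 f z X Y - (D2 G0 z X Y - ∑ i, a i * D2 (E i) z X Y) =
      -(D2 G0 z X Y - D2 f z X Y) + ∑ i, a i * D2 (E i) z X Y := by ring
    rw [h9]
    refine (norm_add_le _ _).trans ?_
    rw [norm_neg]
    have h10 : 0 ≤ 2 * Q * (1 + C1) * t * ‖X‖ * ‖Y‖ := by positivity
    have h11 : C * t * ‖X‖ * ‖Y‖ = C1 * t * ‖X‖ * ‖Y‖ + 2 * Q * (1 + C1) * t * ‖X‖ * ‖Y‖ +
      q * (2 * C1 * C3 * (1 + C1) * K * (2 * Lp) ^ (d + 2) * t * ‖X‖ * ‖Y‖) := by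
      simp only [C, Q]; ring
    linarith

lemma tlog {t x : ℝ} (t0 : 0 < t) (tx : t ≤ x) (hx : x ≤ Real.exp (-1)) :
    t * -Real.log t ≤ x * -Real.log x := by
  have x0 : 0 < x := t0.trans_le tx
  have h1 : 1 ≤ -Real.log x := by
    have := Real.log_le_log x0 hx
    rw [Real.log_exp] at this; linarith
  have h2 := Real.log_le_sub_one_of_pos (div_pos x0 t0)
  rw [Real.log_div x0.ne' t0.ne'] at h2
  have h3 : t * (x / t) = x := by field_simp
  nlinarith

lemma tdist {Ω : SC} {p : EC} {V : SC} {R : ℝ} {r : FR}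
    {P : EC → FC} {c Lp : ℝ} (hΩ : IsOpen Ω) (hp : p ∈ frontier Ω)
    (g : Geo Ω p V R r P c Lp) {r0 : ℝ} (h2 : 2 * r0 ≤ R) {z : EC} (hz : z ∈ Ω ∩ ball p r0) :
    -r z ≤ Lp * bdist Ω z ∧ bdist Ω z ≤ ‖z - p‖ := by
  obtain ⟨hzR, t0, tL, hb⟩ := geo_z g h2 hz
  have h1 : bdist Ω z ≤ ‖z - p‖ := by
    rw [← dist_eq_norm]; exact infDist_le_dist_of_mem hp
  refine ⟨?_, h1⟩
  obtain ⟨q, hq, hqd⟩ := isClosed_frontier.exists_infDist_eq_dist ⟨p, hp⟩ z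
  have hd : bdist Ω z = ‖z - q‖ := by rw [← dist_eq_norm]; exact hqd
  rw [hd] at h1 ⊢
  have hz2 := mem_ball_iff_norm.1 hz.2
  have hqR : q ∈ ball p R := by
    rw [mem_ball_iff_norm]
    have := norm_sub_le_norm_sub_add_norm_sub q z p
    rw [norm_sub_rev q z] at this
    linarith
  have hqΩ : q ∉ Ω := fun h => by
    rw [hΩ.frontier_eq] at hq; exact hq.2 h
  have h3 : 0 ≤ r q := not_lt.1 fun h => hqΩ ((g.iff q hqR).2 h)
  have h4 := (abs_le.1 (g.lip z hzR q hqR)).1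
  linarith

lemma le_J2 {D : SC} {z : EC} {s : ℝ} (s0 : 0 < s) (s1 : s ≤ 1) (hb : ball z s ⊆ D)
    (X Y : EC) : BddAbove {v : ℝ | ∃ f : FC, DifferentiableOn ℂ f D ∧ L2normSq D f ≤ 1 ∧ f z = 0 ∧
    fderiv ℂ f z = 0 ∧ v = ‖fderiv ℂ (fun w => fderiv ℂ f w Y) z X‖ ^ 2} := by
  obtain ⟨K, hK, hc⟩ := cauchy (n := n)
  refine ⟨(K * 1 * ‖X‖ * ‖Y‖ / s ^ (Module.finrank ℝ EC + 2)) ^ 2, ?_⟩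
  rintro v ⟨f, hf, hn, -, -, rfl⟩
  have := (hc z s s0 s1 f 1 zero_le_one (hf.mono hb) ((lintegral_mono_set hb).trans
    (hn.trans (by simp)))).2.2 X Y
  refine pow_le_pow_left₀ (norm_nonneg _) ?_ 2
  rw [le_div_iff₀' bp]
  exact this

lemma J2_ne (D : SC) (z X Y : EC) : {v : ℝ | ∃ f : FC, DifferentiableOn ℂ f D ∧
    L2normSq D f ≤ 1 ∧ f z = 0 ∧
    fderiv ℂ f z = 0 ∧ v = ‖fderiv ℂ (fun w => fderiv ℂ f w Y) z X‖ ^ 2}.Nonempty :=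
  ⟨_, fun _ => 0, differentiableOn_const _, by simp [L2normSq], rfl, by simp, rfl⟩

lemma testf {V : SC} (hV : Bornology.IsBounded V) (p : EC) : ∃ c5 : ℝ, 0 < c5 ∧
    ∀ z ∈ ball p 1, ∀ X Y : EC, X ≠ 0 → Y ≠ 0 → ∃ f : FC, Differentiable ℂ f ∧
      ∫⁻ x in V, ‖f x‖ₑ ^ 2 ≤ 1 ∧ f z = 0 ∧ fderiv ℂ f z = 0 ∧ c5 * ‖X‖ * ‖Y‖ ≤ ‖D2 f z X Y‖ := by
  obtain ⟨ρ', hρ'⟩ := hV.subset_closedBall p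
  set ρ := max ρ' 0
  have ρ0 : 0 ≤ ρ := le_max_right _ _
  have hρ : V ⊆ closedBall p ρ := hρ'.trans (closedBall_subset_closedBall (le_max_left _ _))
  set v := √(volume (closedBall p ρ)).toReal
  have v0 : 0 ≤ v := Real.sqrt_nonneg _
  set c5 := 1 / ((ρ + 1) ^ 2 * (v + 1))
  have c50 : 0 < c5 := by positivity
  refine ⟨c5, c50, fun z hz X Y hX hY => ?_⟩
  have X0 := norm_pos_iff.2 hX
  have Y0 := norm_pos_iff.2 hY
  set ε := c5 / (‖X‖ * ‖Y‖)
  have ε0 : 0 < ε := by positivity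
  have hd : ∀ (A w : EC), HasFDerivAt (fun w => innerSL ℂ A (w - z)) (innerSL ℂ A) w := fun A w => by
    have h : HasFDerivAt (fun w => innerSL ℂ A (w - z)) _ w :=
      (innerSL ℂ A).hasFDerivAt.comp w ((hasFDerivAt_id w).sub_const z)
    exact h.congr_fderiv (by ext; simp)
  set a : FC := fun w => (ε : ℂ) * innerSL ℂ X (w - z)
  set b : FC := fun w => innerSL ℂ Y (w - z)
  have ha : ∀ w, HasFDerivAt a ((ε : ℂ) • innerSL ℂ X) w := fun w => (hd X w).const_mul _
  have hb : ∀ w, HasFDerivAt b (innerSL ℂ Y) w := hd Y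
  have da : Differentiable ℂ a := fun w => (ha w).differentiableAt
  have dbb : Differentiable ℂ b := fun w => (hb w).differentiableAt
  have az : a z = 0 := by simp [a]
  have bz : b z = 0 := by simp [b]
  refine ⟨fun w => a w * b w, da.mul dbb, ?_, by simp [az], ?_, ?_⟩
  · refine (bdd_l2 (m := ε * (‖X‖ * ‖Y‖) * (ρ + 1) ^ 2) hρ measurableSet_closedBall
      measure_closedBall_lt_top.ne bp fun x hx => ?_).trans ?_
    · have h1 : ‖x - z‖ ≤ ρ + 1 := by
        have := norm_sub_le_norm_sub_add_norm_sub x p z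
        rw [norm_sub_rev p z] at this
        linarith [mem_ball_iff_norm.1 hz, mem_closedBall_iff_norm.1 hx]
      have h2 := norm_inner_le_norm (𝕜 := ℂ) X (x - z)
      have h3 := norm_inner_le_norm (𝕜 := ℂ) Y (x - z)
      have h4 : ‖a x * b x‖ = ε * ‖inner ℂ X (x - z)‖ * ‖inner ℂ Y (x - z)‖ := by
        simp [a, b, abs_of_pos ε0, inner_sub_right]
      rw [h4]
      calc _ ≤ ε * (‖X‖ * ‖x - z‖) * (‖Y‖ * ‖x - z‖) := by gcongr
        _ = ε * (‖X‖ * ‖Y‖) * ‖x - z‖ ^ 2 := by ring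
        _ ≤ _ := by gcongr
    · have h1 : ε * (‖X‖ * ‖Y‖) * (ρ + 1) ^ 2 * v ≤ 1 := by
        have : ε * (‖X‖ * ‖Y‖) * (ρ + 1) ^ 2 * v = v / (v + 1) := by
          simp only [ε, c5]; field_simp
        rw [this, div_le_one bp]; linarith
      rw [ENNReal.ofReal_le_one]
      exact pow_le_one₀ bp h1
  · ext A
    rw [fd_mul (da z) (dbb z), az, bz]; simp
  · rw [D2_mul isOpen_univ (mem_univ z) da.differentiableOn dbb.differentiableOn, az, bz,
      (ha z).fderiv, (hb z).fderiv]
    have h1 : inner ℂ Y X * inner ℂ X Y = ((‖inner ℂ X Y‖ ^ 2 : ℝ) : ℂ) := by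
      rw [← inner_conj_symm Y X, ← Complex.normSq_eq_conj_mul_self, Complex.normSq_eq_norm_sq]
    have h2 : (0 : ℂ) * D2 b z X Y + ((ε : ℂ) • innerSL ℂ X) X * (innerSL ℂ Y) Y +
        (0 * D2 a z X Y + (innerSL ℂ Y) X * ((ε : ℂ) • innerSL ℂ X) Y) =
        ((ε * (‖X‖ ^ 2 * ‖Y‖ ^ 2 + ‖inner ℂ X Y‖ ^ 2) : ℝ) : ℂ) := by
      simp only [zero_mul, zero_add, ContinuousLinearMap.smul_apply, innerSL_apply_apply, smul_eq_mul]
      rw [inner_self_eq_norm_sq_to_K, inner_self_eq_norm_sq_to_K]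
      calc _ = (ε : ℂ) * ((‖X‖ : ℂ) ^ 2 * (‖Y‖ : ℂ) ^ 2 + inner ℂ Y X * inner ℂ X Y) := by
            simp; ring
        _ = _ := by rw [h1]; push_cast; ring
    rw [h2, Complex.norm_real, Real.norm_of_nonneg bp]
    calc c5 * ‖X‖ * ‖Y‖ = ε * (‖X‖ ^ 2 * ‖Y‖ ^ 2 + 0) := by simp only [ε]; field_simp; simp
      _ ≤ _ := by gcongr; positivity

lemma mainJ (Ω : SC) (hpsc : IsPseudoconvex Ω)
    (p : EC) (hp : IsStrictPscPtC2 Ω p)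
    (V : SC) (hV : V ∈ 𝓝 p) (hVbdd : Bornology.IsBounded V) :
    ∃ (U : SC) (C : ℝ), U ⊆ V ∧ U ∈ 𝓝 p ∧ 0 < C ∧
      ∀ z ∈ Ω ∩ U, ∀ X Y : EC, X ≠ 0 → Y ≠ 0 →
        J2 Ω z X Y / J2 (Ω ∩ V) z X Y ≤ 1 ∧
        1 + C * bdist Ω z * Real.log (bdist Ω z) ≤ J2 Ω z X Y / J2 (Ω ∩ V) z X Y := by
  obtain ⟨R, a0, a1, a2, r, P, c, Lp, a3, a4, a5, a6, a7, a8, a9, a10, a11, a12⟩ := geom hpsc.1 hp hV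
  have g : Geo Ω p V R r P c Lp := ⟨a0, a1, a2, a3, a4, a5, a6, a7, a8, a9, a10, a11, a12⟩
  obtain ⟨r0, C, h0, h2, hre, C0, H⟩ := star hpsc g
  obtain ⟨c5, c50, T⟩ := testf hVbdd p
  have L1 := g.L1
  have R1 := g.R1
  refine ⟨ball p r0, 2 * (C + C / c5) * Lp + 1, (ball_subset_ball (by linarith)).trans g.sV,
    ball_mem_nhds p h0, by positivity, ?_⟩
  intro z hz X Y hX hY
  have X0 := norm_pos_iff.2 hX
  have Y0 := norm_pos_iff.2 hY
  obtain ⟨hzR, t0, tL, hb⟩ := geo_z g h2 hz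
  obtain ⟨td, dz⟩ := tdist hpsc.1 hp.1 g h2 hz
  have hH := H z hz
  set t := -r z
  set δ := bdist Ω z
  have hz2 := mem_ball_iff_norm.1 hz.2
  have xe : Lp * δ ≤ Real.exp (-1) := le_trans (by gcongr; linarith) hre
  have e1 : Real.exp (-1) ≤ 1 := Real.exp_le_one_iff.2 bn
  have δ0 : 0 < δ := by
    by_contra h
    nlinarith [mul_nonneg (zero_le_one.trans L1) (neg_nonneg.2 (not_lt.1 h))]
  have δ1 : δ ≤ 1 := by nlinarith
  have lδ : 0 ≤ δ * -Real.log δ := mul_nonneg δ0.le (neg_nonneg.2 (Real.log_nonpos δ0.le δ1))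
  have tl : t * -Real.log t ≤ Lp * (δ * -Real.log δ) := by
    refine (tlog t0 td xe).trans ?_
    rw [Real.log_mul bp δ0.ne']
    have := mul_nonneg (mul_nonneg (zero_le_one.trans L1) δ0.le) (Real.log_nonneg L1)
    linarith
  have hL1 : t ≤ t * -Real.log t := by
    refine le_mul_of_one_le_right t0.le ?_
    have := Real.log_le_log t0 (td.trans xe)
    rw [Real.log_exp] at this; linarith
  have s1 : t / (2 * Lp) ≤ 1 := by
    rw [div_le_one bp]; linarith
  have s0 : 0 < t / (2 * Lp) := by positivity
  have hbR : ball z (t / (2 * Lp)) ⊆ Ω ∩ ball p R :=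
    hb.trans (inter_subset_inter_right _ (ball_subset_ball h2))
  have hDV : Ω ∩ ball p R ⊆ Ω ∩ V := inter_subset_inter_right _ g.sV
  have bV := le_J2 s0 s1 (hbR.trans hDV) X Y
  have bΩ := le_J2 s0 s1 (hbR.trans inter_subset_left) X Y
  have J1 : J2 Ω z X Y ≤ J2 (Ω ∩ V) z X Y := by
    refine csSup_le_csSup bV (J2_ne Ω z X Y) ?_
    rintro v ⟨f, hf, hn, h⟩
    exact ⟨f, hf.mono inter_subset_left, (lintegral_mono_set inter_subset_left).trans hn, h⟩
  have J0 : (c5 * ‖X‖ * ‖Y‖) ^ 2 ≤ J2 (Ω ∩ V) z X Y := by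
    obtain ⟨f, f1, f2, f3, f4, f5⟩ := T z (ball_subset_ball R1 hzR) X Y hX hY
    refine le_trans (pow_le_pow_left₀ bp f5 2) (le_csSup bV ?_)
    exact ⟨f, f1.differentiableOn, (lintegral_mono_set inter_subset_right).trans f2, f3, f4, rfl⟩
  have JΩ : 0 ≤ J2 Ω z X Y := by
    obtain ⟨v, hv⟩ := J2_ne Ω z X Y
    refine le_csSup_of_le bΩ hv ?_
    obtain ⟨f, -, -, -, -, rfl⟩ := hv
    positivity
  set JW := J2 (Ω ∩ V) z X Y with hJW
  set JO := J2 Ω z X Y with hJO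
  have JW0 : 0 < JW := lt_of_lt_of_le bp J0
  set u := √JO
  set s := √JW
  have u0 : 0 ≤ u := Real.sqrt_nonneg _
  have s0 : 0 < s := Real.sqrt_pos.2 JW0
  have us : u ≤ s := Real.sqrt_le_sqrt J1
  have cs : c5 * ‖X‖ * ‖Y‖ ≤ s := Real.le_sqrt_of_sq_le J0
  have tl0 : 0 ≤ t * -Real.log t := t0.le.trans hL1
  set m := 1 + C * (t * -Real.log t)
  have m0 : 0 < m := by positivity
  have key : s ≤ m * u + C * t * ‖X‖ * ‖Y‖ := by
    refine Real.sqrt_le_iff.2 ⟨by positivity, csSup_le (J2_ne _ z X Y) ?_⟩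
    rintro v ⟨f, hf, hn, f0, f1, rfl⟩
    refine pow_le_pow_left₀ (norm_nonneg _) ?_ 2
    obtain ⟨G, hG, hGn, G0, G1, hG2⟩ := hH f (hf.mono hDV) ((lintegral_mono_set hDV).trans hn) f0 f1
    have h3 : ‖D2 G z X Y‖ ≤ m * u := by
      have q1 : ∀ w ∈ Ω, ∀ A, fderiv ℂ (fun w => (m : ℂ)⁻¹ * G w) w A = (m : ℂ)⁻¹ * fderiv ℂ G w A := by
        intro w hw A
        rw [fderiv_const_mul (hol_at hpsc.1 hG hw)]; simp
      have q2 : D2 (fun w => (m : ℂ)⁻¹ * G w) z X Y = (m : ℂ)⁻¹ * D2 G z X Y := by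
        unfold D2
        have : (fun w => fderiv ℂ (fun w => (m : ℂ)⁻¹ * G w) w Y) =ᶠ[𝓝 z]
            fun w => (m : ℂ)⁻¹ * fderiv ℂ G w Y := by
          filter_upwards [hpsc.1.mem_nhds hz.1] with w hw using q1 w hw Y
        rw [this.fderiv_eq, fderiv_const_mul (hol_at hpsc.1 (hol_fd hpsc.1 hG Y) hz.1)]; simp
      have q3 : ‖D2 (fun w => (m : ℂ)⁻¹ * G w) z X Y‖ ^ 2 ≤ JO := by
        refine le_csSup bΩ ⟨fun w => (m : ℂ)⁻¹ * G w, hG.const_mul _, ?_, by simp [G0], ?_, rfl⟩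
        · have : L2normSq Ω (fun w => (m : ℂ)⁻¹ * G w) = ENNReal.ofReal (m⁻¹ ^ 2) * ∫⁻ x in Ω, ‖G x‖ₑ ^ 2 := by
            rw [← lintegral_const_mul' _ _ ENNReal.ofReal_ne_top]
            refine lintegral_congr fun x => ?_
            show ‖(m : ℂ)⁻¹ * G x‖ₑ ^ 2 = _
            rw [enorm_mul, mul_pow, ENNReal.ofReal_pow bp, ← ofReal_norm (m : ℂ)⁻¹, norm_inv,
              Complex.norm_real, Real.norm_of_nonneg m0.le]
          rw [this]
          refine (mul_le_mul_right hGn _).trans ?_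
          rw [← ENNReal.ofReal_mul bp, ← mul_pow, inv_mul_cancel₀ m0.ne']
          simp
        · ext A
          rw [q1 z hz.1 A, G1]; simp
      have q4 := Real.le_sqrt_of_sq_le q3
      rw [q2, norm_mul, norm_inv, Complex.norm_real, Real.norm_of_nonneg m0.le,
        inv_mul_le_iff₀ m0] at q4
      exact q4
    have h4 := norm_sub_norm_le (D2 f z X Y) (D2 G z X Y)
    have h5 := hG2 X Y
    show ‖D2 f z X Y‖ ≤ _
    linarith
  refine ⟨(div_le_one JW0).2 J1, ?_⟩
  have k1 : C * t * ‖X‖ * ‖Y‖ ≤ C / c5 * (t * -Real.log t) * s := by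
    calc C * t * ‖X‖ * ‖Y‖ = C / c5 * t * (c5 * ‖X‖ * ‖Y‖) := by field_simp
      _ ≤ _ := by gcongr
  have k2 : C * (t * -Real.log t) * u ≤ C * (t * -Real.log t) * s := by gcongr
  have k3 : (C + C / c5) * (t * -Real.log t) ≤ (C + C / c5) * (Lp * (δ * -Real.log δ)) := by gcongr
  have k4 : 1 - (C + C / c5) * (t * -Real.log t) ≤ u / s := by
    rw [le_div_iff₀ s0]
    simp only [m] at key
    linarith
  have k5 : JO / JW = (u / s) ^ 2 := by
    rw [div_pow, Real.sq_sqrt JΩ, Real.sq_sqrt JW0.le]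
  rw [k5]
  nlinarith [sq_nonneg (u / s - 1)]

end

/-- Localization of `J²` near a `C²`-smooth strictly pseudoconvex boundary
point of a pseudoconvex domain. -/
theorem localization_J2 (n : ℕ) (Ω : Set (Cn n)) (hpsc : IsPseudoconvex Ω) (hconn : IsConnected Ω)
    (p : Cn n) (hp : IsStrictPscPtC2 Ω p)
    (V : Set (Cn n)) (hV : V ∈ nhds p) (hVbdd : Bornology.IsBounded V) :
    ∃ (U : Set (Cn n)) (C : ℝ), U ⊆ V ∧ U ∈ nhds p ∧ 0 < C ∧
      ∀ z ∈ Ω ∩ U, ∀ X Y : Cn n, X ≠ 0 → Y ≠ 0 →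
        J2 Ω z X Y / J2 (Ω ∩ V) z X Y ≤ 1 ∧ 1 + C * bdist Ω z * Real.log (bdist Ω z) ≤ J2 Ω z X Y / J2 (Ω ∩ V) z X Y := by
  exact mainJ Ω hpsc p hp V hV hVbdd

end
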